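/- arXiv:2101.08356 — 2 statements merged into one kernel-verified Lean document; each statement's English description precedes it below -/
import Mathlib

section
/- For each integer n with 1 ≤ n ≤ 20, the n-th excited state is unique: if b₁ and b₂ are both real numbers greater than √2 such that the solutions y_{b₁} and y_{b₂} are each n-th excited states (nonzero solutions tending to 0 at infinity with exactly n zeros on (0,∞)), then b₁ = b₂. -/
noncomputable section

/-- `y` solves the ODE `y'' + (2/t) y' + (y^3 - y) = 0` on `(0,∞)` with
`y(0) = b`, `y'(0) = 0`. -/
def IsSolution (b : ℝ) (y : ℝ → ℝ) : Prop :=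
  y 0 = b ∧ deriv y 0 = 0 ∧
  (∀ t : ℝ, 0 ≤ t → DifferentiableAt ℝ y t) ∧
  (∀ t : ℝ, 0 < t → DifferentiableAt ℝ (deriv y) t) ∧
  ∀ t : ℝ, 0 < t →
    deriv (deriv y) t + (2 / t) * deriv y t + ((y t) ^ 3 - y t) = 0

/-- The energy `E(t) = (1/2) y'(t)^2 + (1/4) y(t)^4 - (1/2) y(t)^2`. -/
def energy (y : ℝ → ℝ) (t : ℝ) : ℝ :=
  (1 / 2) * (deriv y t) ^ 2 + (1 / 4) * (y t) ^ 4 - (1 / 2) * (y t) ^ 2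

/-- `b` is a bound state: the solution is not identically zero on `[0,∞)`
and tends to `0` at infinity. -/
def IsBoundState (b : ℝ) (y : ℝ → ℝ) : Prop :=
  IsSolution b y ∧ (∃ t : ℝ, 0 ≤ t ∧ y t ≠ 0) ∧
    Filter.Tendsto y Filter.atTop (nhds 0)

/-- An `n`-th excited state: a bound state whose solution has exactly `n`
zeros on `(0,∞)`. -/
def IsExcitedState (n : ℕ) (b : ℝ) (y : ℝ → ℝ) : Prop :=
  IsBoundState b y ∧ {t : ℝ | 0 < t ∧ y t = 0}.Finite ∧
    {t : ℝ | 0 < t ∧ y t = 0}.ncard = n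

section

open Set Filter Topology

/-- Truncation of a real number to `[-R, R]`. -/
def clampReal (R x : ℝ) : ℝ := max (-R) (min R x)

lemma abs_clampReal_sub_le (R x y : ℝ) : |clampReal R x - clampReal R y| ≤ |x - y| := by
  unfold clampReal
  grind

lemma abs_clampReal_le {R : ℝ} (hR : 0 ≤ R) (x : ℝ) : |clampReal R x| ≤ R := by
  unfold clampReal
  grind

lemma abs_clampReal_le_abs {R : ℝ} (hR : 0 ≤ R) (x : ℝ) : |clampReal R x| ≤ |x| := by
  unfold clampReal
  grind

lemma clampReal_of_abs_le {R x : ℝ} (h : |x| ≤ R) : clampReal R x = x := by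
  unfold clampReal
  grind

def clampProd (R : ℝ) (x : ℝ × ℝ) : ℝ × ℝ := (clampReal R x.1, clampReal R x.2)

lemma lipschitz_clampProd (R : ℝ) : LipschitzWith 1 (clampProd R) := by
  refine LipschitzWith.of_dist_le_mul fun x y => ?_
  simp only [Prod.dist_eq, Real.dist_eq, clampProd, NNReal.coe_one, one_mul]
  exact max_le_max (abs_clampReal_sub_le _ _ _) (abs_clampReal_sub_le _ _ _)

lemma norm_clampProd_le {R : ℝ} (hR : 0 ≤ R) (x : ℝ × ℝ) : ‖clampProd R x‖ ≤ R := by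
  simp only [Prod.norm_def, Real.norm_eq_abs, clampProd]
  exact max_le (abs_clampReal_le hR _) (abs_clampReal_le hR _)

lemma norm_clampProd_le_norm {R : ℝ} (hR : 0 ≤ R) (x : ℝ × ℝ) : ‖clampProd R x‖ ≤ ‖x‖ := by
  simp only [Prod.norm_def, Real.norm_eq_abs, clampProd]
  exact max_le_max (abs_clampReal_le_abs hR _) (abs_clampReal_le_abs hR _)

lemma clampProd_of_norm_le {R : ℝ} {x : ℝ × ℝ} (h : ‖x‖ ≤ R) : clampProd R x = x := by
  simp only [Prod.norm_def, Real.norm_eq_abs, max_le_iff] at h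
  ext <;> simp [clampProd, clampReal_of_abs_le, h]

lemma norm_le_gronwall_of_Icc {α α' : ℝ → ℝ × ℝ} {T K C D : ℝ} (hK : 0 ≤ K)
    (hC : 0 ≤ C) (hD : ‖α 0‖ ≤ D)
    (hα : ∀ t ∈ Icc 0 T, HasDerivWithinAt α (α' t) (Icc 0 T) t)
    (hb : ∀ t ∈ Icc 0 T, ‖α' t‖ ≤ K * ‖α t‖ + C) :
    ∀ t ∈ Icc 0 T, ‖α t‖ ≤ gronwallBound D K C T := by
  intro t ht
  have h := norm_le_gronwallBound_of_norm_deriv_right_le (f := α) (f' := α') (δ := D) (K := K)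
    (ε := C) (a := 0) (b := T) (fun t ht => (hα t ht).continuousWithinAt) (fun t ht =>
      ((hα t ⟨ht.1, ht.2.le⟩).mono_of_mem_nhdsWithin (Icc_mem_nhdsGE_of_mem ht)))
      hD (fun t ht => hb t ⟨ht.1, ht.2.le⟩) t ht
  exact h.trans (gronwallBound_mono ((norm_nonneg _).trans hD) hC hK (by linarith [ht.2]))

/-- Existence on `[-T, T]` for a Lipschitz vector field. -/
lemma exists_solution_Icc {F : ℝ → ℝ × ℝ → ℝ × ℝ} {T : ℝ} (hT : 0 < T) {K : NNReal}
    (hcont : ∀ x, Continuous fun t => F t x)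
    (hlip : ∀ t ∈ Icc (-T) T, LipschitzWith K (F t)) (x₀ : ℝ × ℝ) :
    ∃ α : ℝ → ℝ × ℝ, α 0 = x₀ ∧
      ∀ t ∈ Icc (-T) T, HasDerivWithinAt α (F t (α t)) (Icc (-T) T) t := by
  obtain ⟨C, hC⟩ := (isCompact_Icc (a := -T) (b := T)).exists_bound_of_continuousOn
    (hcont 0).continuousOn
  have hC0 : 0 ≤ C := (norm_nonneg _).trans (hC 0 ⟨by linarith, by linarith⟩)
  have hFb : ∀ t ∈ Icc (-T) T, ∀ x, ‖F t x‖ ≤ K * ‖x‖ + C := by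
    intro t ht x
    have h1 := (hlip t ht).norm_sub_le x 0
    have h2 : ‖F t x‖ ≤ ‖F t x - F t 0‖ + ‖F t 0‖ := by
      simpa using norm_add_le (F t x - F t 0) (F t 0)
    rw [sub_zero] at h1
    linarith [hC t ht]
  set R := gronwallBound ‖x₀‖ K C T with hRdef
  have hR : 0 ≤ R := by
    have := gronwallBound_mono (norm_nonneg x₀) hC0 K.2 hT.le
    rw [gronwallBound_x0] at this
    exact (norm_nonneg x₀).trans this
  have hG : IsPicardLindelof (fun t x => F t (clampProd R x))
      (⟨0, by constructor <;> linarith⟩ : Icc (-T) T) x₀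
      (⟨(K * R + C) * T, by positivity⟩) 0 ⟨K * R + C, by positivity⟩ K := by
    refine ⟨fun t ht => ?_, fun x _ => (hcont _).continuousOn, fun t ht x _ => ?_, ?_⟩
    · have := (hlip t ht).comp (lipschitz_clampProd R)
      rw [mul_one] at this
      exact this.lipschitzOnWith
    · refine (hFb t ht _).trans ?_
      change _ ≤ K * R + C
      have := norm_clampProd_le hR x
      gcongr
    · change (K * R + C) * max (T - 0) (0 - (-T)) ≤ (K * R + C) * T - 0
      simp
  obtain ⟨α, h0, hα⟩ := hG.exists_eq_forall_mem_Icc_hasDerivWithinAt₀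
  change α 0 = x₀ at h0
  refine ⟨α, h0, fun t ht => ?_⟩
  suffices h : ‖α t‖ ≤ R by
    have := hα t ht
    simp only [clampProd_of_norm_le h] at this
    exact this
  have hb : ∀ t ∈ Icc (-T) T, ‖F t (clampProd R (α t))‖ ≤ K * ‖α t‖ + C := fun t ht =>
    (hFb t ht _).trans (by have := norm_clampProd_le_norm hR (α t); gcongr)
  rcases le_total 0 t with h | h
  · refine norm_le_gronwall_of_Icc (α' := fun t => F t (clampProd R (α t))) K.2 hC0
      (by rw [h0]) (fun s hs => (hα s ⟨by linarith [hs.1], hs.2⟩).mono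
        (Icc_subset_Icc (by linarith) le_rfl)) (fun s hs => hb s ⟨by linarith [hs.1], hs.2⟩)
        t ⟨h, ht.2⟩
  · have := norm_le_gronwall_of_Icc (α := fun t => α (-t))
      (α' := fun t => - F (-t) (clampProd R (α (-t)))) (D := ‖x₀‖) (T := T) K.2 hC0
      (by simp [h0]) (fun s hs => ?_) (fun s hs => by
        rw [norm_neg]; exact hb (-s) ⟨by linarith [hs.2], by linarith [hs.1]⟩) (-t)
        ⟨by linarith, by linarith [ht.1]⟩
    · simpa using this
    · have h1 := hα (-s) ⟨by linarith [hs.2], by linarith [hs.1]⟩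
      have h2 : HasDerivWithinAt (fun t : ℝ => -t) (-1) (Icc 0 T) s :=
        (hasDerivAt_neg s).hasDerivWithinAt
      have := h1.scomp s h2 (fun x hx => ⟨by linarith [hx.2], by linarith [hx.1]⟩)
      simpa [Function.comp_def] using this

/-- Global existence for a vector field that is Lipschitz, locally uniformly in time. -/
lemma exists_global_solution {F : ℝ → ℝ × ℝ → ℝ × ℝ}
    (hcont : ∀ x, Continuous fun t => F t x)
    (hlip : ∀ T : ℝ, ∃ K : NNReal, ∀ t ∈ Icc (-T) T, LipschitzWith K (F t)) (x₀ : ℝ × ℝ) :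
    ∃ α : ℝ → ℝ × ℝ, α 0 = x₀ ∧ ∀ t, HasDerivAt α (F t (α t)) t := by
  have hex : ∀ n : ℕ, ∃ α : ℝ → ℝ × ℝ, α 0 = x₀ ∧ ∀ t ∈ Icc (-(n + 1 : ℝ)) (n + 1),
      HasDerivWithinAt α (F t (α t)) (Icc (-(n + 1 : ℝ)) (n + 1)) t := fun n => by
    obtain ⟨K, hK⟩ := hlip (n + 1)
    exact exists_solution_Icc (by positivity) hcont hK x₀
  choose A hA0 hA using hex
  have hd : ∀ (n : ℕ), ∀ t ∈ Ioo (-(n + 1 : ℝ)) (n + 1), HasDerivAt (A n) (F t (A n t)) t :=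
    fun n t ht => (hA n t ⟨ht.1.le, ht.2.le⟩).hasDerivAt (Icc_mem_nhds ht.1 ht.2)
  have huniq : ∀ (n k : ℕ), n ≤ k → ∀ t ∈ Ioo (-(n + 1 : ℝ)) (n + 1), A n t = A k t := by
    intro n k hnk t ht
    obtain ⟨K, hK⟩ := hlip (n + 1)
    have hnk' : (n : ℝ) ≤ k := by exact_mod_cast hnk
    exact ODE_solution_unique_of_mem_Ioo (v := F) (s := fun _ => univ) (K := K)
      (fun s hs => (hK s ⟨hs.1.le, hs.2.le⟩).lipschitzOnWith)
      (t₀ := 0) ⟨by have : (0:ℝ) ≤ n := n.cast_nonneg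
                    linarith, by positivity⟩
      (fun s hs => ⟨hd n s hs, mem_univ _⟩)
      (fun s hs => ⟨hd k s ⟨by linarith [hs.1], by linarith [hs.2]⟩, mem_univ _⟩)
      (by rw [hA0, hA0]) ht
  refine ⟨fun t => A ⌈|t|⌉₊ t, hA0 _, fun t => ?_⟩
  have hmem : ∀ s : ℝ, s ∈ Ioo (-((⌈|s|⌉₊ : ℝ) + 1)) (⌈|s|⌉₊ + 1) := fun s => by
    have := Nat.le_ceil |s|
    constructor
    · linarith [neg_abs_le s]
    · linarith [le_abs_self s]
  refine ((hd _ t (hmem t)).congr_of_eventuallyEq ?_)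
  filter_upwards [Ioo_mem_nhds (hmem t).1 (hmem t).2] with s hs
  rcases le_total ⌈|s|⌉₊ ⌈|t|⌉₊ with h | h
  · exact huniq _ _ h s (hmem s)
  · exact (huniq _ _ h s hs).symm

lemma linear_lipschitz {q F : ℝ → ℝ} (hq : Continuous q) (T : ℝ) : ∃ K : NNReal,
    ∀ t ∈ Icc (-T) T, LipschitzWith K fun x : ℝ × ℝ => (x.2, q t * x.1 + F t) := by
  obtain ⟨C, hC⟩ := (isCompact_Icc (a := -T) (b := T)).exists_bound_of_continuousOn
    (f := q) (by fun_prop)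
  refine ⟨⟨|C| + 1, by positivity⟩, fun t ht => LipschitzWith.of_dist_le_mul fun x y => ?_⟩
  have h1 := hC t ht
  rw [Real.norm_eq_abs] at h1
  simp only [Prod.dist_eq, Real.dist_eq]
  change _ ≤ (|C| + 1) * _
  have h2 : |q t * x.1 + F t - (q t * y.1 + F t)| = |q t| * |x.1 - y.1| := by
    rw [← abs_mul]; ring_nf
  rw [h2]
  have h3 := le_max_left |x.1 - y.1| |x.2 - y.2|
  have h4 := le_max_right |x.1 - y.1| |x.2 - y.2|
  have h5 := abs_nonneg (x.1 - y.1)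
  have h6 := le_abs_self C
  have h7 : 0 ≤ max |x.1 - y.1| |x.2 - y.2| := h5.trans h3
  refine max_le ?_ ?_
  · nlinarith [abs_nonneg C]
  · have h8 := mul_le_mul (h1.trans h6) h3 h5 (abs_nonneg C)
    nlinarith

/-- Solutions of inhomogeneous linear second order equations exist on the whole line. -/
lemma exists_linear_solution {q F : ℝ → ℝ} (hq : Continuous q) (hF : Continuous F) (c x₀ x₁ : ℝ) :
    ∃ x x' : ℝ → ℝ, x c = x₀ ∧ x' c = x₁ ∧ (∀ t, HasDerivAt x (x' t) t) ∧
      ∀ t, HasDerivAt x' (q t * x t + F t) t := by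
  obtain ⟨α, h0, hα⟩ := exists_global_solution
    (F := fun t x => (x.2, q (t + c) * x.1 + F (t + c))) (fun x => by fun_prop)
    (linear_lipschitz (q := fun t => q (t + c)) (F := fun t => F (t + c)) (by fun_prop)) (x₀, x₁)
  have h1 : ∀ t, HasDerivAt (fun s => (α s).1) (α t).2 t := fun t => (hα t).fst
  have h2 : ∀ t, HasDerivAt (fun s => (α s).2) (q (t + c) * (α t).1 + F (t + c)) t :=
    fun t => (hα t).snd
  refine ⟨fun t => (α (t - c)).1, fun t => (α (t - c)).2, by simp [h0], by simp [h0],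
    fun t => (h1 (t - c)).comp_sub_const t c, fun t => ?_⟩
  simpa using (h2 (t - c)).comp_sub_const t c

/-- Uniqueness for a vector field that is Lipschitz, locally uniformly in time. -/
lemma global_solution_unique {F : ℝ → ℝ × ℝ → ℝ × ℝ}
    (hlip : ∀ T : ℝ, ∃ K : NNReal, ∀ t ∈ Icc (-T) T, LipschitzWith K (F t)) {α β : ℝ → ℝ × ℝ}
    (hα : ∀ t, HasDerivAt α (F t (α t)) t) (hβ : ∀ t, HasDerivAt β (F t (β t)) t) {c : ℝ}
    (hc : α c = β c) : α = β := by
  funext t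
  set T := |c| + |t| + 1
  obtain ⟨K, hK⟩ := hlip T
  have hmem : ∀ s, |s| ≤ |c| + |t| → s ∈ Ioo (-T) T := fun s hs => by
    exact abs_lt.1 (hs.trans_lt (lt_add_one _))
  exact ODE_solution_unique_of_mem_Ioo (v := F) (s := fun _ => univ) (K := K)
    (fun s hs => (hK s ⟨hs.1.le, hs.2.le⟩).lipschitzOnWith)
    (hmem c (by linarith [abs_nonneg t])) (fun s _ => ⟨hα s, mem_univ _⟩)
    (fun s _ => ⟨hβ s, mem_univ _⟩) hc (hmem t (by linarith [abs_nonneg c]))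

section Calculus

variable {f f' : ℝ → ℝ} {a b : ℝ}

lemma lt_of_hasDerivAt_pos (hab : a < b) (hc : Continuous f)
    (hd : ∀ t ∈ Ioo a b, HasDerivAt f (f' t) t) (hp : ∀ t ∈ Ioo a b, 0 < f' t) : f a < f b := by
  refine strictMonoOn_of_deriv_pos (convex_Icc a b) hc.continuousOn (fun t ht => ?_)
    (left_mem_Icc.2 hab.le) (right_mem_Icc.2 hab.le) hab
  rw [interior_Icc] at ht
  rw [(hd t ht).deriv]
  exact hp t ht

lemma le_of_hasDerivAt_nonneg (hab : a ≤ b) (hc : Continuous f)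
    (hd : ∀ t ∈ Ioo a b, HasDerivAt f (f' t) t) (hp : ∀ t ∈ Ioo a b, 0 ≤ f' t) : f a ≤ f b := by
  refine monotoneOn_of_deriv_nonneg (convex_Icc a b) hc.continuousOn (fun t ht => ?_)
    (fun t ht => ?_) (left_mem_Icc.2 hab) (right_mem_Icc.2 hab) hab
  · rw [interior_Icc] at ht
    exact (hd t ht).differentiableAt.differentiableWithinAt
  · rw [interior_Icc] at ht
    rw [(hd t ht).deriv]
    exact hp t ht

lemma exists_last_zero (hf : Continuous f) {δ : ℝ} (hδ : δ < b) (near : ∀ t ∈ Ioo δ b, 0 < f t)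
    (hab : a < b) (ha : f a ≤ 0) : ∃ p, a ≤ p ∧ p < b ∧ f p = 0 ∧ ∀ t ∈ Ioo p b, 0 < f t := by
  have hK : IsCompact (Icc a (max a δ) ∩ f ⁻¹' Iic 0) :=
    isCompact_Icc.inter_right (isClosed_Iic.preimage hf)
  obtain ⟨p, ⟨⟨hp1, hp2⟩, hp3⟩, hp4⟩ := hK.exists_isGreatest ⟨a, ⟨le_rfl, le_max_left _ _⟩, ha⟩
  have hpb : p < b := lt_of_le_of_lt hp2 (max_lt hab hδ)
  have hpos : ∀ t ∈ Ioo p b, 0 < f t := by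
    intro t ht
    by_contra! h
    have h1 : t ≤ δ := by
      by_contra! h1
      exact absurd (near t ⟨h1, ht.2⟩) (not_lt.2 h)
    have := hp4 ⟨⟨hp1.trans ht.1.le, h1.trans (le_max_right _ _)⟩, h⟩
    exact absurd ht.1 (not_lt.2 this)
  refine ⟨p, hp1, hpb, le_antisymm hp3 ?_, hpos⟩
  refine ge_of_tendsto (hf.continuousAt.tendsto.mono_left (nhdsWithin_le_nhds (s := Ioi p))) ?_
  filter_upwards [Ioo_mem_nhdsGT hpb] with t ht using (hpos t ht).le

lemma exists_first_zero (hf : Continuous f) {δ : ℝ} (hδ : a < δ) (near : ∀ t ∈ Ioo a δ, 0 < f t)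
    (hab : a < b) (hb : f b ≤ 0) : ∃ p, a < p ∧ p ≤ b ∧ f p = 0 ∧ ∀ t ∈ Ioo a p, 0 < f t := by
  obtain ⟨p, h1, h2, h3, h4⟩ := exists_last_zero (f := fun t => f (-t)) (a := -b) (b := -a)
    (hf.comp continuous_neg) (neg_lt_neg hδ)
    (fun t ht => near (-t) ⟨by linarith [ht.2], by linarith [ht.1]⟩) (neg_lt_neg hab)
    (by simpa using hb)
  refine ⟨-p, by linarith, by linarith, h3, fun t ht => ?_⟩
  simpa using h4 (-t) ⟨by linarith [ht.2], by linarith [ht.1]⟩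

lemma nonneg_deriv_of_pos_right {p d : ℝ} (hpb : p < b) (hd : HasDerivAt f d p) (h0 : f p = 0)
    (hpos : ∀ t ∈ Ioo p b, 0 < f t) : 0 ≤ d := by
  have h := (hasDerivWithinAt_iff_tendsto_slope' (self_notMem_Ioi (a := p))).1
    hd.hasDerivWithinAt
  refine ge_of_tendsto h ?_
  filter_upwards [Ioo_mem_nhdsGT hpb] with t ht
  rw [slope_def_field, h0, sub_zero]
  exact div_nonneg (hpos t ht).le (by linarith [ht.1])

lemma nonpos_deriv_of_pos_left {p d : ℝ} (hap : a < p) (hd : HasDerivAt f d p) (h0 : f p = 0)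
    (hpos : ∀ t ∈ Ioo a p, 0 < f t) : d ≤ 0 := by
  have h := (hasDerivWithinAt_iff_tendsto_slope' (self_notMem_Iio (a := p))).1
    hd.hasDerivWithinAt
  refine le_of_tendsto h ?_
  filter_upwards [Ioo_mem_nhdsLT hap] with t ht
  rw [slope_def_field, h0, sub_zero]
  exact div_nonpos_of_nonneg_of_nonpos (hpos t ht).le (by linarith [ht.2])

lemma eq_of_hasDerivAt_zero (hd : ∀ t, HasDerivAt f 0 t) (s t : ℝ) : f s = f t :=
  is_const_of_deriv_eq_zero (fun x => (hd x).differentiableAt) (fun x => (hd x).deriv) s t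

lemma continuous_of_hasDerivAt (hd : ∀ t, HasDerivAt f (f' t) t) : Continuous f :=
  continuous_iff_continuousAt.2 fun t => (hd t).continuousAt

end Calculus

/-- A radial solution `y` of the equation, in terms of `u t = t * y t`, extended evenly. -/
structure Profile (y u u' : ℝ → ℝ) : Prop where
  cont : Continuous y
  eq : ∀ t, u t = t * y t
  hu : ∀ t, HasDerivAt u (u' t) t
  hu' : ∀ t, HasDerivAt u' (u t - y t ^ 2 * u t) t

/-- A solution of `x'' = (1 - 3 y ^ 2) x + F`. -/
structure Lin (y F x x' : ℝ → ℝ) : Prop where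
  hx : ∀ t, HasDerivAt x (x' t) t
  hx' : ∀ t, HasDerivAt x' ((1 - 3 * y t ^ 2) * x t + F t) t

namespace Lin

variable {y F G x x' v v' : ℝ → ℝ}

lemma continuous (h : Lin y F x x') : Continuous x := continuous_of_hasDerivAt h.hx

lemma continuous' (h : Lin y F x x') : Continuous x' := continuous_of_hasDerivAt h.hx'

lemma add (h : Lin y F x x') (g : Lin y G v v') :
    Lin y (fun t => F t + G t) (fun t => x t + v t) (fun t => x' t + v' t) :=
  ⟨fun t => (h.hx t).add (g.hx t), fun t => ((h.hx' t).add (g.hx' t)).congr_deriv (by ring)⟩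

lemma sub (h : Lin y F x x') (g : Lin y G v v') :
    Lin y (fun t => F t - G t) (fun t => x t - v t) (fun t => x' t - v' t) :=
  ⟨fun t => (h.hx t).sub (g.hx t), fun t => ((h.hx' t).sub (g.hx' t)).congr_deriv (by ring)⟩

lemma smul (r : ℝ) (h : Lin y F x x') :
    Lin y (fun t => r * F t) (fun t => r * x t) (fun t => r * x' t) :=
  ⟨fun t => (h.hx t).const_mul r, fun t => ((h.hx' t).const_mul r).congr_deriv (by ring)⟩

lemma wronskian (h : Lin y F x x') (g : Lin y G v v') (t : ℝ) :
    HasDerivAt (fun t => x' t * v t - x t * v' t) (F t * v t - x t * G t) t :=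
  (((h.hx' t).mul (g.hx t)).sub ((h.hx t).mul (g.hx' t))).congr_deriv (by ring)

lemma wronskian_const (h : Lin y 0 x x') (g : Lin y 0 v v') (s t : ℝ) :
    x' s * v s - x s * v' s = x' t * v t - x t * v' t :=
  eq_of_hasDerivAt_zero (fun t => (h.wronskian g t).congr_deriv (by simp)) s t

lemma continuous_wronskian (h : Lin y F x x') (g : Lin y G v v') :
    Continuous (fun t => x' t * v t - x t * v' t) :=
  continuous_of_hasDerivAt (h.wronskian g)

/-- A solution with vanishing data at `c` and positive right-hand side is positive before `c`,
as long as a positive homogeneous solution exists. -/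
lemma pos_before (h : Lin y F x x') (g : Lin y 0 v v') {δ c : ℝ} (hv : ∀ t ∈ Ioc δ c, 0 < v t)
    (hF : ∀ t ∈ Ioo δ c, 0 < F t) (h0 : x c = 0) (h1 : x' c = 0) : ∀ t ∈ Ioo δ c, 0 < x t := by
  intro t ht
  have hD : ∀ s ∈ Ioo δ c, x' s * v s - x s * v' s < 0 := by
    intro s hs
    have := lt_of_hasDerivAt_pos hs.2 (h.continuous_wronskian g)
      (fun r _ => h.wronskian g r) (fun r hr => by
        have hr' : r ∈ Ioo δ c := ⟨hs.1.trans hr.1, hr.2⟩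
        simpa using mul_pos (hF r hr') (hv r ⟨hr'.1, hr'.2.le⟩))
    simpa [h0, h1] using this
  by_contra! hx
  have hvt := hv t ⟨ht.1, ht.2.le⟩
  have hanti : StrictAntiOn (fun s => x s / v s) (Icc t c) := by
    refine strictAntiOn_of_deriv_neg (convex_Icc t c) (h.continuous.continuousOn.div
      g.continuous.continuousOn (fun s hs => (hv s ⟨ht.1.trans_le hs.1, hs.2⟩).ne'))
      (fun s hs => ?_)
    rw [interior_Icc] at hs
    have hvs := hv s ⟨ht.1.trans hs.1, hs.2.le⟩
    rw [((h.hx s).fun_div (g.hx s) hvs.ne').deriv]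
    exact div_neg_of_neg_of_pos (hD s ⟨ht.1.trans hs.1, hs.2⟩) (by positivity)
  have := hanti (left_mem_Icc.2 ht.2.le) (right_mem_Icc.2 ht.2.le) ht.2
  simp only [h0, zero_div] at this
  exact absurd (div_nonpos_of_nonpos_of_nonneg hx hvt.le) (not_le.2 this)

end Lin

namespace Profile

variable {y u u' : ℝ → ℝ}

lemma neg (h : Profile y u u') : Profile (fun t => -y t) (fun t => -u t) (fun t => -u' t) :=
  ⟨h.cont.neg, fun t => by rw [h.eq]; ring, fun t => (h.hu t).neg,
    fun t => (h.hu' t).neg.congr_deriv (by ring)⟩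

lemma continuous (h : Profile y u u') : Continuous u := continuous_of_hasDerivAt h.hu

lemma continuous' (h : Profile y u u') : Continuous u' := continuous_of_hasDerivAt h.hu'

lemma hasDerivAt_y (h : Profile y u u') {t : ℝ} (ht : t ≠ 0) :
    HasDerivAt y ((u' t - y t) / t) t := by
  have h1 : HasDerivAt (fun s => u s / s) ((u' t * t - u t * 1) / t ^ 2) t :=
    (h.hu t).div (hasDerivAt_id t) ht
  refine (h1.congr_deriv ?_).congr_of_eventuallyEq ?_
  · rw [h.eq]; field_simp
  · filter_upwards [isOpen_ne.mem_nhds ht] with s hs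
    rw [h.eq]
    exact (mul_div_cancel_left₀ _ hs).symm

lemma y_zero (h : Profile y u u') : y 0 = u' 0 := by
  have h1 : HasDerivAt u (y 0) 0 := by
    rw [hasDerivAt_iff_tendsto_slope]
    refine (h.cont.tendsto 0).mono_left nhdsWithin_le_nhds |>.congr' ?_
    filter_upwards [self_mem_nhdsWithin] with s hs
    have hs' : s ≠ 0 := hs
    rw [slope_def_field, h.eq s, h.eq 0]
    field_simp
    ring
  exact h1.unique (h.hu 0)

lemma lin_u (h : Profile y u u') : Lin y (fun t => 2 * y t ^ 2 * u t) u u' :=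
  ⟨h.hu, fun t => (h.hu' t).congr_deriv (by ring)⟩

lemma lin_u' (h : Profile y u u') :
    Lin y (fun t => 2 * y t ^ 3) u' (fun t => u t - y t ^ 2 * u t) := by
  refine ⟨h.hu', fun t => ?_⟩
  by_cases ht : t = 0
  · subst ht
    rw [hasDerivAt_iff_tendsto_slope]
    have hc : Continuous fun s => y s - y s ^ 3 := by have := h.cont; fun_prop
    have := (hc.tendsto 0).mono_left (nhdsWithin_le_nhds (s := {0}ᶜ))
    rw [← h.y_zero, show (1 - 3 * y 0 ^ 2) * y 0 + 2 * y 0 ^ 3 = y 0 - y 0 ^ 3 by ring]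
    refine this.congr' ?_
    filter_upwards [self_mem_nhdsWithin] with s hs
    have hs' : s ≠ 0 := hs
    rw [slope_def_field, h.eq s, h.eq 0]
    field_simp
    ring
  · refine ((h.hu t).sub (((h.hasDerivAt_y ht).pow 2).mul (h.hu t))).congr_deriv ?_
    simp only [Pi.pow_apply]
    rw [h.eq]
    field_simp
    push_cast
    ring

lemma lin_m (h : Profile y u u') :
    Lin y (fun t => 2 * u t) (fun t => t * u' t) (fun t => u' t + t * (u t - y t ^ 2 * u t)) :=
  ⟨fun t => ((hasDerivAt_id t).mul (h.hu' t)).congr_deriv (by simp),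
    fun t => ((h.hu' t).add ((hasDerivAt_id t).mul (h.lin_u'.hx' t))).congr_deriv (by
      simp only [id, h.eq]; ring)⟩

/-- The energy of a profile, in terms of `u`. -/
def energy (y u u' : ℝ → ℝ) (t : ℝ) : ℝ := u' t ^ 2 / 2 - u t ^ 2 / 2 + u t ^ 2 * y t ^ 2 / 4

lemma hasDerivAt_energy (h : Profile y u u') {t : ℝ} (ht : t ≠ 0) :
    HasDerivAt (energy y u u') (-(t * y t ^ 4) / 2) t := by
  refine (((((h.hu' t).pow 2).div_const 2).sub (((h.hu t).pow 2).div_const 2)).add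
    ((((h.hu t).pow 2).mul ((h.hasDerivAt_y ht).pow 2)).div_const 4)).congr_deriv ?_
  simp only [Pi.pow_apply]
  rw [h.eq]
  field_simp
  push_cast
  ring

lemma continuous_energy (h : Profile y u u') : Continuous (energy y u u') := by
  have := h.cont
  have := h.continuous
  have := h.continuous'
  unfold energy
  fun_prop

end Profile

/-- The auxiliary solutions of the linearised equation attached to a maximum `c` of `u`. -/
structure Peak (y u u' N N' χ χ' : ℝ → ℝ) (c : ℝ) : Prop extends Profile y u u' where
  c_pos : 0 < c
  u'_c : u' c = 0
  y_c : 0 < y c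
  two_lt : 2 < y c ^ 2
  lin_N : Lin y (fun t => 2 * y t ^ 3) N N'
  N_c : N c = y c / (y c ^ 2 - 1)
  N'_c : N' c = 0
  lin_χ : Lin y 0 χ χ'
  χ_c : χ c = 1
  χ'_c : χ' c = 0

lemma Profile.exists_peak {y u u' : ℝ → ℝ} {c : ℝ} (h : Profile y u u') (hc : 0 < c)
    (h1 : u' c = 0) (h2 : 0 < y c) (h3 : 2 < y c ^ 2) :
    ∃ N N' χ χ', Peak y u u' N N' χ χ' c := by
  have hy := h.cont
  obtain ⟨N, N', a1, a2, a3, a4⟩ := exists_linear_solution (q := fun t => 1 - 3 * y t ^ 2)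
    (F := fun t => 2 * y t ^ 3) (by fun_prop) (by fun_prop) c (y c / (y c ^ 2 - 1)) 0
  obtain ⟨χ, χ', b1, b2, b3, b4⟩ := exists_linear_solution (q := fun t => 1 - 3 * y t ^ 2)
    (F := 0) (by fun_prop) (by fun_prop) c 1 0
  exact ⟨N, N', χ, χ', h, hc, h1, h2, h3, ⟨a3, a4⟩, a1, a2, ⟨b3, b4⟩, b1, b2⟩

namespace Peak

variable {y u u' N N' χ χ' : ℝ → ℝ} {c : ℝ}

lemma lin_ψ (h : Peak y u u' N N' χ χ' c) :
    Lin y 0 (fun t => u' t - N t) (fun t => u t - y t ^ 2 * u t - N' t) := by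
  have := h.lin_u'.sub h.lin_N
  simp only [sub_self] at this
  exact this

lemma u_c (h : Peak y u u' N N' χ χ' c) : 0 < u c := by
  rw [h.eq]; exact mul_pos h.c_pos h.y_c

lemma N_c_pos (h : Peak y u u' N N' χ χ' c) : 0 < N c := by
  rw [h.N_c]; exact div_pos h.y_c (by linarith [h.two_lt])

/-- `w + u²`, with `w` the Wronskian of `u' - N` and `t u'`. -/
lemma hasDerivAt_omega (h : Peak y u u' N N' χ χ' c) (t : ℝ) :
    HasDerivAt (fun t => (u t - y t ^ 2 * u t - N' t) * (t * u' t)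
      - (u' t - N t) * (u' t + t * (u t - y t ^ 2 * u t)) + u t ^ 2) (2 * u t * N t) t :=
  ((h.lin_ψ.wronskian h.lin_m t).add ((h.hu t).pow 2)).congr_deriv (by
    simp only [Pi.zero_apply]; push_cast; ring)

lemma omega_c (h : Peak y u u' N N' χ χ' c) :
    (u c - y c ^ 2 * u c - N' c) * (c * u' c)
      - (u' c - N c) * (u' c + c * (u c - y c ^ 2 * u c)) + u c ^ 2 = 0 := by
  have h2 : y c ^ 2 - 1 ≠ 0 := by linarith [h.two_lt]
  rw [h.u'_c, h.N_c, h.N'_c, h.eq]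
  field_simp
  ring

lemma wronskian_ψ_χ (h : Peak y u u' N N' χ χ' c) (t : ℝ) :
    (u' t - N t) * χ' t - (u t - y t ^ 2 * u t - N' t) * χ t = u c * (y c ^ 2 - 1) := by
  have := h.lin_ψ.wronskian_const h.lin_χ t c
  simp only [h.u'_c, h.N'_c, h.χ_c, h.χ'_c] at this
  linarith

lemma wronskian_pos (h : Peak y u u' N N' χ χ' c) : 0 < u c * (y c ^ 2 - 1) :=
  mul_pos h.u_c (by linarith [h.two_lt])

lemma strictMonoOn_ratio (h : Peak y u u' N N' χ χ' c) {s : Set ℝ} (hs : Convex ℝ s)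
    (hψ : ∀ t ∈ s, u' t - N t ≠ 0) : StrictMonoOn (fun t => χ t / (u' t - N t)) s := by
  refine strictMonoOn_of_deriv_pos hs (h.lin_χ.continuous.continuousOn.div
      h.lin_ψ.continuous.continuousOn hψ) (fun t ht => ?_)
  have h0 := hψ t (interior_subset ht)
  rw [((h.lin_χ.hx t).fun_div (h.lin_ψ.hx t) h0).deriv]
  refine div_pos ?_ (by positivity)
  linarith [h.wronskian_ψ_χ t, h.wronskian_pos]

end Peak

/-- The condition on a solution `v` of the linearised equation at a zero `z` of `u`
where `u` is increasing. -/
def Cone (v v' : ℝ → ℝ) (z : ℝ) : Prop := 0 ≤ v z ∧ 0 < v' z ∧ v z ≤ z * v' z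

/-- The condition on a solution `v` of the linearised equation at a positive maximum `c` of `u`. -/
def PeakCone (y u v v' : ℝ → ℝ) (c : ℝ) : Prop :=
  v' c < 0 ∧ 0 ≤ -(y c / (y c ^ 2 - 1)) * v' c + u c * (y c ^ 2 - 1) * v c

namespace Peak

variable {y u u' N N' χ χ' v v' : ℝ → ℝ} {c τ : ℝ}

lemma decomposition (h : Peak y u u' N N' χ χ' c) (hv : Lin y 0 v v')
    (hcone : PeakCone y u v v' c) : ∃ l k : ℝ, 0 < l ∧ 0 ≤ k ∧
      ∀ t, v t = l * (u' t - N t) + k * χ t ∧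
        v' t = l * (u t - y t ^ 2 * u t - N' t) + k * χ' t := by
  have hW := h.wronskian_pos
  refine ⟨-v' c / (u c * (y c ^ 2 - 1)), (-(y c / (y c ^ 2 - 1)) * v' c
    + u c * (y c ^ 2 - 1) * v c) / (u c * (y c ^ 2 - 1)), div_pos (neg_pos.2 hcone.1) hW,
    div_nonneg hcone.2 hW.le, fun t => ?_⟩
  have h1 := hv.wronskian_const h.lin_χ t c
  have h2 := h.lin_ψ.wronskian_const hv t c
  have h3 := h.wronskian_ψ_χ t
  simp only [h.u'_c, h.N_c, h.N'_c, h.χ_c, h.χ'_c] at h1 h2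
  have h1' : -v' c = v t * χ' t - v' t * χ t := by linarith
  have h2' : -(y c / (y c ^ 2 - 1)) * v' c + u c * (y c ^ 2 - 1) * v c
      = (u' t - N t) * v' t - (u t - y t ^ 2 * u t - N' t) * v t := by linarith
  rw [h1', h2', ← h3]
  rw [← h3] at hW
  constructor <;>
  · rw [div_mul_eq_mul_div, div_mul_eq_mul_div, ← add_div, eq_div_iff hW.ne']
    ring

lemma N_pos_after (h : Peak y u u' N N' χ χ' c) (hu : ∀ t ∈ Ico c τ, 0 < u t)
    (hu' : ∀ t ∈ Ioo c τ, u' t < 0) (hH : ∀ t ∈ Ioo c τ, 0 < Profile.energy y u u' t) :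
    ∀ t ∈ Ico c τ, 0 < N t := by
  have hY : ∀ t, HasDerivAt (fun t => N' t * u t - N t * u' t)
      (2 * y t ^ 2 * u t * (y t - N t)) t :=
    fun t => (h.lin_N.wronskian h.lin_u t).congr_deriv (by ring)
  have hYc : Continuous (fun t => N' t * u t - N t * u' t) := continuous_of_hasDerivAt hY
  have hy : ∀ t ∈ Ico c τ, 0 < y t := fun t ht => by
    have := hu t ht
    rw [h.eq] at this
    exact pos_of_mul_pos_right this (h.c_pos.le.trans ht.1)
  have hY0 : N' c * u c - N c * u' c = 0 := by rw [h.N'_c, h.u'_c]; ring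
  have hN : ∀ s ∈ Ico c τ, (∀ t ∈ Ioo c s, 0 < N' t * u t - N t * u' t) →
      ∀ t ∈ Icc c s, 0 < N t := by
    intro s hs hpos t ht
    have hut : ∀ r ∈ Icc c t, 0 < u r := fun r hr => hu r ⟨hr.1, (hr.2.trans ht.2).trans_lt hs.2⟩
    have hmono : MonotoneOn (fun t => N t / u t) (Icc c t) := by
      refine monotoneOn_of_deriv_nonneg (convex_Icc c t) (h.lin_N.continuous.continuousOn.div
        h.continuous.continuousOn (fun r hr => (hut r hr).ne')) (fun r hr => ?_) (fun r hr => ?_)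
      · rw [interior_Icc] at hr
        exact ((h.lin_N.hx r).fun_div (h.hu r) (hut r ⟨hr.1.le, hr.2.le⟩).ne')
          |>.differentiableAt.differentiableWithinAt
      · rw [interior_Icc] at hr
        rw [((h.lin_N.hx r).fun_div (h.hu r) (hut r ⟨hr.1.le, hr.2.le⟩).ne').deriv]
        exact div_nonneg (hpos r ⟨hr.1, hr.2.trans_le ht.2⟩).le (by positivity)
    have h1 := hmono (left_mem_Icc.2 ht.1) (right_mem_Icc.2 ht.1) ht.1
    have h2 : 0 < N c / u c := div_pos h.N_c_pos h.u_c
    exact (div_pos_iff_of_pos_right (hut t ⟨ht.1, le_rfl⟩)).1 (h2.trans_le h1)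
  intro s hs
  refine hN s hs ?_ s ⟨hs.1, le_rfl⟩
  by_contra! hcon
  obtain ⟨q, hq, hq0⟩ := hcon
  have hcτ : c < τ := hs.1.trans_lt hs.2
  have hRc : 0 < y c - N c := by
    rw [h.N_c, sub_pos, div_lt_iff₀ (by linarith [h.two_lt])]
    nlinarith [h.two_lt, h.y_c]
  have hev : ∀ᶠ t in 𝓝 c, 0 < y t - N t :=
    (h.cont.sub h.lin_N.continuous).continuousAt.eventually (lt_mem_nhds hRc)
  obtain ⟨δ, hδ, hδR⟩ := mem_nhdsGT_iff_exists_Ioo_subset.1 (mem_nhdsWithin_of_mem_nhds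
    (hev.and (Iio_mem_nhds hcτ)) : _ ∈ 𝓝[>] c)
  have hnear : ∀ t ∈ Ioo c δ, 0 < N' t * u t - N t * u' t := by
    intro t ht
    have := lt_of_hasDerivAt_pos ht.1 hYc (fun r _ => hY r) (fun r hr => by
      have hr' := hδR ⟨hr.1, hr.2.trans ht.2⟩
      have h1 := hu r ⟨hr.1.le, hr'.2⟩
      have h2 := hy r ⟨hr.1.le, hr'.2⟩
      have h3 := hr'.1
      positivity)
    rwa [hY0] at this
  obtain ⟨p, hp1, hp2, hp3, hp4⟩ := exists_first_zero hYc hδ hnear hq.1 hq0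
  have hpτ : p < τ := (hp2.trans_lt hq.2).trans hs.2
  have hp : p ∈ Ioo c τ := ⟨hp1, hpτ⟩
  have hω := le_of_hasDerivAt_nonneg hp1.le (continuous_of_hasDerivAt h.hasDerivAt_omega)
    (fun r _ => h.hasDerivAt_omega r) (fun r hr => by
      have h1 := hu r ⟨hr.1.le, hr.2.trans hpτ⟩
      have h2 := hN p ⟨hp1.le, hpτ⟩ hp4 r ⟨hr.1.le, hr.2.le⟩
      positivity)
  rw [h.omega_c] at hω
  have hNp := hN p ⟨hp1.le, hpτ⟩ hp4 p ⟨hp1.le, le_rfl⟩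
  have hup := hu p ⟨hp1.le, hpτ⟩
  have hu'p := hu' p hp
  have hHp := hH p hp
  have hp0 : 0 < p := h.c_pos.trans hp1
  unfold Profile.energy at hHp
  have huu : 0 < u p * -u' p := mul_pos hup (neg_pos.2 hu'p)
  have hA : 0 < p * u' p ^ 2 - u p * u' p - p * u p ^ 2 + u p ^ 2 * p * y p ^ 2 := by
    have h1 := mul_pos hp0 hHp
    have h2 : 0 ≤ u p ^ 2 * p * y p ^ 2 := by positivity
    linarith
  have hkey : p * (p * u' p ^ 2 - u p * u' p - p * u p ^ 2 + u p ^ 2 * p * y p ^ 2) * (y p - N p)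
      = u p * (4 * p * (u' p ^ 2 / 2 - u p ^ 2 / 2 + u p ^ 2 * y p ^ 2 / 4) - u p * u' p
        + p * ((u p - y p ^ 2 * u p - N' p) * (p * u' p)
        - (u' p - N p) * (u' p + p * (u p - y p ^ 2 * u p)) + u p ^ 2)) := by
    have h1 : p * y p = u p := (h.eq p).symm
    have h2 : N' p * u p = N p * u' p := by linarith
    linear_combination (p * u' p ^ 2 - u p * u' p - p * u p ^ 2 + u p ^ 2 * p * y p ^ 2) * h1
      + p * p * u' p * h2
  have hR : 0 < y p - N p := by
    refine pos_of_mul_pos_right (a := p * (p * u' p ^ 2 - u p * u' p - p * u p ^ 2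
      + u p ^ 2 * p * y p ^ 2)) ?_ (by positivity)
    rw [hkey]
    have h1 := mul_pos hp0 hHp
    have h2 := mul_nonneg hp0.le hω
    refine mul_pos hup ?_
    linarith
  have hd := nonpos_deriv_of_pos_left hp1 (hY p) hp3 hp4
  have := hy p ⟨hp1.le, hpτ⟩
  exact absurd hd (not_le.2 (by positivity))

lemma omega_pos_after (h : Peak y u u' N N' χ χ' c) (hu : ∀ t ∈ Ioo c τ, 0 < u t)
    (hN : ∀ t ∈ Ioo c τ, 0 < N t) (hcτ : c < τ) :
    0 < (u τ - y τ ^ 2 * u τ - N' τ) * (τ * u' τ)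
      - (u' τ - N τ) * (u' τ + τ * (u τ - y τ ^ 2 * u τ)) + u τ ^ 2 := by
  have := lt_of_hasDerivAt_pos hcτ (continuous_of_hasDerivAt h.hasDerivAt_omega)
    (fun r _ => h.hasDerivAt_omega r) (fun r hr => by
      have h1 := hu r hr
      have h2 := hN r hr
      positivity)
  rwa [h.omega_c] at this

lemma hasDerivAt_wronskian_u_χ (h : Peak y u u' N N' χ χ' c) (t : ℝ) :
    HasDerivAt (fun t => u' t * χ t - u t * χ' t) (2 * y t ^ 2 * u t * χ t) t :=
  (h.lin_u.wronskian h.lin_χ t).congr_deriv (by simp)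

lemma wronskian_u_χ_c (h : Peak y u u' N N' χ χ' c) : u' c * χ c - u c * χ' c = 0 := by
  rw [h.u'_c, h.χ'_c]; ring

/-- Propagation of the cone from a maximum to the next zero of `u`. -/
lemma cone_after (h : Peak y u u' N N' χ χ' c) (hv : Lin y 0 v v') (hcone : PeakCone y u v v' c)
    (hcτ : c < τ) (hu : ∀ t ∈ Ico c τ, 0 < u t) (hu' : ∀ t ∈ Ioc c τ, u' t < 0)
    (hH : ∀ t ∈ Ioo c τ, 0 < Profile.energy y u u' t) (huτ : u τ = 0) :
    Cone (fun t => -v t) (fun t => -v' t) τ ∧ v τ < 0 := by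
  have hN := h.N_pos_after hu (fun t ht => hu' t ⟨ht.1, ht.2.le⟩) hH
  have hτ0 : 0 < τ := h.c_pos.trans hcτ
  have hNτ : 0 ≤ N τ := by
    refine ge_of_tendsto (h.lin_N.continuous.continuousAt.tendsto.mono_left
      (nhdsWithin_le_nhds (s := Iio τ))) ?_
    filter_upwards [Ioo_mem_nhdsLT hcτ] with t ht using (hN t ⟨ht.1.le, ht.2⟩).le
  have hu'τ := hu' τ ⟨hcτ, le_rfl⟩
  have hψ : ∀ t ∈ Icc c τ, u' t - N t < 0 := by
    intro t ht
    rcases ht.2.eq_or_lt with rfl | h2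
    · linarith
    · have := hN t ⟨ht.1, h2⟩
      rcases ht.1.eq_or_lt with rfl | h1
      · rw [h.u'_c]; linarith
      · linarith [hu' t ⟨h1, ht.2⟩]
  have hω := h.omega_pos_after (fun t ht => hu t ⟨ht.1.le, ht.2⟩)
    (fun t ht => hN t ⟨ht.1.le, ht.2⟩) hcτ
  rw [huτ] at hω
  have hψτ := hψ τ ⟨hcτ.le, le_rfl⟩
  set ψτ' := u τ - y τ ^ 2 * u τ - N' τ with hψ'
  have hψ'0 : ψτ' = -N' τ := by rw [hψ', huτ]; ring
  have hlt : τ * ψτ' < u' τ - N τ := by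
    rw [hψ'0]
    nlinarith
  obtain ⟨ζ, hζ, hζ0⟩ : ∃ ζ ∈ Ioo c τ, χ ζ ≤ 0 := by
    by_contra! hcon
    have := lt_of_hasDerivAt_pos hcτ (h.lin_u.continuous_wronskian h.lin_χ)
      (fun r _ => h.hasDerivAt_wronskian_u_χ r) (fun r hr => by
        have h1 := hu r ⟨hr.1.le, hr.2⟩
        have h2 := hcon r hr
        have h3 : 0 < y r := by
          rw [h.eq] at h1
          exact pos_of_mul_pos_right h1 (h.c_pos.le.trans hr.1.le)
        positivity)
    rw [h.wronskian_u_χ_c, huτ, zero_mul, sub_zero] at this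
    have hχ : 0 ≤ χ τ := by
      refine ge_of_tendsto (h.lin_χ.continuous.continuousAt.tendsto.mono_left
        (nhdsWithin_le_nhds (s := Iio τ))) ?_
      filter_upwards [Ioo_mem_nhdsLT hcτ] with t ht using (hcon t ht).le
    nlinarith
  have hχτ : χ τ < 0 := by
    have := h.strictMonoOn_ratio (convex_Icc c τ) (fun t ht => (hψ t ht).ne)
      ⟨hζ.1.le, hζ.2.le⟩ ⟨hcτ.le, le_rfl⟩ hζ.2
    have h1 : 0 ≤ χ ζ / (u' ζ - N ζ) :=
      div_nonneg_of_nonpos hζ0 (hψ ζ ⟨hζ.1.le, hζ.2.le⟩).le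
    have h2 := h1.trans_lt this
    rcases div_pos_iff.1 h2 with h3 | h3
    · linarith [h3.2]
    · exact h3.1
  have hW := h.wronskian_ψ_χ τ
  have hW0 := h.wronskian_pos
  rw [← hψ'] at hW
  have hχlt : τ * χ' τ - χ τ < 0 := by
    have h1 : 0 < (u' τ - N τ) * (τ * χ' τ - χ τ) := by
      have h2 : (u' τ - N τ) * (τ * χ' τ - χ τ)
          = τ * (u c * (y c ^ 2 - 1)) + χ τ * (τ * ψτ' - (u' τ - N τ)) := by rw [← hW]; ring
      rw [h2]
      have := mul_pos_of_neg_of_neg hχτ (sub_neg.2 hlt)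
      positivity
    exact neg_of_mul_pos_right h1 hψτ.le
  obtain ⟨l, k, hl, hk, hlk⟩ := h.decomposition hv hcone
  obtain ⟨e1, e2⟩ := hlk τ
  rw [← hψ'] at e2
  have hvneg : v τ < 0 := by
    rw [e1]
    have h1 := mul_pos hl (neg_pos.2 hψτ)
    have h2 := mul_nonneg hk (neg_pos.2 hχτ).le
    linarith
  have hv'lt : τ * v' τ < v τ := by
    rw [e1, e2]
    have h1 := mul_pos hl (sub_pos.2 hlt)
    have h2 := mul_nonneg hk (neg_pos.2 hχlt).le
    linarith
  have hv' : v' τ < 0 := by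
    by_contra! h1
    have := mul_nonneg hτ0.le h1
    linarith
  exact ⟨⟨by linarith, by linarith, by linarith⟩, hvneg⟩

end Peak

lemma exists_Ioc_pos {f : ℝ → ℝ} (hf : Continuous f) {c : ℝ} (hc : 0 < f c) (z : ℝ) (hz : z < c) :
    ∃ δ, z < δ ∧ δ < c ∧ ∀ t ∈ Ioc δ c, 0 < f t := by
  obtain ⟨δ, hδ, h⟩ := mem_nhdsLE_iff_exists_Ioc_subset.1 (mem_nhdsWithin_of_mem_nhds
    (hf.continuousAt.eventually (lt_mem_nhds hc)) : _ ∈ 𝓝[≤] c)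
  have hδ : δ < c := hδ
  refine ⟨max δ ((z + c) / 2), lt_max_of_lt_right (by linarith), max_lt hδ (by linarith), ?_⟩
  exact fun t ht => h ⟨(le_max_left _ _).trans_lt ht.1, ht.2⟩

namespace Peak

variable {y u u' N N' χ χ' v v' : ℝ → ℝ} {c z : ℝ}

/-- `u y - c` times a multiple of `u u'` integrates to something positive before the maximum. -/
lemma exists_potential (h : Peak y u u' N N' χ χ' c) (hz : 0 ≤ z)
    (hu : ∀ t ∈ Ioc z c, 0 < u t) (hu' : ∀ t ∈ Ioo z c, 0 < u' t) :
    ∃ Z : ℝ → ℝ, Z c = 0 ∧ (∀ t ∈ Ioc z c, HasDerivAt Z (-(2 * u t * u' t * (u t * y t - c))) t) ∧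
      ∀ t ∈ Ioo z c, 0 < Z t := by
  have hy := h.cont
  have huc := h.continuous
  have hjc : Continuous fun t => u t ^ 2 * y t ^ 2 / 2 := by fun_prop
  set J : ℝ → ℝ := fun t => ∫ s in c..t, u s ^ 2 * y s ^ 2 / 2 with hJ
  have hJd : ∀ t, HasDerivAt J (u t ^ 2 * y t ^ 2 / 2) t :=
    fun t => (hjc.integral_hasStrictDerivAt c t).hasDerivAt
  have hJc : J c = 0 := by simp [hJ]
  set k := u c ^ 2 * c * (y c ^ 2 - 2) / 2 with hk
  have hk0 : 0 < k := by
    have := h.u_c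
    have := h.c_pos
    have : 0 < y c ^ 2 - 2 := by linarith [h.two_lt]
    positivity
  set Z : ℝ → ℝ := fun t => k + u t ^ 2 * (2 * c - u t * y t) / 2 - J t with hZ
  have hZc : Z c = 0 := by
    simp only [hZ, hJc, hk, h.eq c]; ring
  have hZd : ∀ t ∈ Ioc z c, HasDerivAt Z (-(2 * u t * u' t * (u t * y t - c))) t := by
    intro t ht
    have ht0 : t ≠ 0 := (hz.trans_lt ht.1).ne'
    refine ((((((h.hu t).pow 2).mul (((h.hu t).mul (h.hasDerivAt_y ht0)).const_sub
      (2 * c))).div_const 2).const_add k).sub (hJd t)).congr_deriv ?_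
    simp only [Pi.pow_apply, Pi.mul_apply]
    rw [h.eq]
    field_simp
    push_cast
    ring
  have hZcont : ContinuousOn Z (Ioc z c) := fun t ht => (hZd t ht).continuousAt.continuousWithinAt
  refine ⟨Z, hZc, hZd, fun t ht => ?_⟩
  by_cases hcase : ∀ p ∈ Ioo t c, c < u p * y p
  · have : StrictAntiOn Z (Icc t c) := by
      refine strictAntiOn_of_deriv_neg (convex_Icc t c)
        (hZcont.mono fun s hs => ⟨ht.1.trans_le hs.1, hs.2⟩) (fun s hs => ?_)
      rw [interior_Icc] at hs
      rw [(hZd s ⟨ht.1.trans hs.1, hs.2.le⟩).deriv, neg_lt_zero]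
      have h1 := hu s ⟨ht.1.trans hs.1, hs.2.le⟩
      have h2 := hu' s ⟨ht.1.trans hs.1, hs.2⟩
      have h3 := sub_pos.2 (hcase s hs)
      positivity
    have := this (left_mem_Icc.2 ht.2.le) (right_mem_Icc.2 ht.2.le) ht.2
    rwa [hZc] at this
  · push Not at hcase
    obtain ⟨q, hq, hq0⟩ := hcase
    have hK : IsCompact (Icc t q ∩ (fun s => u s * y s) ⁻¹' Iic c) :=
      isCompact_Icc.inter_right (isClosed_Iic.preimage (by fun_prop))
    obtain ⟨p, ⟨⟨hp1, hp2⟩, hp3⟩, hp4⟩ := hK.exists_isLeast ⟨q, ⟨hq.1.le, le_rfl⟩, hq0⟩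
    have hp3 : u p * y p ≤ c := hp3
    have hpc : p < c := hp2.trans_lt hq.2
    have hZp : 0 < Z p := by
      have h1 := hu p ⟨ht.1.trans_le hp1, hpc.le⟩
      have h2 : 0 < 2 * c - u p * y p := by linarith [h.c_pos]
      have h3 : J p ≤ J c := le_of_hasDerivAt_nonneg hpc.le (continuous_of_hasDerivAt hJd)
        (fun r _ => hJd r) (fun r _ => by positivity)
      have h4 : 0 < u p ^ 2 * (2 * c - u p * y p) / 2 := by positivity
      rw [hJc] at h3
      simp only [hZ]
      linarith
    have hanti : AntitoneOn Z (Icc t p) := by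
      refine antitoneOn_of_deriv_nonpos (convex_Icc t p)
        (hZcont.mono fun s hs => ⟨ht.1.trans_le hs.1, hs.2.trans hpc.le⟩) (fun s hs => ?_)
        (fun s hs => ?_)
      · rw [interior_Icc] at hs
        exact (hZd s ⟨ht.1.trans hs.1, (hs.2.trans hpc).le⟩).differentiableAt.differentiableWithinAt
      · rw [interior_Icc] at hs
        rw [(hZd s ⟨ht.1.trans hs.1, (hs.2.trans hpc).le⟩).deriv, neg_nonpos]
        have h1 := hu s ⟨ht.1.trans hs.1, (hs.2.trans hpc).le⟩
        have h2 := hu' s ⟨ht.1.trans hs.1, hs.2.trans hpc⟩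
        have h3 : 0 < u s * y s - c := by
          by_contra! h3
          have := hp4 ⟨⟨hs.1.le, hs.2.le.trans hp2⟩, sub_nonpos.1 h3⟩
          exact absurd hs.2 (not_lt.2 this)
        positivity
    exact hZp.trans_le (hanti (left_mem_Icc.2 hp1) (right_mem_Icc.2 hp1) hp1)

/-- `c N + β χ` dominates `u` before the maximum. -/
lemma comparison_before (h : Peak y u u' N N' χ χ' c) (hz : 0 ≤ z) (hzc : z < c)
    (hu : ∀ t ∈ Ioc z c, 0 < u t) (hu' : ∀ t ∈ Ioo z c, 0 < u' t) :
    ∃ β : ℝ, 0 ≤ β ∧ β ≤ u c ∧ ∀ t ∈ Ioo z c, 0 < c * N t - u t + β * χ t := by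
  have hy := h.cont
  have hypos : ∀ t ∈ Ioc z c, 0 < y t := fun t ht => by
    have := hu t ht
    rw [h.eq] at this
    exact pos_of_mul_pos_right this (hz.trans ht.1.le)
  set β := u c - c * N c with hβ
  have hβ0 : 0 ≤ β := by
    rw [hβ, h.N_c, h.eq, ← mul_sub]
    refine mul_nonneg h.c_pos.le ?_
    rw [sub_nonneg, div_le_iff₀ (by linarith [h.two_lt])]
    nlinarith [h.two_lt, h.y_c]
  refine ⟨β, hβ0, by have := mul_pos h.c_pos h.N_c_pos; linarith, ?_⟩
  have hE : Lin y (fun t => 2 * y t ^ 3 * (c - t)) (fun t => c * N t - u t + β * χ t)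
      (fun t => c * N' t - u' t + β * χ' t) := by
    have := ((h.lin_N.smul c).sub h.lin_u).add (h.lin_χ.smul β)
    convert this using 2 with t
    rw [h.eq]; simp; ring
  set E : ℝ → ℝ := fun t => c * N t - u t + β * χ t with hEdef
  set E' : ℝ → ℝ := fun t => c * N' t - u' t + β * χ' t with hE'def
  have hEc : E c = 0 := by simp [hEdef, h.χ_c, hβ]
  have hE'c : E' c = 0 := by simp [hE'def, h.χ'_c, h.N'_c, h.u'_c]
  have hS : Lin y (fun t => 2 * u t * (y t ^ 2 - 1)) (fun t => (c - t) * u' t - E t)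
      (fun t => -u' t + (c - t) * (u t - y t ^ 2 * u t) - E' t) := by
    refine ⟨fun t => ((((hasDerivAt_id t).const_sub c).mul (h.hu' t)).sub (hE.hx t)).congr_deriv
      (by simp), fun t => (((h.hu' t).neg.add (((hasDerivAt_id t).const_sub c).mul
        (h.lin_u'.hx' t))).sub (hE.hx' t)).congr_deriv (by simp; ring)⟩
  obtain ⟨δ, hδz, hδc, hδχ⟩ := exists_Ioc_pos h.lin_χ.continuous (by rw [h.χ_c]; norm_num) z hzc
  obtain ⟨δ', hδz', hδc', hδy⟩ := exists_Ioc_pos (f := fun t => y t ^ 2 - 1) (by fun_prop)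
    (by linarith [h.two_lt]) δ hδc
  have hEnear : ∀ t ∈ Ioo δ c, 0 < E t := hE.pos_before h.lin_χ hδχ (fun t ht => by
    have h1 := hypos t ⟨hδz.trans ht.1, ht.2.le⟩
    have h2 := sub_pos.2 ht.2
    positivity) hEc hE'c
  have hSnear : ∀ t ∈ Ioo δ' c, 0 < (c - t) * u' t - E t :=
    hS.pos_before h.lin_χ (fun t ht => hδχ t ⟨hδz'.trans ht.1, ht.2⟩) (fun t ht => by
      have h1 := hδy t ⟨ht.1, ht.2.le⟩
      have h2 := hu t ⟨(hδz.trans hδz').trans ht.1, ht.2.le⟩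
      positivity) (by simp [hEc]) (by simp [hE'c, h.u'_c])
  intro t ht
  by_contra! hcon
  obtain ⟨q, hq1, hq2, hq3, hq4⟩ := exists_last_zero hE.continuous hδc hEnear ht.2 hcon
  have hqz : z < q := ht.1.trans_le hq1
  have hSpos : ∀ s ∈ Ico q c, 0 < (c - s) * u' s - E s := by
    intro s hs
    by_contra! hcon
    obtain ⟨p, hp1, hp2, hp3, hp4⟩ := exists_last_zero hS.continuous hδc' hSnear hs.2 hcon
    have hqp : q ≤ p := hs.1.trans hp1
    have hpd := nonneg_deriv_of_pos_right hp2 (hS.hx p) hp3 hp4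
    obtain ⟨Z, hZc, hZd, hZpos⟩ := h.exists_potential hz hu hu'
    have hpz : z < p := hqz.trans_le hqp
    have hmono : MonotoneOn (fun t => (-u' t + (c - t) * (u t - y t ^ 2 * u t) - E' t) * (t * u' t)
        - ((c - t) * u' t - E t) * (u' t + t * (u t - y t ^ 2 * u t)) + Z t) (Icc p c) := by
      have hd : ∀ r ∈ Icc p c, HasDerivAt (fun t => (-u' t + (c - t) * (u t - y t ^ 2 * u t)
          - E' t) * (t * u' t) - ((c - t) * u' t - E t) * (u' t + t * (u t - y t ^ 2 * u t)) + Z t)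
          (2 * u r * E r) r := fun r hr =>
        ((hS.wronskian h.lin_m r).add (hZd r ⟨hpz.trans_le hr.1, hr.2⟩)).congr_deriv (by
          rw [h.eq]; ring)
      refine monotoneOn_of_deriv_nonneg (convex_Icc p c) (fun r hr =>
        (hd r hr).continuousAt.continuousWithinAt) (fun r hr => ?_) (fun r hr => ?_)
      · exact (hd r (interior_subset hr)).differentiableAt.differentiableWithinAt
      · rw [(hd r (interior_subset hr)).deriv]
        rw [interior_Icc] at hr
        have h1 := hu r ⟨hpz.trans hr.1, hr.2.le⟩
        have h2 := hq4 r ⟨hqp.trans_lt hr.1, hr.2⟩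
        positivity
    have h1 := hmono (left_mem_Icc.2 hp2.le) (right_mem_Icc.2 hp2.le) hp2.le
    simp only [hp3, zero_mul, sub_zero, sub_self, hEc, hZc, h.u'_c, mul_zero, add_zero] at h1
    have h2 := hZpos p ⟨hpz, hp2⟩
    have h3 : 0 ≤ p * u' p := mul_nonneg (hz.trans hpz.le) (hu' p ⟨hpz, hp2⟩).le
    have h4 := mul_nonneg hpd h3
    linarith
  have h1 := lt_of_hasDerivAt_pos hq2 (hE.continuous_wronskian h.lin_u')
    (fun r _ => hE.wronskian h.lin_u' r) (fun r hr => by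
      have h1 := hypos r ⟨hqz.trans hr.1, hr.2.le⟩
      have h2 := hSpos r ⟨hr.1.le, hr.2⟩
      have h3 : 0 < 2 * y r ^ 3 * ((c - r) * u' r - E r) := by positivity
      linarith)
  rw [hEc, hE'c, hq3] at h1
  have h2 := nonneg_deriv_of_pos_right hq2 (hE.hx q) hq3 hq4
  have h3 := mul_nonneg h2 (hu' q ⟨hqz, hq2⟩).le
  linarith

/-- Consequences of `N > 0` on an interval ending at the maximum. -/
lemma w_neg_before (h : Peak y u u' N N' χ χ' c) {s : ℝ} (hsc : s < c)
    (hu : ∀ t ∈ Ioo s c, 0 < u t) (hN : ∀ t ∈ Ioo s c, 0 < N t) :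
    (u s - y s ^ 2 * u s - N' s) * (s * u' s)
      - (u' s - N s) * (u' s + s * (u s - y s ^ 2 * u s)) < 0 := by
  have := lt_of_hasDerivAt_pos hsc (continuous_of_hasDerivAt h.hasDerivAt_omega)
    (fun r _ => h.hasDerivAt_omega r) (fun r hr => by
      have h1 := hu r hr
      have h2 := hN r hr
      positivity)
  rw [h.omega_c] at this
  have h1 : 0 ≤ u s ^ 2 := by positivity
  linarith

/-- At the last zero of `χ` before the maximum, and before, `ψ` is positive. -/
lemma ψ_pos_before (h : Peak y u u' N N' χ χ' c) {s ζ : ℝ} (hs : 0 ≤ s) (hsζ : s ≤ ζ) (hζc : ζ < c)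
    (hu : ∀ t ∈ Ioo s c, 0 < u t) (hu' : ∀ t ∈ Ico s c, 0 < u' t) (hN : ∀ t ∈ Ioo s c, 0 < N t)
    (hζ : χ ζ = 0) (hpos : ∀ t ∈ Ioo ζ c, 0 < χ t) : ∀ t ∈ Icc s ζ, 0 < u' t - N t := by
  have hψζ : 0 < u' ζ - N ζ := by
    have h1 := nonneg_deriv_of_pos_right hζc (h.lin_χ.hx ζ) hζ hpos
    have h2 := h.wronskian_ψ_χ ζ
    rw [hζ, mul_zero, sub_zero] at h2
    exact pos_of_mul_pos_left (h2 ▸ h.wronskian_pos) h1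
  intro t ht
  by_contra! hcon
  have htζ : t < ζ := ht.2.lt_of_ne (by rintro rfl; linarith)
  obtain ⟨δ, hδ1, hδ2, hδ3⟩ := exists_Ioc_pos h.lin_ψ.continuous hψζ t htζ
  obtain ⟨p, hp1, hp2, hp3, hp4⟩ := exists_last_zero h.lin_ψ.continuous hδ2
    (fun r hr => hδ3 r ⟨hr.1, hr.2.le⟩) htζ hcon
  have hd := nonneg_deriv_of_pos_right hp2 (h.lin_ψ.hx p) hp3 hp4
  have hsp : s ≤ p := ht.1.trans hp1
  have hpc : p < c := hp2.trans hζc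
  have hw := h.w_neg_before hpc (fun r hr => hu r ⟨hsp.trans_lt hr.1, hr.2⟩)
    (fun r hr => hN r ⟨hsp.trans_lt hr.1, hr.2⟩)
  rw [hp3, zero_mul, sub_zero] at hw
  have h1 : 0 ≤ p * u' p := mul_nonneg (hs.trans hsp) (hu' p ⟨hsp, hpc⟩).le
  have h2 := mul_nonneg hd h1
  linarith

lemma N_pos_before (h : Peak y u u' N N' χ χ' c) (hz : 0 ≤ z) (hzc : z < c)
    (hu : ∀ t ∈ Ioc z c, 0 < u t) (hu' : ∀ t ∈ Ioo z c, 0 < u' t) :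
    ∀ t ∈ Ioo z c, 0 < N t := by
  obtain ⟨β, hβ0, hβu, hE⟩ := h.comparison_before hz hzc hu hu'
  obtain ⟨δ, hδz, hδc, hδN⟩ := exists_Ioc_pos h.lin_N.continuous h.N_c_pos z hzc
  obtain ⟨δ', hδz', hδc', hδχ⟩ := exists_Ioc_pos h.lin_χ.continuous
    (by rw [h.χ_c]; norm_num) z hzc
  intro t ht
  by_contra! hcon
  obtain ⟨q, hq1, hq2, hq3, hq4⟩ := exists_last_zero h.lin_N.continuous hδc
    (fun r hr => hδN r ⟨hr.1, hr.2.le⟩) ht.2 hcon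
  have hqz : z < q := ht.1.trans_le hq1
  have hEq := hE q ⟨hqz, hq2⟩
  rw [hq3, mul_zero, zero_sub] at hEq
  have huq := hu q ⟨hqz, hq2.le⟩
  by_cases hcase : ∀ r ∈ Icc q c, 0 < χ r
  · have hanti : AntitoneOn (fun r => u r / χ r) (Icc q c) := by
      refine antitoneOn_of_deriv_nonpos (convex_Icc q c) (h.continuous.continuousOn.div
        h.lin_χ.continuous.continuousOn (fun r hr => (hcase r hr).ne')) (fun r hr => ?_)
        (fun r hr => ?_)
      · exact ((h.hu r).fun_div (h.lin_χ.hx r) (hcase r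
          (interior_subset hr)).ne').differentiableAt.differentiableWithinAt
      · rw [((h.hu r).fun_div (h.lin_χ.hx r) (hcase r (interior_subset hr)).ne').deriv]
        rw [interior_Icc] at hr
        refine div_nonpos_of_nonpos_of_nonneg ?_ (by positivity)
        have := le_of_hasDerivAt_nonneg hr.2.le (h.lin_u.continuous_wronskian h.lin_χ)
          (fun r _ => h.hasDerivAt_wronskian_u_χ r) (fun s hs => by
            have h1 := hu s ⟨hqz.trans (hr.1.trans hs.1), hs.2.le⟩
            have h2 := hcase s ⟨(hr.1.trans hs.1).le, hs.2.le⟩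
            positivity)
        rwa [h.wronskian_u_χ_c] at this
    have h1 := hanti (left_mem_Icc.2 hq2.le) (right_mem_Icc.2 hq2.le) hq2.le
    have hχq := hcase q ⟨le_rfl, hq2.le⟩
    simp only [h.χ_c, div_one] at h1
    rw [le_div_iff₀ hχq] at h1
    have h2 := mul_le_mul_of_nonneg_right hβu hχq.le
    linarith
  · push Not at hcase
    obtain ⟨r, hr, hr0⟩ := hcase
    have hrc : r < c := hr.2.lt_of_ne (by rintro rfl; rw [h.χ_c] at hr0; linarith)
    obtain ⟨ζ, hζ1, hζ2, hζ3, hζ4⟩ := exists_last_zero h.lin_χ.continuous hδc'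
      (fun r hr => hδχ r ⟨hr.1, hr.2.le⟩) hrc hr0
    have hqζ : q ≤ ζ := hr.1.trans hζ1
    have hψ := h.ψ_pos_before (hz.trans hqz.le) hqζ hζ2
      (fun s hs => hu s ⟨hqz.trans hs.1, hs.2.le⟩) (fun s hs => hu' s ⟨hqz.trans_le hs.1, hs.2⟩)
      hq4 hζ3 hζ4
    have h1 := (h.strictMonoOn_ratio (convex_Icc q ζ) (fun s hs => (hψ s hs).ne')).monotoneOn
      (left_mem_Icc.2 hqζ) (right_mem_Icc.2 hqζ) hqζ
    simp only [hζ3, zero_div] at h1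
    rw [div_le_iff₀ (hψ q ⟨le_rfl, hqζ⟩), zero_mul] at h1
    have h2 := mul_nonpos_of_nonneg_of_nonpos hβ0 h1
    linarith

/-- Propagation of the cone from a zero of `u` to the next maximum. -/
lemma cone_before (h : Peak y u u' N N' χ χ' c) (hv : Lin y 0 v v') (hz : 0 ≤ z) (hzc : z < c)
    (hu : ∀ t ∈ Ioc z c, 0 < u t) (hu' : ∀ t ∈ Ico z c, 0 < u' t) (huz : u z = 0)
    (hcone : Cone v v' z) : PeakCone y u v v' c := by
  have hypos : ∀ t ∈ Ioc z c, 0 < y t := fun t ht => by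
    have := hu t ht
    rw [h.eq] at this
    exact pos_of_mul_pos_right this (hz.trans ht.1.le)
  have hN := h.N_pos_before hz hzc hu (fun t ht => hu' t ⟨ht.1.le, ht.2⟩)
  have hu'z := hu' z ⟨le_rfl, hzc⟩
  obtain ⟨δ', hδz', hδc', hδχ⟩ := exists_Ioc_pos h.lin_χ.continuous
    (by rw [h.χ_c]; norm_num) z hzc
  obtain ⟨r, hr, hr0⟩ : ∃ r ∈ Ioo z c, χ r ≤ 0 := by
    by_contra! hcon
    have := lt_of_hasDerivAt_pos hzc (h.lin_u.continuous_wronskian h.lin_χ)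
      (fun r _ => h.hasDerivAt_wronskian_u_χ r) (fun r hr => by
        have h1 := hu r ⟨hr.1, hr.2.le⟩
        have h2 := hcon r hr
        have h3 := hypos r ⟨hr.1, hr.2.le⟩
        positivity)
    rw [h.wronskian_u_χ_c, huz, zero_mul, sub_zero] at this
    have hχ : 0 ≤ χ z := by
      refine ge_of_tendsto (h.lin_χ.continuous.continuousAt.tendsto.mono_left
        (nhdsWithin_le_nhds (s := Ioi z))) ?_
      filter_upwards [Ioo_mem_nhdsGT hzc] with t ht using (hcon t ht).le
    nlinarith
  obtain ⟨ζ, hζ1, hζ2, hζ3, hζ4⟩ := exists_last_zero h.lin_χ.continuous hδc'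
    (fun r hr => hδχ r ⟨hr.1, hr.2.le⟩) hr.2 hr0
  have hzζ : z < ζ := hr.1.trans_le hζ1
  have hψ := h.ψ_pos_before hz hzζ.le hζ2 (fun s hs => hu s ⟨hs.1, hs.2.le⟩) hu' hN hζ3 hζ4
  have hψz := hψ z ⟨le_rfl, hzζ.le⟩
  have hχz : χ z < 0 := by
    have h1 := h.strictMonoOn_ratio (convex_Icc z ζ) (fun s hs => (hψ s hs).ne')
      (left_mem_Icc.2 hzζ.le) (right_mem_Icc.2 hzζ.le) hzζ
    simp only [hζ3, zero_div] at h1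
    rwa [div_lt_iff₀ hψz, zero_mul] at h1
  have hw := h.w_neg_before hzc (fun s hs => hu s ⟨hs.1, hs.2.le⟩) hN
  have hW := h.wronskian_ψ_χ z
  have hW0 := h.wronskian_pos
  set ψz' := u z - y z ^ 2 * u z - N' z with hψ'
  have hlt : z * ψz' < u' z - N z := by
    have h1 : u' z * (z * ψz' - (u' z - N z)) < 0 := by
      rw [huz] at hw
      linarith
    linarith [neg_of_mul_neg_right h1 hu'z.le]
  have hχlt : 0 < z * χ' z - χ z := by
    have h1 : 0 < (u' z - N z) * (z * χ' z - χ z) := by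
      have h2 : (u' z - N z) * (z * χ' z - χ z)
          = z * (u c * (y c ^ 2 - 1)) + χ z * (z * ψz' - (u' z - N z)) := by rw [← hW]; ring
      rw [h2]
      have := mul_pos_of_neg_of_neg hχz (sub_neg.2 hlt)
      positivity
    exact pos_of_mul_pos_right h1 hψz.le
  obtain ⟨hv0, hv1, hv2⟩ := hcone
  have k1 : v' z * χ z - v z * χ' z < 0 := by
    rcases hz.eq_or_lt with rfl | hz0
    · rw [zero_mul] at hv2
      have : v 0 = 0 := le_antisymm hv2 hv0
      rw [this, zero_mul, sub_zero]
      exact mul_neg_of_pos_of_neg hv1 hχz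
    · have h1 : z * (v' z * χ z - v z * χ' z) < 0 := by
        have h2 : z * (v' z * χ z - v z * χ' z)
          = -(v z * (z * χ' z - χ z)) + χ z * (z * v' z - v z) := by ring
        rw [h2]
        rcases hv0.eq_or_lt with h3 | h3
        · rw [← h3]
          have := mul_neg_of_neg_of_pos hχz (mul_pos hz0 hv1)
          linarith
        · have h4 := mul_pos h3 hχlt
          have h5 := mul_nonneg_of_nonpos_of_nonpos hχz.le (sub_nonpos.2 hv2)
          linarith
      exact neg_of_mul_neg_right h1 hz0.le
  have k2 : 0 ≤ (u' z - N z) * v' z - ψz' * v z := by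
    rcases hz.eq_or_lt with rfl | hz0
    · rw [zero_mul] at hv2
      have : v 0 = 0 := le_antisymm hv2 hv0
      rw [this, mul_zero, sub_zero]
      exact (mul_pos hψz hv1).le
    · have h1 : 0 ≤ z * ((u' z - N z) * v' z - ψz' * v z) := by
        have h2 : z * ((u' z - N z) * v' z - ψz' * v z)
          = v z * ((u' z - N z) - z * ψz') + (u' z - N z) * (z * v' z - v z) := by ring
        rw [h2]
        exact add_nonneg (mul_nonneg hv0 (sub_pos.2 hlt).le)
          (mul_nonneg hψz.le (sub_nonneg.2 hv2))
      exact nonneg_of_mul_nonneg_right h1 hz0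
  have e1 := hv.wronskian_const h.lin_χ z c
  have e2 := h.lin_ψ.wronskian_const hv z c
  rw [← hψ'] at e2
  simp only [h.u'_c, h.N_c, h.N'_c, h.χ_c, h.χ'_c] at e1 e2
  exact ⟨by linarith, by linarith⟩

end Peak

namespace Profile

variable {y u u' v v' : ℝ → ℝ} {c z τ : ℝ}

lemma energy_neg : energy (fun t => -y t) (fun t => -u t) (fun t => -u' t) = energy y u u' := by
  funext t
  simp [energy]

lemma y_pos (h : Profile y u u') {t : ℝ} (ht : 0 ≤ t) (hu : 0 < u t) : 0 < y t := by
  rw [h.eq] at hu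
  exact pos_of_mul_pos_right hu ht

/-- After a maximum with positive energy, `u` decreases as long as it is positive. -/
lemma decreasing_after (h : Profile y u u') (h1 : u' c = 0) (h2 : 2 < y c ^ 2)
    (hu : ∀ t ∈ Ico c τ, 0 < u t) (hH : ∀ t ∈ Ioc c τ, 0 < energy y u u' t) (huτ : 0 ≤ u τ) :
    ∀ t ∈ Ioc c τ, u' t < 0 := by
  intro s hs
  by_contra! hcon
  have huc := hu c ⟨le_rfl, hs.1.trans_le hs.2⟩
  have hev : ∀ᶠ t in 𝓝 c, u t - y t ^ 2 * u t < 0 := by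
    refine (h.lin_u'.continuous').continuousAt.eventually (gt_mem_nhds ?_)
    nlinarith
  obtain ⟨δ, hδ, hδR⟩ := mem_nhdsGT_iff_exists_Ioo_subset.1 (mem_nhdsWithin_of_mem_nhds hev :
    _ ∈ 𝓝[>] c)
  obtain ⟨p, hp1, hp2, hp3, hp4⟩ := exists_first_zero (f := fun t => -u' t) h.continuous'.neg hδ
    (fun t ht => by
      have := lt_of_hasDerivAt_pos ht.1 h.continuous'.neg (fun r _ => (h.hu' r).neg)
        (fun r hr => by
          have h3 : u r - y r ^ 2 * u r < 0 := hδR ⟨hr.1, hr.2.trans ht.2⟩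
          linarith)
      simpa [h1] using this) hs.1 (by simpa using hcon)
  have hd := nonpos_deriv_of_pos_left hp1 (h.hu' p).neg hp3 hp4
  have hpτ : p ≤ τ := hp2.trans hs.2
  have hHp := hH p ⟨hp1, hpτ⟩
  have hup : 0 ≤ u p := by
    rcases hpτ.eq_or_lt with rfl | h3
    · exact huτ
    · exact (hu p ⟨hp1.le, h3⟩).le
  have hu'p : u' p = 0 := by linarith
  unfold energy at hHp
  rw [hu'p] at hHp
  have h4 : 0 ≤ u p * (u p - y p ^ 2 * u p) := mul_nonneg hup (by linarith)
  nlinarith [sq_nonneg (u p)]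

/-- Between two zeros, `u` has a maximum before which it increases. -/
lemma exists_max (h : Profile y u u') (hz : 0 ≤ z) (hu'z : 0 < u' z)
    (hu : ∀ t ∈ Ioo z τ, 0 < u t) (hH : ∀ t ∈ Ioo z τ, 0 < energy y u u' t) {s : ℝ}
    (hs : s ∈ Ioo z τ) (hs' : u' s ≤ 0) :
    ∃ c ∈ Ioo z τ, u' c = 0 ∧ 0 < y c ∧ 2 < y c ^ 2 ∧ ∀ t ∈ Ico z c, 0 < u' t := by
  obtain ⟨δ, hδ, hδR⟩ := mem_nhdsGE_iff_exists_Ico_subset.1 (mem_nhdsWithin_of_mem_nhds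
    (h.continuous'.continuousAt.eventually (lt_mem_nhds hu'z)) : _ ∈ 𝓝[≥] z)
  obtain ⟨c, hc1, hc2, hc3, hc4⟩ := exists_first_zero h.continuous' hδ
    (fun t ht => hδR ⟨ht.1.le, ht.2⟩) hs.1 hs'
  have hc : c ∈ Ioo z τ := ⟨hc1, hc2.trans_lt hs.2⟩
  have huc := hu c hc
  have hHc := hH c hc
  unfold energy at hHc
  rw [hc3] at hHc
  refine ⟨c, hc, hc3, h.y_pos (hz.trans hc1.le) huc, ?_, fun t ht => ?_⟩
  · by_contra! h1
    nlinarith [sq_nonneg (u c)]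
  · rcases ht.1.eq_or_lt with rfl | h1
    · exact hu'z
    · exact hc4 t ⟨h1, ht.2⟩

/-- Propagation of the cone from a zero to the next. -/
lemma cone_next (h : Profile y u u') (hv : Lin y 0 v v') (hz : 0 ≤ z) (hzτ : z < τ)
    (huz : u z = 0) (hu'z : 0 < u' z) (hu : ∀ t ∈ Ioo z τ, 0 < u t) (huτ : u τ = 0)
    (hH : ∀ t ∈ Ioc z τ, 0 < energy y u u' t) (hcone : Cone v v' z) :
    u' τ < 0 ∧ Cone (fun t => -v t) (fun t => -v' t) τ ∧ v τ < 0 := by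
  obtain ⟨s, hs, hs'⟩ := exists_hasDerivAt_eq_zero hzτ h.continuous.continuousOn
    (huz.trans huτ.symm) (fun t _ => h.hu t)
  obtain ⟨c, hc, hc1, hc2, hc3, hc4⟩ := h.exists_max hz hu'z hu
    (fun t ht => hH t ⟨ht.1, ht.2.le⟩) hs hs'.le
  have hc0 : 0 < c := hz.trans_lt hc.1
  have hu2 : ∀ t ∈ Ico c τ, 0 < u t := fun t ht => hu t ⟨hc.1.trans_le ht.1, ht.2⟩
  have hdec := h.decreasing_after hc1 hc3 hu2 (fun t ht => hH t ⟨hc.1.trans ht.1, ht.2⟩)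
    huτ.ge
  obtain ⟨N, N', χ, χ', P⟩ := h.exists_peak hc0 hc1 hc2 hc3
  exact ⟨hdec τ ⟨hc.2, le_rfl⟩, P.cone_after hv (P.cone_before hv hz hc.1
    (fun t ht => hu t ⟨ht.1, ht.2.trans_lt hc.2⟩) hc4 huz hcone) hc.2 hu2 hdec
    (fun t ht => hH t ⟨hc.1.trans ht.1, ht.2.le⟩) huτ⟩

/-- At every zero of `u`, the solution `v` is in the cone, up to the sign of `u'`. -/
def SignedCone (u' v v' : ℝ → ℝ) (z : ℝ) : Prop :=
  (0 < u' z ∧ Cone v v' z ∧ (0 < z → 0 < v z)) ∨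
    (u' z < 0 ∧ Cone (fun t => -v t) (fun t => -v' t) z ∧ (0 < z → v z < 0))

lemma pos_of_ne_zero {f : ℝ → ℝ} (hf : Continuous f) {a b d : ℝ} (hab : a < b)
    (hne : ∀ t ∈ Ioo a b, f t ≠ 0) (h0 : f a = 0) (hd : HasDerivAt f d a) (hdp : 0 < d) :
    ∀ t ∈ Ioo a b, 0 < f t := by
  obtain ⟨s, hs, hs'⟩ : ∃ s ∈ Ioo a b, 0 < f s := by
    have h := (hasDerivWithinAt_iff_tendsto_slope' (self_notMem_Ioi (a := a))).1
      hd.hasDerivWithinAt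
    obtain ⟨s, h1, h2⟩ := ((h.eventually (lt_mem_nhds hdp)).and (Ioo_mem_nhdsGT hab)).exists
    refine ⟨s, h2, ?_⟩
    rw [slope_def_field, h0, sub_zero] at h1
    exact (div_pos_iff_of_pos_right (by linarith [h2.1])).1 h1
  intro t ht
  by_contra! hcon
  obtain ⟨r, hr, hr0⟩ := (isPreconnected_Ioo (a := a) (b := b)).intermediate_value ht hs
    hf.continuousOn ⟨hcon, hs'.le⟩
  exact hne r hr hr0

lemma cone_at_zeros (h : Profile y u u') (hv : Lin y 0 v v') {T : ℝ}
    (hH : ∀ t ∈ Ioc 0 T, 0 < energy y u u' t) (h0 : 0 < u' 0) (hv0 : v 0 = 0) (hv'0 : v' 0 = 1) :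
    ∀ z ∈ Icc 0 T, u z = 0 → SignedCone u' v v' z := by
  have hu0 : u 0 = 0 := by rw [h.eq, zero_mul]
  have hne : ∀ z ∈ Icc 0 T, u z = 0 → u' z ≠ 0 := by
    intro z hz hz0 hz1
    rcases hz.1.eq_or_lt with rfl | h1
    · exact h0.ne' hz1
    · have := hH z ⟨h1, hz.2⟩
      simp [energy, hz0, hz1] at this
  by_contra! hcon
  set B : Set ℝ := {z | z ∈ Icc 0 T ∧ u z = 0 ∧ ¬ SignedCone u' v v' z} with hB
  have hBne : B.Nonempty := by
    obtain ⟨z, h1, h2, h3⟩ := hcon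
    exact ⟨z, h1, h2, h3⟩
  have hBb : BddBelow B := ⟨0, fun z hz => hz.1.1⟩
  have hz0 : u (sInf B) = 0 := by
    have : sInf B ∈ closure B := csInf_mem_closure hBne hBb
    exact closure_minimal (fun z hz => hz.2.1) (isClosed_eq h.continuous continuous_const) this
  have hzI : sInf B ∈ Icc 0 T :=
    closure_minimal (fun z hz => hz.1) isClosed_Icc (csInf_mem_closure hBne hBb)
  set z := sInf B with hz
  have hiso := (h.hu z).eventually_ne (hne z hzI hz0) (c := (0 : ℝ))
  have hzB : z ∈ B := by
    by_contra hzB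
    have h1 : z ∈ closure B := csInf_mem_closure hBne hBb
    have h2 : ∃ᶠ s in 𝓝[≠] z, s ∈ B := by
      rw [← mem_closure_ne_iff_frequently_within]
      rwa [sdiff_singleton_eq_self hzB]
    obtain ⟨s, h3, h4⟩ := (h2.and_eventually hiso).exists
    exact h4 h3.2.1
  have hzpos : 0 < z := by
    refine hzI.1.lt_of_ne fun h1 => hzB.2.2 ?_
    rw [← h1]
    exact Or.inl ⟨h0, ⟨hv0.ge, by simp [hv'0], by simp [hv0]⟩, fun h => absurd h (lt_irrefl _)⟩
  obtain ⟨δ, hδ, hδR⟩ := mem_nhdsLT_iff_exists_Ioo_subset.1 (nhdsWithin_mono z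
    (fun s (hs : s < z) => hs.ne) hiso : _ ∈ 𝓝[<] z)
  have hδ : δ < z := hδ
  have hK : IsCompact (Icc 0 (max 0 δ) ∩ u ⁻¹' {0}) :=
    isCompact_Icc.inter_right (isClosed_singleton.preimage h.continuous)
  obtain ⟨s, ⟨⟨hs1, hs2⟩, hs3⟩, hs4⟩ := hK.exists_isGreatest ⟨0, ⟨le_rfl, le_max_left _ _⟩, hu0⟩
  have hs3 : u s = 0 := hs3
  have hsz : s < z := hs2.trans_lt (max_lt hzpos hδ)
  have hsne : ∀ t ∈ Ioo s z, u t ≠ 0 := by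
    intro t ht h0
    rcases le_or_gt t δ with h1 | h1
    · exact absurd ht.1 (not_lt.2 (hs4 ⟨⟨hs1.trans ht.1.le, h1.trans (le_max_right _ _)⟩, h0⟩))
    · exact hδR ⟨h1, ht.2⟩ h0
  have hsT : s ∈ Icc 0 T := ⟨hs1, hsz.le.trans hzI.2⟩
  have hsgood : SignedCone u' v v' s := by
    by_contra hbad
    exact absurd (csInf_le hBb ⟨hsT, hs3, hbad⟩) (not_le.2 hsz)
  have hHs : ∀ t ∈ Ioc s z, 0 < energy y u u' t :=
    fun t ht => hH t ⟨hs1.trans_lt ht.1, ht.2.trans hzI.2⟩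
  refine hzB.2.2 ?_
  rcases hsgood with ⟨g1, g2, -⟩ | ⟨g1, g2, -⟩
  · obtain ⟨k1, k2, k3⟩ := h.cone_next hv hs1 hsz hs3 g1
      (pos_of_ne_zero h.continuous hsz hsne hs3 (h.hu s) g1) hz0 hHs g2
    exact Or.inr ⟨k1, k2, fun _ => k3⟩
  · have hv' : Lin (fun t => -y t) 0 (fun t => -v t) (fun t => -v' t) :=
      ⟨fun t => (hv.hx t).neg, fun t => (hv.hx' t).neg.congr_deriv (by simp)⟩
    obtain ⟨k1, k2, k3⟩ := h.neg.cone_next hv' hs1 hsz (by simp [hs3]) (neg_pos.2 g1)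
      (pos_of_ne_zero h.neg.continuous hsz (fun t ht => neg_ne_zero.2 (hsne t ht)) (by simp [hs3])
        (h.neg.hu s) (neg_pos.2 g1)) (by simp [hz0]) (by rwa [energy_neg]) g2
    simp only [neg_neg] at k2
    exact Or.inl ⟨neg_lt_zero.1 k1, k2, fun _ => by linarith⟩

end Profile

namespace Profile

variable {y u u' v v' : ℝ → ℝ} {c z τ : ℝ}

lemma eq_zero_of_data (h : Profile y u u') {t : ℝ} (h0 : u t = 0) (h1 : u' t = 0) : u' 0 = 0 := by
  have hy := h.cont
  have := global_solution_unique (F := fun t x => (x.2, (1 - y t ^ 2) * x.1 + 0))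
    (α := fun t => (u t, u' t)) (β := fun _ => (0, 0))
    (linear_lipschitz (F := fun _ => 0) (by fun_prop))
    (fun s => ((h.hu s).prodMk (h.hu' s)).congr_deriv (by simp; ring))
    (fun s => (hasDerivAt_const s _).congr_deriv (by simp; rfl)) (c := t) (by simp [h0, h1])
  simpa using congrArg Prod.snd (congrFun this 0)

lemma sq_le_eventually (hlim : Tendsto y atTop (𝓝 0)) {ε : ℝ} (hε : 0 < ε) :
    ∃ T, 1 ≤ T ∧ ∀ t, T ≤ t → y t ^ 2 < ε := by
  have h1 : Tendsto (fun t => y t ^ 2) atTop (𝓝 0) := by simpa using hlim.pow 2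
  obtain ⟨T, hT⟩ := ((h1.eventually (gt_mem_nhds hε)).and (eventually_ge_atTop 1))
    |>.exists_forall_of_atTop
  exact ⟨max T 1, le_max_right _ _, fun t ht => (hT t ((le_max_left _ _).trans ht)).1⟩

lemma not_growing (h : Profile y u u') (hlim : Tendsto y atTop (𝓝 0)) {T δ : ℝ} (hδ : 0 < δ)
    (hu' : ∀ t, T ≤ t → δ ≤ u' t) : False := by
  obtain ⟨T₁, hT₁, hy⟩ := sq_le_eventually hlim (show 0 < (δ / 2) ^ 2 by positivity)
  set M := max T T₁
  have hM1 : T ≤ M := le_max_left _ _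
  have hM2 : T₁ ≤ M := le_max_right _ _
  have key : ∀ t, M ≤ t → u M + δ * (t - M) ≤ u t := by
    intro t ht
    have := le_of_hasDerivAt_nonneg (f := fun s => u s - δ * s) ht
      (h.continuous.sub (by fun_prop)) (fun s _ => (h.hu s).sub ((hasDerivAt_id s).const_mul δ))
      (fun s hs => by have := hu' s (hM1.trans hs.1.le); simp; linarith)
    linarith
  set t := M + 2 * |u M| / δ + M + 1
  have hM0 : 0 < M := by linarith
  have hab : 0 ≤ 2 * |u M| / δ := by positivity
  have ht : M ≤ t := by linarith
  have ht0 : 0 < t := by linarith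
  have h1 := key t ht
  have h2 := abs_lt_of_sq_lt_sq (hy t (hM2.trans ht)) (by positivity)
  rw [h.eq t] at h1
  have h3 := (abs_lt.1 h2).2
  have h4 : t * y t < t * (δ / 2) := by gcongr
  have h5 : δ * (2 * |u M| / δ) = 2 * |u M| := by field_simp
  have h6 : t = M + 2 * |u M| / δ + M + 1 := rfl
  have h7 := neg_abs_le (u M)
  have h8 := mul_pos hδ hM0
  rw [h6] at h1 h4
  nlinarith

lemma antitone_energy (h : Profile y u u') {s t : ℝ} (hs : 0 < s) (hst : s ≤ t) :
    energy y u u' t ≤ energy y u u' s := by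
  have := le_of_hasDerivAt_nonneg (f := fun r => -energy y u u' r) hst h.continuous_energy.neg
    (fun r hr => (h.hasDerivAt_energy (hs.trans hr.1).ne').neg) (fun r hr => by
      have := hs.trans hr.1
      have : 0 ≤ r * y r ^ 4 := by positivity
      linarith)
  linarith

lemma energy_pos (h : Profile y u u') (h0 : u' 0 ≠ 0) (hlim : Tendsto y atTop (𝓝 0)) :
    ∀ t, 0 < t → 0 < energy y u u' t := by
  have hneg : ∀ s, 0 < s → 0 ≤ energy y u u' s := by
    intro s hs
    by_contra! hcon
    set k := -energy y u u' s with hk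
    have hk0 : 0 < k := by linarith
    have hu2 : ∀ t, s ≤ t → 2 * k ≤ u t ^ 2 := by
      intro t ht
      have := h.antitone_energy hs ht
      have h1 : 0 ≤ u' t ^ 2 := by positivity
      have h2 : 0 ≤ u t ^ 2 * y t ^ 2 := by positivity
      rw [energy] at this
      linarith
    have main : ∀ {y u u' : ℝ → ℝ}, Profile y u u' → Tendsto y atTop (𝓝 0) →
        (∀ t, s ≤ t → 2 * k ≤ u t ^ 2) → ∀ r, s ≤ r → u r ≤ 0 := by
      intro y u u' h hlim hu2 r hr
      by_contra! hur
      have hupos : ∀ t, r ≤ t → 0 < u t := by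
        intro t ht
        by_contra! hcon
        obtain ⟨p, hp, hp0⟩ := isPreconnected_Icc.intermediate_value (right_mem_Icc.2 ht)
          (left_mem_Icc.2 ht) h.continuous.continuousOn ⟨hcon, hur.le⟩
        have := hu2 p (hr.trans hp.1)
        rw [hp0] at this
        linarith
      obtain ⟨T, hT1, hT⟩ := sq_le_eventually hlim (show (0 : ℝ) < 1 / 2 by norm_num)
      set M := max r T
      have hk' : 0 < Real.sqrt (2 * k) := Real.sqrt_pos.2 (by linarith)
      have hgrow : ∀ t, M ≤ t → Real.sqrt (2 * k) / 2 ≤ u t - y t ^ 2 * u t := by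
        intro t ht
        have h1 := hT t ((le_max_right _ _).trans ht)
        have h2 := hupos t ((le_max_left _ _).trans ht)
        have h3 : Real.sqrt (2 * k) ≤ u t :=
          Real.sqrt_le_iff.2 ⟨h2.le, hu2 t (hr.trans ((le_max_left _ _).trans ht))⟩
        nlinarith
      have key : ∀ t, M ≤ t → u' M + Real.sqrt (2 * k) / 2 * (t - M) ≤ u' t := by
        intro t ht
        have := le_of_hasDerivAt_nonneg (f := fun s => u' s - Real.sqrt (2 * k) / 2 * s) ht
          (h.continuous'.sub (by fun_prop)) (fun s _ => (h.hu' s).sub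
            ((hasDerivAt_id s).const_mul (Real.sqrt (2 * k) / 2)))
          (fun s hs => by have := hgrow s hs.1.le; simp only [mul_one]; linarith)
        linarith
      refine h.not_growing hlim (T := M + (1 + |u' M|) / (Real.sqrt (2 * k) / 2)) one_pos
        fun t ht => ?_
      have h1 : 0 ≤ (1 + |u' M|) / (Real.sqrt (2 * k) / 2) := by positivity
      have h2 := key t (by linarith)
      have h3 : Real.sqrt (2 * k) / 2 * ((1 + |u' M|) / (Real.sqrt (2 * k) / 2)) = 1 + |u' M| := by
        field_simp
      have h4 := neg_abs_le (u' M)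
      have h5 : Real.sqrt (2 * k) / 2 * ((1 + |u' M|) / (Real.sqrt (2 * k) / 2))
        ≤ Real.sqrt (2 * k) / 2 * (t - M) := by gcongr; linarith
      linarith
    have h1 := main h hlim hu2 s le_rfl
    have h2 := main h.neg (by simpa using hlim.neg) (by simpa using hu2) s le_rfl
    have h3 := hu2 s le_rfl
    have h4 : u s = 0 := by linarith
    rw [h4] at h3
    linarith
  intro t ht
  by_contra! hcon
  have hzero : ∀ r, t ≤ r → energy y u u' r = 0 := fun r hr =>
    le_antisymm ((h.antitone_energy ht hr).trans hcon) (hneg r (ht.trans_le hr))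
  have hd := h.hasDerivAt_energy (t := t + 1) (by linarith)
  have hd0 : HasDerivAt (energy y u u') 0 (t + 1) := by
    refine (hasDerivAt_const (t + 1) (0 : ℝ)).congr_of_eventuallyEq ?_
    filter_upwards [Ioi_mem_nhds (lt_add_one t)] with r hr using hzero r (le_of_lt hr)
  have h1 := hd.unique hd0
  have h2 : y (t + 1) = 0 := by
    have : (t + 1) * y (t + 1) ^ 4 = 0 := by linarith
    rcases mul_eq_zero.1 this with h3 | h3
    · linarith
    · exact pow_eq_zero_iff (by norm_num) |>.1 h3
  have h3 : u (t + 1) = 0 := by rw [h.eq, h2, mul_zero]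
  have h4 := hzero (t + 1) (by linarith)
  rw [energy, h3] at h4
  have h5 : u' (t + 1) = 0 := by
    have : u' (t + 1) ^ 2 = 0 := by linarith
    exact pow_eq_zero_iff (by norm_num) |>.1 this
  exact h0 (h.eq_zero_of_data h3 h5)

end Profile

namespace Peak

variable {y u u' N N' χ χ' v v' : ℝ → ℝ} {c : ℝ}

/-- Exponential decay, in a weak form. -/
lemma decay_bound (h : Profile y u u') {T : ℝ} (hT : 4 ≤ T) (hu : ∀ t, T ≤ t → 0 < u t)
    (hu' : ∀ t, T ≤ t → u' t < 0) (hy : ∀ t, T ≤ t → y t ^ 2 ≤ 1 / 2) :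
    ∀ t, T ≤ t → t ^ 2 * (u t - u' t) ≤ T ^ 2 * (u T - u' T) := by
  intro t ht
  have hd : ∀ s, HasDerivAt (fun s => -(s ^ 2 * (u s - u' s)))
      (-(2 * s * (u s - u' s) + s ^ 2 * (u' s - (u s - y s ^ 2 * u s)))) s := fun s =>
    (((hasDerivAt_id s).pow 2).mul ((h.hu s).sub (h.hu' s))).neg.congr_deriv (by simp)
  have := le_of_hasDerivAt_nonneg ht (continuous_of_hasDerivAt hd) (fun s _ => hd s)
    (fun s hs => by
      have h1 := hu s hs.1.le
      have h2 := hu' s hs.1.le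
      have h3 := hy s hs.1.le
      have h4 : 4 ≤ s := hT.trans hs.1.le
      have h5 : y s ^ 2 * u s ≤ 1 / 2 * (u s - u' s) := by nlinarith
      have h6 : s ^ 2 * (u' s - (u s - y s ^ 2 * u s)) ≤ s ^ 2 * (-(1 / 2) * (u s - u' s)) := by
        gcongr; linarith
      have h7 : 0 ≤ s * (s - 4) * (u s - u' s) :=
        mul_nonneg (mul_nonneg (by linarith) (by linarith)) (by linarith)
      nlinarith)
  linarith

/-- The variational solution `χ` becomes negative eventually. -/
lemma χ_neg_eventually (h : Peak y u u' N N' χ χ' c)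
    (hu : ∀ t, c ≤ t → 0 < u t) (hu' : ∀ t, c < t → u' t < 0)
    (hψ : ∀ t ∈ Ici c, u' t - N t < 0) : ∃ ζ, c < ζ ∧ ∀ t, ζ < t → χ t < 0 := by
  have hua : ∀ t, c ≤ t → u t ≤ u c := fun t ht => by
    have := le_of_hasDerivAt_nonneg (f := fun s => -u s) ht h.continuous.neg
      (fun s _ => (h.hu s).neg) (fun s hs => by linarith [hu' s hs.1])
    linarith
  have huc := h.u_c
  obtain ⟨ζ, hζ, hζ0⟩ : ∃ ζ, c < ζ ∧ χ ζ ≤ 0 := by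
    by_contra! hcon
    have hg : ∀ r, HasDerivAt (fun t => u' t * χ t - u t * χ' t) (2 * y r ^ 2 * u r * χ r) r :=
      h.hasDerivAt_wronskian_u_χ
    have hgc := continuous_of_hasDerivAt hg
    have h1 := lt_of_hasDerivAt_pos (lt_add_one c) hgc
      (fun r _ => hg r) (fun r hr => by
        have h1 := hu r hr.1.le
        have h2 := hcon r hr.1
        have h3 := h.y_pos (h.c_pos.le.trans hr.1.le) h1
        positivity)
    rw [h.wronskian_u_χ_c] at h1
    set δ := u' (c + 1) * χ (c + 1) - u (c + 1) * χ' (c + 1)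
    have h2 : ∀ t, c + 1 ≤ t → χ' t ≤ -(δ / u c) := by
      intro t ht
      have h3 := le_of_hasDerivAt_nonneg ht hgc (fun r _ => hg r) (fun r hr => by
        have h1 := hu r (by linarith [hr.1])
        have h2 := hcon r (by linarith [hr.1])
        positivity)
      have h4 : δ ≤ u t * -χ' t := by
        have := mul_neg_of_neg_of_pos (hu' t (by linarith)) (hcon t (by linarith))
        linarith
      have h5 : 0 ≤ -χ' t := by
        by_contra! h6
        have := mul_neg_of_pos_of_neg (hu t (by linarith)) h6
        linarith
      have h6 : δ ≤ u c * -χ' t := h4.trans (by gcongr; exact hua t (by linarith))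
      rw [le_neg, div_le_iff₀ huc]
      linarith
    have h3 : 0 < δ / u c := div_pos h1 huc
    have hX := hcon (c + 1) (by linarith)
    obtain ⟨s, hseq⟩ : ∃ s, s = c + 1 + χ (c + 1) / (δ / u c) := ⟨_, rfl⟩
    have hs : c + 1 ≤ s := by have := div_pos hX h3; linarith
    have h4 := le_of_hasDerivAt_nonneg (f := fun t => -χ t - δ / u c * t) hs
      (h.lin_χ.continuous.neg.sub (by fun_prop))
      (fun r _ => (h.lin_χ.hx r).neg.sub ((hasDerivAt_id r).const_mul (δ / u c)))
      (fun r hr => by have := h2 r hr.1.le; simp; linarith)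
    have h5 : δ / u c * (s - (c + 1)) = χ (c + 1) := by
      have : s - (c + 1) = χ (c + 1) / (δ / u c) := by rw [hseq]; ring
      rw [this]
      exact mul_div_cancel₀ _ h3.ne'
    have h6 := hcon s (by linarith)
    linarith
  refine ⟨ζ, hζ, fun t ht => ?_⟩
  have h1 := h.strictMonoOn_ratio (convex_Ici c) (fun t ht => (hψ t ht).ne)
    hζ.le (hζ.le.trans ht.le) ht
  have h2 := (div_nonneg_of_nonpos hζ0 (hψ ζ hζ.le).le).trans_lt h1
  rcases div_pos_iff.1 h2 with h3 | h3
  · linarith [h3.2, hψ t (hζ.le.trans ht.le)]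
  · exact h3.1

lemma wronskian_χ_m_pos (h : Peak y u u' N N' χ χ' c) {R : ℝ} (hR0 : 0 < R) (hu'R : u' R < 0)
    (hψR : u' R - N R < 0) (hχR : χ R < 0)
    (hwψ : 0 < (u R - y R ^ 2 * u R - N' R) * (R * u' R)
      - (u' R - N R) * (u' R + R * (u R - y R ^ 2 * u R))) :
    0 < χ' R * (R * u' R) - χ R * (u' R + R * (u R - y R ^ 2 * u R)) := by
    have h2 : (u' R - N R) * (χ' R * (R * u' R) - χ R * (u' R + R * (u R - y R ^ 2 * u R)))
        = u c * (y c ^ 2 - 1) * (R * u' R) + χ R * ((u R - y R ^ 2 * u R - N' R) * (R * u' R)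
    - (u' R - N R) * (u' R + R * (u R - y R ^ 2 * u R))) := by
      rw [← h.wronskian_ψ_χ R]; ring
    have h3 := mul_neg_of_neg_of_pos hχR hwψ
    have h4 := mul_neg_of_pos_of_neg h.wronskian_pos (mul_neg_of_pos_of_neg hR0 hu'R)
    by_contra! h5
    have := mul_nonneg_of_nonpos_of_nonpos hψR.le h5
    linarith

/-- A solution `v` that stays negative and increasing cannot have a positive Wronskian with
`t u'`, because the latter decays exponentially. -/
lemma wronskian_m_not_pos (h : Profile y u u') (hv : Lin y 0 v v') {S R C : ℝ} (hRS : S ≤ R)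
    (hR1 : 1 ≤ R) (hC0 : 0 < C) (hu : ∀ t, S ≤ t → 0 < u t) (hu' : ∀ t, S ≤ t → u' t < 0)
    (hy : ∀ t, S ≤ t → y t ^ 2 < 1 / 3) (hvneg : ∀ t, S ≤ t → v t < 0)
    (hv'0 : ∀ t, S ≤ t → 0 ≤ v' t)
    (hdecay : ∀ t, S ≤ t → t ^ 2 * (u t - u' t) ≤ C) :
    v' R * (R * u' R) - v R * (u' R + R * (u R - y R ^ 2 * u R)) ≤ 0 := by
  by_contra! hwpos
  have hvA : ∀ t, S ≤ t → v S ≤ v t := fun t ht =>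
    le_of_hasDerivAt_nonneg ht hv.continuous (fun s _ => hv.hx s) (fun s hs => hv'0 s hs.1.le)
  have hw : ∀ r, HasDerivAt (fun t => v' t * (t * u' t) - v t * (u' t + t * (u t - y t ^ 2 * u t)))
      (-(2 * (v r * u r))) r := fun r => (hv.wronskian h.lin_m r).congr_deriv (by simp; ring)
  set ε := v' R * (R * u' R) - v R * (u' R + R * (u R - y R ^ 2 * u R)) with hε
  set B := -v S with hB
  have hB0 : 0 ≤ B := by linarith [hvneg S le_rfl]
  have hfin : ∀ t, R ≤ t → ε * t ≤ B * C := by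
    intro t ht
    have ht0 : 1 ≤ t := hR1.trans ht
    have htS : S ≤ t := hRS.trans ht
    have h1 := le_of_hasDerivAt_nonneg ht (continuous_of_hasDerivAt hw) (fun r _ => hw r)
      (fun r hr => by
        have h1 := hvneg r (hRS.trans hr.1.le)
        have h2 := hu r (hRS.trans hr.1.le)
        nlinarith)
    rw [← hε] at h1
    have hut := hu t htS
    have hu't := hu' t htS
    have hvt := hvneg t htS
    have hvSt := hvA t htS
    have hyt := hy t htS
    have h2 : v' t * (t * u' t) ≤ 0 :=
      mul_nonpos_of_nonneg_of_nonpos (hv'0 t htS)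
      (mul_nonpos_of_nonneg_of_nonpos (by linarith) hu't.le)
    have h3 : u' t + t * (u t - y t ^ 2 * u t) ≤ t * (u t - u' t) := by
      have h9 : 0 ≤ t * (y t ^ 2 * u t) := by positivity
      have h10 : 0 ≤ t * -u' t := mul_nonneg (by linarith) (by linarith)
      linarith
    have h4 : -v t * (u' t + t * (u t - y t ^ 2 * u t)) ≤ -v S * (t * (u t - u' t)) :=
      mul_le_mul (by linarith) h3 (by
        by_contra! h5
        have := mul_neg_of_pos_of_neg (neg_pos.2 hvt) h5
        linarith) (by linarith)
    have h5 := hdecay t htS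
    have h6 : ε ≤ -v S * (t * (u t - u' t)) := by linarith
    have h7 : ε * t ≤ -v S * (t ^ 2 * (u t - u' t)) := by
      have := mul_le_mul_of_nonneg_right h6 (show 0 ≤ t by linarith)
      linarith
    have h8 : -v S * (t ^ 2 * (u t - u' t)) ≤ B * C :=
      mul_le_mul_of_nonneg_left h5 hB0
    linarith
  have h1 := hfin (max R (B * C / ε + 1)) (le_max_left _ _)
  have h2 : B * C / ε + 1 ≤ max R (B * C / ε + 1) := le_max_right _ _
  have h3 : ε * (B * C / ε + 1) = B * C + ε := by field_simp
  have h4 := mul_le_mul_of_nonneg_left h2 hwpos.le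
  linarith

/-- After the last maximum of a bound state, the solution `v` leaves the cone with both `v` and
`v'` negative, arbitrarily late. -/
lemma exists_exit (h : Peak y u u' N N' χ χ' c) (hv : Lin y 0 v v') (hcone : PeakCone y u v v' c)
    (hu : ∀ t, c ≤ t → 0 < u t) (hu' : ∀ t, c < t → u' t < 0)
    (hH : ∀ t, c < t → 0 < Profile.energy y u u' t) (hlim : Tendsto y atTop (𝓝 0)) (T : ℝ) :
    ∃ T₀, T < T₀ ∧ v T₀ < 0 ∧ v' T₀ < 0 := by
  have hN : ∀ t, c ≤ t → 0 < N t := fun t ht =>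
    h.N_pos_after (τ := t + 1) (fun s hs => hu s hs.1) (fun s hs => hu' s hs.1)
      (fun s hs => hH s hs.1) t ⟨ht, by linarith⟩
  have hu'0 : ∀ t, c ≤ t → u' t ≤ 0 := by
    intro t ht
    rcases ht.eq_or_lt with rfl | h1
    · exact h.u'_c.le
    · exact (hu' t h1).le
  have hψ : ∀ t ∈ Ici c, u' t - N t < 0 := fun t ht => by
    linarith [hN t ht, hu'0 t ht]
  have hω0 := h.omega_pos_after (τ := c + 1) (fun t ht => hu t ht.1.le) (fun t ht => hN t ht.1.le)
    (by linarith)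
  set ω₀ := (u (c + 1) - y (c + 1) ^ 2 * u (c + 1) - N' (c + 1)) * ((c + 1) * u' (c + 1))
      - (u' (c + 1) - N (c + 1)) * (u' (c + 1) + (c + 1) * (u (c + 1) - y (c + 1) ^ 2 * u (c + 1)))
      + u (c + 1) ^ 2 with hω₀
  have hω : ∀ t, c + 1 ≤ t → ω₀ ≤ (u t - y t ^ 2 * u t - N' t) * (t * u' t)
      - (u' t - N t) * (u' t + t * (u t - y t ^ 2 * u t)) + u t ^ 2 := fun t ht =>
    le_of_hasDerivAt_nonneg ht (continuous_of_hasDerivAt h.hasDerivAt_omega)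
      (fun r _ => h.hasDerivAt_omega r) (fun r hr => by
        have h1 := hu r (by linarith [hr.1])
        have h2 := hN r (by linarith [hr.1])
        positivity)
  obtain ⟨ζ, hζ, hχ⟩ := h.χ_neg_eventually hu hu' hψ
  obtain ⟨l, k, hl, hk, hlk⟩ := h.decomposition hv hcone
  have hvneg : ∀ t, ζ < t → v t < 0 := by
    intro t ht
    rw [(hlk t).1]
    have h1 := mul_pos hl (neg_pos.2 (hψ t (hζ.le.trans ht.le)))
    have h2 := mul_nonneg hk (neg_pos.2 (hχ t ht)).le
    linarith
  by_contra! hcon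
  obtain ⟨Ty, hTy1, hTy⟩ := Profile.sq_le_eventually hlim (show (0 : ℝ) < 1 / 3 by norm_num)
  set S := max (max T ζ + 1) (max (c + 4) Ty) with hS
  have hST : T < S := by
    have := le_max_left T ζ
    have := le_max_left (max T ζ + 1) (max (c + 4) Ty)
    linarith
  have hSζ : ζ < S := by
    have := le_max_right T ζ
    have := le_max_left (max T ζ + 1) (max (c + 4) Ty)
    linarith
  have hSc : c + 4 ≤ S := (le_max_left _ _).trans (le_max_right (max T ζ + 1) (max (c + 4) Ty))
  have hSy : Ty ≤ S := (le_max_right _ _).trans (le_max_right (max T ζ + 1) (max (c + 4) Ty))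
  have hc0 := h.c_pos
  have hv'0 : ∀ t, S ≤ t → 0 ≤ v' t := fun t ht =>
    hcon t (hST.trans_le ht) (hvneg t (hSζ.trans_le ht))
  have hdecay := decay_bound h.toProfile (T := S) (by linarith) (fun t ht => hu t (by linarith))
    (fun t ht => hu' t (by linarith)) (fun t ht => by linarith [hTy t (hSy.trans ht)])
  set C := S ^ 2 * (u S - u' S) with hC
  have hC0 : 0 < C := by
    have := hu S (by linarith)
    have := hu' S (by linarith)
    have : 0 < S := by linarith
    have : 0 < u S - u' S := by linarith
    positivity
  set R := max S (max (1 + C) (1 + C / ω₀)) with hR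
  have hRS : S ≤ R := le_max_left _ _
  have hRC : 1 + C ≤ R := (le_max_left _ _).trans (le_max_right S _)
  have hRω : 1 + C / ω₀ ≤ R := (le_max_right _ _).trans (le_max_right S _)
  have hwpos : 0 < v' R * (R * u' R) - v R * (u' R + R * (u R - y R ^ 2 * u R)) := by
    have hR0 : 0 < R := by linarith
    have huR := hu R (by linarith)
    have hu'R := hu' R (by linarith)
    have hψR := hψ R (by change c ≤ R; linarith)
    have hχR := hχ R (by linarith)
    have h1 : u R ^ 2 < ω₀ := by
      have h2 := hdecay R hRS
      have h5 : C / ω₀ < R := by linarith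
      rw [div_lt_iff₀ hω0] at h5
      have h6 : R * (R * u R) ≤ C := by
        refine le_trans ?_ h2
        rw [← mul_assoc, ← pow_two]
        gcongr
        linarith
      have h8 : R * u R < C := by
        have := mul_pos hR0 huR
        have := mul_lt_mul_of_pos_right (show 1 < R by linarith) this
        linarith
      have h9 : u R < 1 := by
        by_contra! h10
        have := mul_le_mul_of_nonneg_left h10 hR0.le
        linarith
      have h10 : R * u R ^ 2 < R * ω₀ := by
        have := mul_lt_mul_of_pos_left h9 (mul_pos hR0 huR)
        linarith
      exact lt_of_mul_lt_mul_left h10 hR0.le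
    have hwψ : 0 < (u R - y R ^ 2 * u R - N' R) * (R * u' R)
      - (u' R - N R) * (u' R + R * (u R - y R ^ 2 * u R)) := by
      have := hω R (by linarith)
      linarith
    have hwχ := h.wronskian_χ_m_pos hR0 hu'R hψR hχR hwψ
    have h3 := mul_pos hl hwψ
    have h4 := mul_nonneg hk hwχ.le
    rw [(hlk R).1, (hlk R).2]
    linarith
  exact hwpos.not_ge (wronskian_m_not_pos h.toProfile hv hRS (by linarith) hC0
    (fun t ht => hu t (by linarith)) (fun t ht => hu' t (by linarith))
    (fun t ht => hTy t (hSy.trans ht)) (fun t ht => hvneg t (hSζ.trans_le ht)) hv'0 hdecay)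

end Peak

namespace Profile

variable {y u u' v v' y₁ u₁ u₁' : ℝ → ℝ} {z T : ℝ}

/-- After its last zero, a decaying profile has a critical point. -/
lemma exists_critical (h : Profile y u u') (hlim : Tendsto y atTop (𝓝 0))
    (hu : ∀ t, z < t → 0 < u t) : ∃ s, z < s ∧ u' s ≤ 0 := by
  by_contra! hcon
  obtain ⟨T, hT1, hT⟩ := sq_le_eventually hlim (show (0 : ℝ) < 1 / 2 by norm_num)
  set M := max T z + 1
  have hMT : T ≤ M := by have := le_max_left T z; linarith
  have hMz : z < M := by have := le_max_right T z; linarith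
  refine h.not_growing hlim (hcon M hMz) (T := M) fun t ht => ?_
  exact le_of_hasDerivAt_nonneg ht h.continuous' (fun s _ => h.hu' s) (fun s hs => by
    have h1 := hu s (hMz.trans hs.1)
    have h2 := hT s (hMT.trans hs.1.le)
    nlinarith)

/-- If `v` is in the cone at the last zero of a decaying profile, then it is negative and
decreasing at arbitrarily large times. -/
lemma exists_exit (h : Profile y u u') (hv : Lin y 0 v v') (hlim : Tendsto y atTop (𝓝 0))
    (hz : 0 ≤ z) (huz : u z = 0) (hu : ∀ t, z < t → 0 < u t) (hu'z : 0 < u' z)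
    (hH : ∀ t, z < t → 0 < energy y u u' t) (hcone : Cone v v' z) (T : ℝ) :
    ∃ T₀, T < T₀ ∧ v T₀ < 0 ∧ v' T₀ < 0 := by
  obtain ⟨s, hs, hs'⟩ := h.exists_critical hlim hu
  obtain ⟨c, hc, hc1, hc2, hc3, hc4⟩ := h.exists_max (τ := s + 1) hz hu'z
    (fun t ht => hu t ht.1) (fun t ht => hH t ht.1) ⟨hs, lt_add_one s⟩ hs'
  obtain ⟨N, N', χ, χ', P⟩ := h.exists_peak (hz.trans_lt hc.1) hc1 hc2 hc3
  refine P.exists_exit hv (P.cone_before hv hz hc.1 (fun t ht => hu t ht.1) hc4 huz hcone)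
    (fun t ht => hu t (hc.1.trans_le ht)) (fun t ht => ?_) (fun t ht => hH t (hc.1.trans ht))
    hlim T
  exact h.decreasing_after hc1 hc3 (fun r hr => hu r (hc.1.trans_le hr.1))
    (fun r hr => hH r (hc.1.trans hr.1)) (hu t (hc.1.trans ht)).le t ⟨ht, le_rfl⟩

/-- A profile that is overtaken by a small positive decaying one must vanish later. -/
lemma exists_zero_after (h₁ : Profile y₁ u₁ u₁') (h : Profile y u u')
    (hlim : Tendsto y₁ atTop (𝓝 0)) (hT : 0 < T) (hy₁ : ∀ t, T ≤ t → y₁ t ^ 2 < 1 / 3)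
    (huT : u T < u₁ T) (hu'T : u' T < u₁' T) (hpos : 0 < u T) : ∃ T', T < T' ∧ u T' = 0 := by
  by_contra! hcon
  have hu : ∀ t, T ≤ t → 0 < u t := by
    intro t ht
    by_contra! h1
    obtain ⟨p, hp, hp0⟩ := isPreconnected_Icc.intermediate_value (right_mem_Icc.2 ht)
      (left_mem_Icc.2 ht) h.continuous.continuousOn ⟨h1, hpos.le⟩
    rcases hp.1.eq_or_lt with rfl | h2
    · exact hpos.ne' hp0
    · exact hcon p h2 hp0
  set δ := u₁' T - u' T with hδ
  have hδ0 : 0 < δ := sub_pos.2 hu'T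
  have hslope : ∀ τ, T ≤ τ → (∀ t ∈ Ioo T τ, u t < u₁ t) → ∀ t ∈ Icc T τ, δ ≤ u₁' t - u' t := by
    intro τ hτ hlt t ht
    refine le_of_hasDerivAt_nonneg (f := fun t => u₁' t - u' t) ht.1
      (h₁.continuous'.sub h.continuous') (fun s _ => (h₁.hu' s).sub (h.hu' s)) (fun s hs => ?_)
    have hs0 : 0 < s := hT.trans hs.1
    have h1 := hlt s ⟨hs.1, hs.2.trans_le ht.2⟩
    have h2 := hu s hs.1.le
    have h3 := hy₁ s hs.1.le
    have h4 := h.y_pos hs0.le h2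
    have h5 : y s < y₁ s := by
      rw [h.eq, h₁.eq] at h1
      exact lt_of_mul_lt_mul_left h1 hs0.le
    rw [h.eq, h₁.eq]
    have h6 : s * y₁ s - y₁ s ^ 2 * (s * y₁ s) - (s * y s - y s ^ 2 * (s * y s))
        = s * ((y₁ s - y s) * (1 - (y₁ s ^ 2 + y₁ s * y s + y s ^ 2))) := by ring
    rw [h6]
    have h7 : y₁ s * y s ≤ y₁ s ^ 2 := by nlinarith
    have h8 : y s ^ 2 ≤ y₁ s ^ 2 := by nlinarith
    exact mul_nonneg hs0.le (mul_nonneg (by linarith) (by linarith))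
  have hlin : ∀ τ, T ≤ τ → (∀ t ∈ Ioo T τ, u t < u₁ t) → δ * (τ - T) < u₁ τ - u τ := by
    intro τ hτ hlt
    have h1 := hslope τ hτ hlt
    have := le_of_hasDerivAt_nonneg (f := fun t => u₁ t - u t - δ * t) hτ
      ((h₁.continuous.sub h.continuous).sub (by fun_prop)) (fun s _ =>
        ((h₁.hu s).sub (h.hu s)).sub ((hasDerivAt_id s).const_mul δ)) (fun s hs => by
          have := h1 s ⟨hs.1.le, hs.2.le⟩
          rw [mul_one]
          linarith)
    linarith
  have hlt : ∀ τ, T ≤ τ → u τ < u₁ τ := by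
    intro τ hτ
    rcases hτ.eq_or_lt with rfl | hτ
    · exact huT
    by_contra! h1
    obtain ⟨d, hd, hdR⟩ := mem_nhdsGE_iff_exists_Ico_subset.1 (mem_nhdsWithin_of_mem_nhds
      ((h₁.continuous.sub h.continuous).continuousAt.eventually
        (lt_mem_nhds (show 0 < u₁ T - u T by linarith))) : _ ∈ 𝓝[≥] T)
    obtain ⟨p, hp1, hp2, hp3, hp4⟩ := exists_first_zero (f := fun t => u₁ t - u t)
      (h₁.continuous.sub h.continuous) hd (fun t ht => hdR ⟨ht.1.le, ht.2⟩) hτ (by simpa using h1)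
    have h2 := hlin p hp1.le (fun t ht => sub_pos.1 (hp4 t ht))
    have h3 := mul_pos hδ0 (sub_pos.2 hp1)
    linarith
  obtain ⟨S, hS1, hS⟩ := sq_le_eventually hlim (show 0 < (δ / 2) ^ 2 by positivity)
  set M := max S (2 * T)
  have hM1 : S ≤ M := le_max_left _ _
  have hM2 : 2 * T ≤ M := le_max_right _ _
  have hMT : T ≤ M := by linarith
  have h1 := hlin M hMT (fun t ht => hlt t ht.1.le)
  have h2 := hu M hMT
  have h3 := (abs_lt.1 (abs_lt_of_sq_lt_sq (hS M hM1) (by positivity))).2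
  have h4 : M * y₁ M < M * (δ / 2) := mul_lt_mul_of_pos_left h3 (by linarith)
  rw [h₁.eq] at h1
  have h5 := mul_le_mul_of_nonneg_left hM2 hδ0.le
  linarith

end Profile

lemma clampReal_neg {R : ℝ} (hR : 0 ≤ R) (x : ℝ) : clampReal R (-x) = -clampReal R x := by
  unfold clampReal
  grind

/-- The force of the radial equation, truncated at `|y| = B`. -/
def truncatedForce (B t u : ℝ) : ℝ :=
  clampReal (B * |t|) u - clampReal (B * |t|) u ^ 3 / t ^ 2

lemma truncatedForce_neg {B : ℝ} (hB : 0 ≤ B) (t u : ℝ) :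
    truncatedForce B (-t) (-u) = -truncatedForce B t u := by
  simp only [truncatedForce, abs_neg, clampReal_neg (show 0 ≤ B * |t| by positivity)]
  ring

lemma abs_truncatedForce_le {B : ℝ} (hB : 0 ≤ B) (t u : ℝ) :
    |truncatedForce B t u| ≤ (B + B ^ 3) * |t| := by
  have h1 := abs_clampReal_le (show 0 ≤ B * |t| by positivity) u
  set k := clampReal (B * |t|) u with hk
  have h2 : |k ^ 3 / t ^ 2| ≤ B ^ 3 * |t| := by
    rw [abs_div, abs_pow, abs_pow, sq_abs]
    refine div_le_of_le_mul₀ (by positivity) (by positivity) ?_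
    calc |k| ^ 3 ≤ (B * |t|) ^ 3 := by gcongr
      _ = B ^ 3 * |t| * t ^ 2 := by rw [← sq_abs t]; ring
  calc |truncatedForce B t u| ≤ |k| + |k ^ 3 / t ^ 2| := abs_sub _ _
    _ ≤ _ := by linarith

lemma continuous_truncatedForce {B : ℝ} (hB : 0 ≤ B) (u : ℝ) :
    Continuous fun t => truncatedForce B t u := by
  rw [continuous_iff_continuousAt]
  intro t
  by_cases ht : t = 0
  · subst ht
    have h0 : truncatedForce B 0 u = 0 := by
      have := abs_truncatedForce_le hB 0 u
      simpa using this
    rw [ContinuousAt, h0]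
    refine squeeze_zero_norm (fun t => abs_truncatedForce_le hB t u) ?_
    have : Continuous fun t : ℝ => (B + B ^ 3) * |t| := by fun_prop
    simpa using this.tendsto 0
  · unfold truncatedForce clampReal
    have : t ^ 2 ≠ 0 := pow_ne_zero 2 ht
    fun_prop (disch := assumption)

lemma lipschitz_truncatedForce {B : ℝ} (hB : 0 ≤ B) (t u w : ℝ) :
    |truncatedForce B t u - truncatedForce B t w| ≤ (1 + 3 * B ^ 2) * |u - w| := by
  have h1 := abs_clampReal_le (show 0 ≤ B * |t| by positivity) u
  have h2 := abs_clampReal_le (show 0 ≤ B * |t| by positivity) w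
  have h3 := abs_clampReal_sub_le (B * |t|) u w
  unfold truncatedForce
  set k := clampReal (B * |t|) u
  set l := clampReal (B * |t|) w
  have h4 : k - k ^ 3 / t ^ 2 - (l - l ^ 3 / t ^ 2)
      = (k - l) - (k - l) * ((k ^ 2 + k * l + l ^ 2) / t ^ 2) := by ring
  have h5 : |(k ^ 2 + k * l + l ^ 2) / t ^ 2| ≤ 3 * B ^ 2 := by
    rw [abs_div, abs_pow, sq_abs]
    refine div_le_of_le_mul₀ (by positivity) (by positivity) ?_
    calc |k ^ 2 + k * l + l ^ 2| ≤ |k| ^ 2 + |k| * |l| + |l| ^ 2 := by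
          refine (abs_add_three _ _ _).trans_eq ?_
          rw [abs_pow, abs_mul, abs_pow]
      _ ≤ (B * |t|) ^ 2 + (B * |t|) * (B * |t|) + (B * |t|) ^ 2 := by gcongr
      _ = 3 * B ^ 2 * t ^ 2 := by rw [← sq_abs t]; ring
  rw [h4]
  calc _ ≤ |k - l| + |(k - l) * ((k ^ 2 + k * l + l ^ 2) / t ^ 2)| := abs_sub _ _
    _ = |k - l| * (1 + |(k ^ 2 + k * l + l ^ 2) / t ^ 2|) := by rw [abs_mul]; ring
    _ ≤ |u - w| * (1 + 3 * B ^ 2) := by gcongr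
    _ = _ := mul_comm _ _

lemma truncatedForce_eq {B t u y : ℝ} (hu : u = t * y) (hy : |y| ≤ B) :
    truncatedForce B t u = u - y ^ 2 * u := by
  have h1 : |u| ≤ B * |t| := by
    rw [hu, abs_mul, mul_comm B]
    gcongr
  rw [truncatedForce, clampReal_of_abs_le h1]
  by_cases ht : t = 0
  · simp [hu, ht]
  · rw [hu]
    field_simp

/-- Solutions of the truncated equation do not reach the truncation level. -/
lemma abs_lt_of_truncated {b B : ℝ} {u u' : ℝ → ℝ} (hb : 2 ≤ b ^ 2) (hb0 : 0 < b) (hbB : b < B)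
    (h0 : u 0 = 0) (h0' : u' 0 = b) (hu : ∀ t, HasDerivAt u (u' t) t)
    (hu' : ∀ t, HasDerivAt u' (truncatedForce B t (u t)) t) {t : ℝ} (ht : 0 ≤ t) :
    |dslope u 0 t| < B := by
  set y := dslope u 0 with hy
  have hB0 : 0 < B := hb0.trans hbB
  have hueq : ∀ t, u t = t * y t := by
    intro t
    have := sub_smul_dslope u 0 t
    simpa [h0] using this.symm
  have hycont : Continuous y := by
    rw [← continuousOn_univ, hy, continuousOn_dslope univ_mem]
    exact ⟨(continuous_of_hasDerivAt hu).continuousOn, (hu 0).differentiableAt⟩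
  have hy0 : y 0 = b := by rw [hy, dslope_same, (hu 0).deriv, h0']
  by_contra! hcon
  have ht0 : 0 < t := by
    refine ht.lt_of_ne fun h => ?_
    rw [← h, hy0, abs_of_pos hb0] at hcon
    linarith
  obtain ⟨d, hd, hdR⟩ := mem_nhdsGE_iff_exists_Ico_subset.1 (mem_nhdsWithin_of_mem_nhds
    ((continuous_const.sub hycont.abs).continuousAt.eventually
      (lt_mem_nhds (show 0 < B - |y 0| by rw [hy0, abs_of_pos hb0]; linarith))) : _ ∈ 𝓝[≥] (0 : ℝ))
  obtain ⟨p, hp1, hp2, hp3, hp4⟩ := exists_first_zero (f := fun t => B - |y t|)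
    (continuous_const.sub hycont.abs) hd (fun t ht => hdR ⟨ht.1.le, ht.2⟩) ht0 (by linarith)
  have hyB : ∀ s ∈ Ioo 0 p, |y s| < B := fun s hs => sub_pos.1 (hp4 s hs)
  set C := B + B ^ 3
  have hm : ∀ s, HasDerivAt (fun s => s * u' s - u s) (s * truncatedForce B s (u s)) s := fun s =>
    (((hasDerivAt_id s).mul (hu' s)).sub (hu s)).congr_deriv (by simp)
  have hmb : ∀ s, 0 ≤ s → |s * truncatedForce B s (u s)| ≤ C * s ^ 2 := fun s hs => by
    have := abs_truncatedForce_le hB0.le s (u s)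
    rw [abs_of_nonneg hs] at this
    rw [abs_mul, abs_of_nonneg hs]
    calc s * |truncatedForce B s (u s)| ≤ s * (C * s) := by gcongr
      _ = C * s ^ 2 := by ring
  have hcub : ∀ s, HasDerivAt (fun s => C * s ^ 3 / 3) (C * s ^ 2) s := fun s =>
    ((((hasDerivAt_id s).pow 3).const_mul C).div_const 3).congr_deriv (by simp; ring)
  have hmc := continuous_of_hasDerivAt hm
  have hms : ∀ s, 0 ≤ s → |s * u' s - u s| ≤ C * s ^ 3 / 3 := by
    intro s hs
    have h1 := le_of_hasDerivAt_nonneg hs ((continuous_of_hasDerivAt hcub).sub hmc)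
      (fun r _ => (hcub r).sub (hm r)) (fun r hr => by linarith [(abs_le.1 (hmb r hr.1.le)).2])
    have h2 := le_of_hasDerivAt_nonneg hs ((continuous_of_hasDerivAt hcub).add hmc)
      (fun r _ => (hcub r).add (hm r)) (fun r hr => by linarith [(abs_le.1 (hmb r hr.1.le)).1])
    simp only [Pi.add_apply, Pi.sub_apply, h0] at h1 h2
    rw [abs_le]
    constructor <;> linarith
  have hE : ∀ s ∈ Ioo 0 p, y p ^ 4 / 4 - y p ^ 2 / 2 ≤
      (C * s / 3) ^ 2 / 2 + y s ^ 4 / 4 - y s ^ 2 / 2 := by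
    intro s hs
    have hyd : ∀ r, 0 < r → HasDerivAt y ((r * u' r - u r) / r ^ 2) r := by
      intro r hr
      have h1 : HasDerivAt (fun r => u r / r) ((u' r * r - u r * 1) / r ^ 2) r :=
        (hu r).div (hasDerivAt_id r) hr.ne'
      refine (h1.congr_deriv (by ring)).congr_of_eventuallyEq ?_
      filter_upwards [isOpen_ne.mem_nhds hr.ne'] with s hs
      rw [hueq]
      exact (mul_div_cancel_left₀ _ hs).symm
    have hEd : ∀ r, 0 < r → HasDerivAt (fun r => -(((r * u' r - u r) / r ^ 2) ^ 2 / 2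
        + y r ^ 4 / 4 - y r ^ 2 / 2)) (-(((r * u' r - u r) / r ^ 2) *
          ((r * truncatedForce B r (u r) * r ^ 2 - (r * u' r - u r) * (2 * r)) / (r ^ 2) ^ 2)
          + (y r ^ 3 - y r) * ((r * u' r - u r) / r ^ 2))) r := by
      intro r hr
      have h1 := (hm r).fun_div ((hasDerivAt_id r).fun_pow 2) (pow_ne_zero 2 hr.ne')
      refine (((h1.fun_pow 2).div_const 2).fun_add (((hyd r hr).fun_pow 4).div_const 4)
        |>.fun_sub (((hyd r hr).fun_pow 2).div_const 2)).fun_neg.congr_deriv ?_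
      simp only [id]
      push_cast
      ring
    have hanti : -(((s * u' s - u s) / s ^ 2) ^ 2 / 2 + y s ^ 4 / 4 - y s ^ 2 / 2) ≤
        -(((p * u' p - u p) / p ^ 2) ^ 2 / 2 + y p ^ 4 / 4 - y p ^ 2 / 2) := by
      refine (monotoneOn_of_deriv_nonneg (convex_Icc s p) (fun r hr =>
        (hEd r (hs.1.trans_le hr.1)).continuousAt.continuousWithinAt) (fun r hr => ?_)
        (fun r hr => ?_)) (left_mem_Icc.2 hs.2.le) (right_mem_Icc.2 hs.2.le) hs.2.le
      · rw [interior_Icc] at hr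
        exact (hEd r (hs.1.trans hr.1)).differentiableAt.differentiableWithinAt
      · rw [interior_Icc] at hr
        have hr0 := hs.1.trans hr.1
        rw [(hEd r hr0).deriv, truncatedForce_eq (hueq r) (hyB r ⟨hr0, hr.2⟩).le]
        have : -((r * u' r - u r) / r ^ 2 * ((r * (u r - y r ^ 2 * u r) * r ^ 2
            - (r * u' r - u r) * (2 * r)) / (r ^ 2) ^ 2)
            + (y r ^ 3 - y r) * ((r * u' r - u r) / r ^ 2)) = 2 * (r * u' r - u r) ^ 2 / r ^ 5 := by
          rw [hueq]
          field_simp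
          ring
        rw [this]
        positivity
    have hsq : ((s * u' s - u s) / s ^ 2) ^ 2 ≤ (C * s / 3) ^ 2 := by
      rw [sq_le_sq, abs_div, abs_of_pos (show 0 < s ^ 2 by have := hs.1; positivity)]
      refine le_trans ?_ (le_abs_self _)
      rw [div_le_iff₀ (by have := hs.1; positivity)]
      refine (hms s hs.1.le).trans_eq (by ring)
    have : 0 ≤ ((p * u' p - u p) / p ^ 2) ^ 2 := sq_nonneg _
    linarith
  have hlim : y p ^ 4 / 4 - y p ^ 2 / 2 ≤ (C * 0 / 3) ^ 2 / 2 + y 0 ^ 4 / 4 - y 0 ^ 2 / 2 := by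
    have hc : Continuous fun s => (C * s / 3) ^ 2 / 2 + y s ^ 4 / 4 - y s ^ 2 / 2 := by fun_prop
    refine ge_of_tendsto ((hc.tendsto 0).mono_left (nhdsWithin_le_nhds (s := Ioi 0))) ?_
    filter_upwards [Ioo_mem_nhdsGT hp1] with s hs using hE s hs
  have hyp : y p ^ 2 = B ^ 2 := by
    rw [← sq_abs, show |y p| = B by linarith]
  have h4 : y p ^ 4 = B ^ 4 := by
    rw [show y p ^ 4 = (y p ^ 2) ^ 2 by ring, hyp]; ring
  rw [hy0, h4, hyp] at hlim
  have h5 : b ^ 2 < B ^ 2 := by gcongr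
  nlinarith

lemma Profile.exists_of_initial_value {b : ℝ} (hb0 : 0 < b) (hb : 2 ≤ b ^ 2) :
    ∃ y u u', Profile y u u' ∧ u' 0 = b ∧ ∀ t, |y t| ≤ b + 1 := by
  set B := b + 1
  have hB0 : 0 ≤ B := by positivity
  have hlip : ∀ T : ℝ, ∃ K : NNReal, ∀ t ∈ Icc (-T) T,
      LipschitzWith K fun x : ℝ × ℝ => (x.2, truncatedForce B t x.1) := by
    intro T
    refine ⟨⟨1 + 3 * B ^ 2, by positivity⟩, fun t _ => LipschitzWith.of_dist_le_mul fun x w => ?_⟩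
    simp only [Prod.dist_eq, Real.dist_eq]
    change _ ≤ (1 + 3 * B ^ 2) * _
    refine max_le ?_ ?_
    · have : |x.2 - w.2| ≤ max |x.1 - w.1| |x.2 - w.2| := le_max_right _ _
      have h0 := abs_nonneg (x.2 - w.2)
      nlinarith [sq_nonneg B]
    · refine (lipschitz_truncatedForce hB0 t x.1 w.1).trans ?_
      gcongr
      exact le_max_left _ _
  obtain ⟨α, h0, hα⟩ := exists_global_solution (F := fun t x => (x.2, truncatedForce B t x.1))
    (fun x => continuous_const.prodMk (continuous_truncatedForce hB0 x.1)) hlip (0, b)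
  have hu : ∀ t, HasDerivAt (fun t => (α t).1) (α t).2 t := fun t => (hα t).fst
  have hu' : ∀ t, HasDerivAt (fun t => (α t).2) (truncatedForce B t (α t).1) t :=
    fun t => (hα t).snd
  have hodd : (fun t => (-(α (-t)).1, (α (-t)).2)) = α := by
    refine global_solution_unique hlip (fun t => ?_) hα (c := 0) (by simp [h0])
    have h1 := ((hu (-t)).comp t (hasDerivAt_neg t)).neg
    have h2 := (hu' (-t)).comp t (hasDerivAt_neg t)
    refine (h1.prodMk h2).congr_deriv ?_
    simp only [mul_neg, mul_one, neg_neg, Prod.mk.injEq, true_and]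
    rw [← truncatedForce_neg hB0, neg_neg]
  set u := fun t => (α t).1 with hudef
  set u' := fun t => (α t).2 with hu'def
  have hu0 : u 0 = 0 := by simp [hudef, h0]
  have hu'0 : u' 0 = b := by simp [hu'def, h0]
  have hu_odd : ∀ t, u (-t) = -u t := fun t => by
    have := congrArg Prod.fst (congrFun hodd t)
    simp only at this
    simp only [hudef]
    linarith
  set y := dslope u 0 with hy
  have hueq : ∀ t, u t = t * y t := by
    intro t
    have := sub_smul_dslope u 0 t
    simpa [hu0] using this.symm
  have hyb : ∀ t, |y t| ≤ B := by
    intro t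
    rcases le_total 0 t with ht | ht
    · exact (abs_lt_of_truncated hb hb0 (lt_add_one b) hu0 hu'0 hu hu' ht).le
    · have h1 := abs_lt_of_truncated hb hb0 (lt_add_one b) hu0 hu'0 hu hu' (neg_nonneg.2 ht)
      rcases ht.eq_or_lt with rfl | ht
      · rw [neg_zero] at h1
        exact h1.le
      · have h2 : y (-t) = y t := by
          have h3 := hueq (-t)
          rw [hu_odd, hueq t] at h3
          have h4 : t * y t = t * y (-t) := by linarith
          exact (mul_left_cancel₀ ht.ne h4).symm
        rw [← h2]
        exact h1.le
  refine ⟨y, u, u', ⟨?_, hueq, hu, fun t => ?_⟩, hu'0, hyb⟩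
  · rw [← continuousOn_univ, hy, continuousOn_dslope univ_mem]
    exact ⟨(continuous_of_hasDerivAt hu).continuousOn, (hu 0).differentiableAt⟩
  · rw [← truncatedForce_eq (hueq t) (hyb t)]
    exact hu' t

/-- The even extension of a solution is a profile. -/
lemma IsSolution.profile {b : ℝ} {y : ℝ → ℝ} (h : IsSolution b y) :
    Profile (fun t => y |t|) (fun t => t * y |t|) (fun t => y |t| + |t| * deriv y |t|) := by
  obtain ⟨h0, h0', hd, hdd, heq⟩ := h
  have hy0 : HasDerivAt y 0 0 := (hd 0 le_rfl).hasDerivAt.congr_deriv h0'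
  have hm : ∀ t, 0 < t → HasDerivAt (fun t => t ^ 2 * deriv y t)
      (-(t ^ 2 * (y t ^ 3 - y t))) t := by
    intro t ht
    refine (((hasDerivAt_id t).pow 2).mul (hdd t ht).hasDerivAt).congr_deriv ?_
    have h1 : deriv (deriv y) t = -((2 / t) * deriv y t + (y t ^ 3 - y t)) := by
      linarith [heq t ht]
    rw [h1]
    simp only [Pi.pow_apply, id]
    field_simp
    push_cast
    ring
  have hcont : ContinuousOn y (Icc 0 1) := fun t ht => (hd t ht.1).continuousAt.continuousWithinAt
  obtain ⟨M, hM⟩ := isCompact_Icc.exists_bound_of_continuousOn ((hcont.pow 3).sub hcont)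
  have hM0 : 0 ≤ M := (norm_nonneg _).trans (hM 0 ⟨le_rfl, zero_le_one⟩)
  have hdiff : ∀ s t, 0 < s → s ≤ t → t ≤ 1 →
      |t ^ 2 * deriv y t - s ^ 2 * deriv y s| ≤ M * t ^ 3 := by
    intro s t hs hst ht
    have := (convex_Icc s t).norm_image_sub_le_of_norm_hasDerivWithin_le (C := M * t ^ 2)
      (fun r hr => (hm r (hs.trans_le hr.1)).hasDerivWithinAt) (fun r hr => by
        have hr0 := hs.trans_le hr.1
        have h1 := hM r ⟨hr0.le, hr.2.trans ht⟩
        simp only [Pi.sub_apply, Pi.pow_apply] at h1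
        rw [norm_neg, norm_mul, Real.norm_of_nonneg (sq_nonneg r), mul_comm M]
        gcongr
        exact hr.2) (left_mem_Icc.2 hst) (right_mem_Icc.2 hst)
    refine this.trans ?_
    rw [Real.norm_of_nonneg (sub_nonneg.2 hst), mul_assoc]
    have : t ^ 2 * (t - s) ≤ t ^ 3 := by nlinarith [sq_nonneg t]
    gcongr
  have hm0 : ∀ t, 0 < t → t ≤ 1 → |deriv y t| ≤ M * t := by
    intro t ht ht1
    have key : ∀ ε > 0, |t ^ 2 * deriv y t| ≤ M * t ^ 3 + ε := by
      intro ε hε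
      have h2 := (hasDerivAt_iff_isLittleO_nhds_zero.1 hy0).def (show (0 : ℝ) < 1 by norm_num)
      have h3 : ∀ᶠ s in 𝓝[>] (0 : ℝ), s ^ 2 < ε := by
        have h4 : ContinuousAt (fun s : ℝ => s ^ 2) 0 := by fun_prop
        exact (h4.eventually (gt_mem_nhds (by simpa using hε))).filter_mono nhdsWithin_le_nhds
      obtain ⟨s, ⟨hs1, hs2⟩, hs3⟩ :=
        (((h2.filter_mono (nhdsWithin_le_nhds (s := Ioi (0 : ℝ)))).and h3).and
        (Ioo_mem_nhdsGT ht)).exists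
      simp only [zero_add, smul_eq_mul, mul_zero, sub_zero, one_mul] at hs1
      obtain ⟨r, hr, hr'⟩ := exists_deriv_eq_slope y hs3.1
        (fun x hx => (hd x hx.1).continuousAt.continuousWithinAt)
        (fun x hx => (hd x hx.1.le).differentiableWithinAt)
      have h4 : |deriv y r| ≤ 1 := by
        rw [hr', sub_zero, abs_div, abs_of_pos hs3.1, div_le_one hs3.1]
        simpa [abs_of_pos hs3.1] using hs1
      have h5 := hdiff r t hr.1 (hr.2.le.trans hs3.2.le) ht1
      have h6 : |r ^ 2 * deriv y r| ≤ ε := by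
        rw [abs_mul, abs_of_nonneg (sq_nonneg r)]
        have : r ^ 2 ≤ s ^ 2 := by have := hr.1; have := hr.2; gcongr
        nlinarith [sq_nonneg r]
      have h7 := abs_sub_abs_le_abs_sub (t ^ 2 * deriv y t) (r ^ 2 * deriv y r)
      linarith
    have h1 := le_of_forall_pos_le_add key
    rw [abs_mul, abs_of_nonneg (sq_nonneg t)] at h1
    have h2 : 0 < t ^ 2 := by positivity
    refine le_of_mul_le_mul_left (h1.trans_eq (by ring)) h2
  have hY : Continuous fun t => y |t| := continuous_iff_continuousAt.2 fun t =>
    ContinuousAt.comp (f := fun t => |t|) (hd _ (abs_nonneg t)).continuousAt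
      continuous_abs.continuousAt
  have hu : ∀ t, 0 < t → HasDerivAt (fun t => t * y |t|) (y |t| + |t| * deriv y |t|) t := by
    intro t ht
    have h1 : HasDerivAt (fun t => t * y t) (1 * y t + t * deriv y t) t :=
      (hasDerivAt_id t).mul (hd t ht.le).hasDerivAt
    rw [abs_of_pos ht]
    refine (h1.congr_deriv (by ring)).congr_of_eventuallyEq ?_
    filter_upwards [Ioi_mem_nhds ht] with s hs
    rw [abs_of_pos hs]
  have hu' : ∀ t, 0 < t → HasDerivAt (fun t => y |t| + |t| * deriv y |t|)
      (t * y |t| - (y |t|) ^ 2 * (t * y |t|)) t := by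
    intro t ht
    have h1 : HasDerivAt (fun t => y t + t * deriv y t)
        (deriv y t + (1 * deriv y t + t * deriv (deriv y) t)) t :=
      (hd t ht.le).hasDerivAt.add ((hasDerivAt_id t).mul (hdd t ht).hasDerivAt)
    rw [abs_of_pos ht]
    refine (h1.congr_deriv ?_).congr_of_eventuallyEq ?_
    · have h1 : deriv (deriv y) t = -((2 / t) * deriv y t + (y t ^ 3 - y t)) := by
        linarith [heq t ht]
      rw [h1]
      field_simp
      ring
    · filter_upwards [Ioi_mem_nhds ht] with s hs
      rw [abs_of_pos hs]
  have hY0 : HasDerivAt (fun t => y |t|) 0 0 := by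
    rw [hasDerivAt_iff_isLittleO_nhds_zero] at hy0 ⊢
    simp only [zero_add, smul_zero, sub_zero, abs_zero] at hy0 ⊢
    have h1 : Tendsto (fun t : ℝ => |t|) (𝓝 0) (𝓝 0) := by
      simpa using (continuous_abs (G := ℝ)).tendsto 0
    have h2 := hy0.comp_tendsto h1
    exact h2.trans_isBigO (Asymptotics.isBigO_of_le _ fun t => by simp)
  refine ⟨hY, fun t => rfl, fun t => ?_, fun t => ?_⟩
  · rcases lt_trichotomy t 0 with ht | rfl | ht
    · have := ((hu (-t) (neg_pos.2 ht)).comp t (hasDerivAt_neg t)).neg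
      simp only [abs_neg] at this
      refine (this.congr_deriv (by ring)).congr_of_eventuallyEq (Eventually.of_forall fun s => ?_)
      simp
    · exact ((hasDerivAt_id (0 : ℝ)).mul hY0).congr_deriv (by simp)
    · exact hu t ht
  · rcases lt_trichotomy t 0 with ht | rfl | ht
    · have := (hu' (-t) (neg_pos.2 ht)).comp t (hasDerivAt_neg t)
      simp only [abs_neg] at this
      refine (this.congr_deriv (by ring)).congr_of_eventuallyEq (Eventually.of_forall fun s => ?_)
      simp
    · have h1 : HasDerivAt (fun t => |t| * deriv y |t|) 0 0 := by
        rw [hasDerivAt_iff_isLittleO_nhds_zero]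
        simp only [zero_add, smul_zero, sub_zero, abs_zero, zero_mul]
        have h2 : (fun t : ℝ => |t| * deriv y |t|) =O[𝓝 0] fun t => t ^ 2 := by
          refine Asymptotics.IsBigO.of_bound M ?_
          filter_upwards [Ioo_mem_nhds (show (-1 : ℝ) < 0 by norm_num) zero_lt_one] with t ht
          rcases eq_or_ne t 0 with rfl | h3
          · simp
          · have h4 := hm0 |t| (abs_pos.2 h3) (abs_lt.2 ht).le
            simp only [norm_mul, Real.norm_eq_abs, abs_abs, norm_pow]
            calc |t| * |deriv y (|t|)| ≤ |t| * (M * |t|) := by gcongr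
              _ = M * |t| ^ 2 := by ring
        exact h2.trans_isLittleO (Asymptotics.isLittleO_pow_id one_lt_two)
      exact (hY0.add h1).congr_deriv (by simp)
    · exact hu' t ht

namespace Profile

variable {y u u' y₁ u₁ u₁' y₂ u₂ u₂' v v' : ℝ → ℝ}

lemma lin_sub (h₁ : Profile y₁ u₁ u₁') (h₂ : Profile y₂ u₂ u₂') (t : ℝ) :
    HasDerivAt (fun t => u₁' t - u₂' t)
      ((1 - (y₁ t ^ 2 + y₁ t * y₂ t + y₂ t ^ 2)) * (u₁ t - u₂ t)) t :=
  ((h₁.hu' t).sub (h₂.hu' t)).congr_deriv (by rw [h₁.eq, h₂.eq]; ring)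

lemma unique (h₁ : Profile y₁ u₁ u₁') (h₂ : Profile y₂ u₂ u₂') (h : u₁' 0 = u₂' 0) :
    u₁ = u₂ ∧ u₁' = u₂' := by
  have hc₁ := h₁.cont
  have hc₂ := h₂.cont
  have := global_solution_unique
    (F := fun t x => (x.2, (1 - (y₁ t ^ 2 + y₁ t * y₂ t + y₂ t ^ 2)) * x.1 + 0))
    (α := fun t => (u₁ t - u₂ t, u₁' t - u₂' t)) (β := fun _ => (0, 0))
    (linear_lipschitz (F := fun _ => 0) (by fun_prop))
    (fun s => (((h₁.hu s).sub (h₂.hu s)).prodMk (h₁.lin_sub h₂ s)).congr_deriv (by simp))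
    (fun s => (hasDerivAt_const s _).congr_deriv (by simp; rfl)) (c := 0)
    (by simp [h, h₁.eq, h₂.eq])
  constructor <;> funext t <;> have := congrFun this t <;>
    simp only [Prod.mk.injEq, sub_eq_zero] at this
  exacts [this.1, this.2]

/-- Lipschitz dependence on the initial value. -/
lemma exists_lipschitz_bound (T B : ℝ) : ∃ L, 0 ≤ L ∧
    ∀ {y₁ u₁ u₁' y₂ u₂ u₂' : ℝ → ℝ}, Profile y₁ u₁ u₁' → Profile y₂ u₂ u₂' →
      (∀ t, |y₁ t| ≤ B) → (∀ t, |y₂ t| ≤ B) → ∀ t ∈ Icc 0 T,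
        |u₁ t - u₂ t| ≤ L * |u₁' 0 - u₂' 0| ∧ |u₁' t - u₂' t| ≤ L * |u₁' 0 - u₂' 0| ∧
          |y₁ t - y₂ t| ≤ L * |u₁' 0 - u₂' 0| := by
  set K := 1 + 3 * B ^ 2
  have hK : 0 < K := by positivity
  refine ⟨Real.exp (K * T), (Real.exp_pos _).le, ?_⟩
  intro y₁ u₁ u₁' y₂ u₂ u₂' h₁ h₂ hb₁ hb₂
  have hB : 0 ≤ B := (abs_nonneg _).trans (hb₁ 0)
  have hb := norm_le_gronwall_of_Icc (α := fun t => (u₁ t - u₂ t, u₁' t - u₂' t))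
    (α' := fun t => (u₁' t - u₂' t, (1 - (y₁ t ^ 2 + y₁ t * y₂ t + y₂ t ^ 2)) * (u₁ t - u₂ t)))
    (T := T) (K := K) (C := 0) (D := |u₁' 0 - u₂' 0|) hK.le le_rfl
    (by simp [Prod.norm_def, h₁.eq, h₂.eq])
    (fun s _ => (((h₁.hu s).sub (h₂.hu s)).prodMk (h₁.lin_sub h₂ s)).hasDerivWithinAt)
    (fun s _ => by
      simp only [Prod.norm_def, Real.norm_eq_abs, add_zero]
      have hq : |1 - (y₁ s ^ 2 + y₁ s * y₂ s + y₂ s ^ 2)| ≤ K := by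
        have h3 := hb₁ s
        have h4 := hb₂ s
        refine (abs_sub _ _).trans ?_
        rw [abs_one]
        refine add_le_add le_rfl ((abs_add_three _ _ _).trans ?_)
        rw [abs_pow, abs_mul, abs_pow]
        calc |y₁ s| ^ 2 + |y₁ s| * |y₂ s| + |y₂ s| ^ 2 ≤ B ^ 2 + B * B + B ^ 2 := by gcongr
          _ = _ := by ring
      refine max_le ?_ ?_
      · refine (le_max_right |u₁ s - u₂ s| _).trans ?_
        refine le_mul_of_one_le_left (by positivity) ?_
        have := sq_nonneg B
        linarith
      · rw [abs_mul]
        gcongr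
        exact le_max_left _ _)
  simp only [gronwallBound_ε0, Prod.norm_def, Real.norm_eq_abs, max_le_iff] at hb
  rw [mul_comm] at hb
  refine fun t ht => ⟨(hb t ht).1, (hb t ht).2, ?_⟩
  rcases ht.1.eq_or_lt with rfl | h0
  · rw [h₁.y_zero, h₂.y_zero]
    exact (hb 0 ht).2
  · have := (convex_Icc 0 t).norm_image_sub_le_of_norm_hasDerivWithin_le
      (f := fun t => u₁ t - u₂ t) (f' := fun t => u₁' t - u₂' t)
      (fun r _ => ((h₁.hu r).sub (h₂.hu r)).hasDerivWithinAt)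
      (fun r hr => (hb r ⟨hr.1, hr.2.trans ht.2⟩).2) (left_mem_Icc.2 h0.le) (right_mem_Icc.2 h0.le)
    simp only [h₁.eq, h₂.eq, zero_mul, sub_zero, Real.norm_eq_abs, abs_of_pos h0] at this
    rw [← mul_sub, abs_mul, abs_of_pos h0, mul_comm t] at this
    exact le_of_mul_le_mul_right this h0

/-- Differentiability with respect to the initial value. -/
lemma exists_quadratic_bound (h : Profile y u u') (hv : Lin y 0 v v') (hv0 : v 0 = 0)
    (hv'0 : v' 0 = 1) {T B : ℝ} (hT : 0 ≤ T) (hb : ∀ t, |y t| ≤ B) : ∃ L, 0 ≤ L ∧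
    ∀ {y₁ u₁ u₁' : ℝ → ℝ}, Profile y₁ u₁ u₁' → (∀ t, |y₁ t| ≤ B) → ∀ t ∈ Icc 0 T,
        |u₁ t - u t - (u₁' 0 - u' 0) * v t| ≤ L * |u₁' 0 - u' 0| ^ 2 ∧
        |u₁' t - u' t - (u₁' 0 - u' 0) * v' t| ≤ L * |u₁' 0 - u' 0| ^ 2 := by
  obtain ⟨L₀, hL₀, hL⟩ := exists_lipschitz_bound T B
  obtain ⟨V, hV⟩ := (isCompact_Icc (a := 0) (b := T)).exists_bound_of_continuousOn
    hv.continuous.continuousOn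
  have hV0 : 0 ≤ V := (norm_nonneg _).trans (hV 0 ⟨le_rfl, hT⟩)
  have hB : 0 ≤ B := (abs_nonneg _).trans (hb 0)
  set K := 1 + 3 * B ^ 2
  have hK : 0 < K := by positivity
  refine ⟨L₀ * (3 * B) * V / K * Real.exp (K * T), by positivity, ?_⟩
  intro y₁ u₁ u₁' h₁ hb₁
  set d := u₁' 0 - u' 0
  have hg := norm_le_gronwall_of_Icc
    (α := fun t => (u₁ t - u t - d * v t, u₁' t - u' t - d * v' t))
    (α' := fun t => (u₁' t - u' t - d * v' t, (1 - (y₁ t ^ 2 + y₁ t * y t + y t ^ 2)) * (u₁ t - u t)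
      - d * ((1 - 3 * y t ^ 2) * v t + 0)))
    (T := T) (K := K) (C := L₀ * (3 * B) * V * |d| ^ 2) (D := 0) hK.le (by positivity)
    (by simp [h₁.eq, h.eq, hv0, hv'0, d])
    (fun s _ => ((((h₁.hu s).sub (h.hu s)).sub ((hv.hx s).const_mul d)).prodMk
      ((h₁.lin_sub h s).sub ((hv.hx' s).const_mul d))).hasDerivWithinAt)
    (fun s hs => by
      have h3 := hb₁ s
      have h4 := hb s
      have h5 := hV s hs
      rw [Real.norm_eq_abs] at h5
      have h6 := (hL h₁ h hb₁ hb s hs).2.2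
      simp only [Prod.norm_def, Real.norm_eq_abs, add_zero]
      have hq : |1 - (y₁ s ^ 2 + y₁ s * y s + y s ^ 2)| ≤ K := by
        refine (abs_sub _ _).trans ?_
        rw [abs_one]
        refine add_le_add le_rfl ((abs_add_three _ _ _).trans ?_)
        rw [abs_pow, abs_mul, abs_pow]
        calc |y₁ s| ^ 2 + |y₁ s| * |y s| + |y s| ^ 2 ≤ B ^ 2 + B * B + B ^ 2 := by gcongr
          _ = _ := by ring
      have hC : 0 ≤ L₀ * (3 * B) * V * |d| ^ 2 := by positivity
      refine max_le ?_ ?_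
      · refine (le_max_right |u₁ s - u s - d * v s| _).trans
          ((le_mul_of_one_le_left (by positivity) ?_).trans (le_add_of_nonneg_right hC))
        have := sq_nonneg B
        linarith
      · have h7 : (1 - (y₁ s ^ 2 + y₁ s * y s + y s ^ 2)) * (u₁ s - u s)
            - d * ((1 - 3 * y s ^ 2) * v s)
            = (1 - (y₁ s ^ 2 + y₁ s * y s + y s ^ 2)) * (u₁ s - u s - d * v s)
              - (y₁ s - y s) * (y₁ s + 2 * y s) * v s * d := by ring
        rw [h7]
        refine (abs_sub _ _).trans (add_le_add ?_ ?_)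
        · rw [abs_mul]
          gcongr
          exact le_max_left _ _
        · simp only [abs_mul]
          have h8 : |y₁ s + 2 * y s| ≤ 3 * B := by
            refine (abs_add_le _ _).trans ?_
            rw [abs_mul, abs_two]
            linarith
          calc |y₁ s - y s| * |y₁ s + 2 * y s| * |v s| * |d|
              ≤ (L₀ * |d|) * (3 * B) * V * |d| := by gcongr
            _ = _ := by ring)
  rw [gronwallBound_of_K_ne_0 hK.ne'] at hg
  intro t ht
  have h1 := hg t ht
  simp only [Prod.norm_def, Real.norm_eq_abs, max_le_iff, zero_mul, zero_add] at h1
  have h2 : L₀ * (3 * B) * V * |d| ^ 2 / K * (Real.exp (K * T) - 1)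
      ≤ L₀ * (3 * B) * V / K * Real.exp (K * T) * |d| ^ 2 := by
    have h3 : 0 ≤ L₀ * (3 * B) * V * |d| ^ 2 / K := by positivity
    calc _ ≤ L₀ * (3 * B) * V * |d| ^ 2 / K * Real.exp (K * T) := by gcongr; linarith
      _ = _ := by ring
  exact ⟨h1.1.trans h2, h1.2.trans h2⟩

end Profile

namespace Profile

variable {y u u' : ℝ → ℝ}

/-- The angular velocity of `(u', u)` around the origin. -/
def angularVelocity (y u u' : ℝ → ℝ) (t : ℝ) : ℝ :=
  (u' t ^ 2 - u t * (u t - y t ^ 2 * u t)) / (u t ^ 2 + u' t ^ 2)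

/-- The Prüfer angle of a profile. -/
def angle (y u u' : ℝ → ℝ) (t : ℝ) : ℝ := ∫ s in (0 : ℝ)..t, angularVelocity y u u' s

@[simp] lemma angle_zero : angle y u u' 0 = 0 := intervalIntegral.integral_same

lemma sq_add_sq_pos (h : Profile y u u') (h0 : u' 0 ≠ 0) (t : ℝ) : 0 < u t ^ 2 + u' t ^ 2 := by
  by_contra! hn
  have h1 : u t = 0 := by nlinarith [sq_nonneg (u t), sq_nonneg (u' t)]
  have h2 : u' t = 0 := by nlinarith [sq_nonneg (u t), sq_nonneg (u' t)]
  exact h0 (h.eq_zero_of_data h1 h2)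

lemma continuous_angularVelocity (h : Profile y u u') (h0 : u' 0 ≠ 0) :
    Continuous (angularVelocity y u u') := by
  have h1 := h.cont
  have h2 := h.continuous
  have h3 := h.continuous'
  exact Continuous.div (by fun_prop) (by fun_prop) fun t => (h.sq_add_sq_pos h0 t).ne'

lemma hasDerivAt_angle (h : Profile y u u') (h0 : u' 0 ≠ 0) (t : ℝ) :
    HasDerivAt (angle y u u') (angularVelocity y u u' t) t :=
  ((h.continuous_angularVelocity h0).integral_hasStrictDerivAt 0 t).hasDerivAt

lemma continuous_angle (h : Profile y u u') (h0 : u' 0 ≠ 0) : Continuous (angle y u u') :=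
  continuous_of_hasDerivAt (h.hasDerivAt_angle h0)

lemma exists_amplitude (h : Profile y u u') (h0 : 0 < u' 0) : ∃ r : ℝ → ℝ, ∀ t, 0 < r t ∧
    u t = r t * Real.sin (angle y u u' t) ∧ u' t = r t * Real.cos (angle y u u' t) := by
  set θ := angle y u u' with hθ
  have hN := h.sq_add_sq_pos h0.ne'
  have hθd := h.hasDerivAt_angle h0.ne'
  rw [← hθ] at hθd
  have hP : ∀ t, u t * Real.cos (θ t) - u' t * Real.sin (θ t) = 0 := by
    have hd : ∀ t, HasDerivAt (fun t => (u t * Real.cos (θ t) - u' t * Real.sin (θ t)) ^ 2 /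
        (u t ^ 2 + u' t ^ 2)) 0 t := by
      intro t
      have h1 := (((((h.hu t).mul (hθd t).cos).sub ((h.hu' t).mul (hθd t).sin)).pow 2).fun_div
        (((h.hu t).pow 2).add ((h.hu' t).pow 2)) (hN t).ne')
      refine h1.congr_deriv ?_
      have := (hN t).ne'
      simp only [Pi.pow_apply, Pi.add_apply, Pi.sub_apply, Pi.mul_apply, angularVelocity]
      field_simp
      push_cast
      ring
    intro t
    have h1 := eq_of_hasDerivAt_zero hd t 0
    simp only [h.eq 0, hθ, angle_zero] at h1
    simpa [(hN t).ne', hθ] using h1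
  have hQ : ∀ t, (u t * Real.sin (θ t) + u' t * Real.cos (θ t)) ^ 2 = u t ^ 2 + u' t ^ 2 := by
    intro t
    have h1 := hP t
    have h2 := Real.sin_sq_add_cos_sq (θ t)
    linear_combination (u t ^ 2 + u' t ^ 2) * h2 -
      (u t * Real.cos (θ t) - u' t * Real.sin (θ t)) * h1
  have hc : Continuous fun t => u t * Real.sin (θ t) + u' t * Real.cos (θ t) := by
    have h2 := h.continuous
    have h3 := h.continuous'
    have h4 := h.continuous_angle h0.ne'
    fun_prop
  refine ⟨fun t => u t * Real.sin (θ t) + u' t * Real.cos (θ t), fun t => ⟨?_, ?_, ?_⟩⟩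
  · by_contra! ht
    obtain ⟨s, hs⟩ := mem_range_of_exists_le_of_exists_ge hc ⟨t, ht⟩
      ⟨0, by simpa [hθ] using h0.le⟩
    have h1 := hQ s
    simp only at hs
    rw [hs] at h1
    linarith [hN s]
  · linear_combination Real.cos (θ t) * hP t - u t * Real.sin_sq_add_cos_sq (θ t)
  · linear_combination -Real.sin (θ t) * hP t - u' t * Real.sin_sq_add_cos_sq (θ t)

lemma eq_zero_iff_angle (h : Profile y u u') (h0 : 0 < u' 0) (t : ℝ) :
    u t = 0 ↔ ∃ k : ℤ, k * Real.pi = angle y u u' t := by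
  obtain ⟨r, hr⟩ := h.exists_amplitude h0
  rw [(hr t).2.1, mul_eq_zero, or_iff_right (hr t).1.ne', Real.sin_eq_zero_iff]

lemma angle_deriv_of_eq (h : Profile y u u') (h0 : 0 < u' 0) {t : ℝ} {k : ℤ}
    (ht : angle y u u' t = k * Real.pi) : HasDerivAt (angle y u u') 1 t := by
  have h1 : u t = 0 := (h.eq_zero_iff_angle h0 t).2 ⟨k, ht.symm⟩
  have h2 := h.sq_add_sq_pos h0.ne' t
  refine (h.hasDerivAt_angle h0.ne' t).congr_deriv ?_
  rw [h1] at h2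
  rw [angularVelocity, h1]
  have : u' t ≠ 0 := by rintro h3; simp [h3] at h2
  field_simp
  ring

/-- The angle crosses multiples of `π` only upwards. -/
lemma angle_barrier (h : Profile y u u') (h0 : 0 < u' 0) {s t : ℝ} (hst : s < t) {k : ℤ}
    (hs : k * Real.pi ≤ angle y u u' s) : k * Real.pi < angle y u u' t := by
  by_contra! ht
  have hc := h.continuous_angle h0.ne'
  have hnear : ∀ᶠ r in 𝓝[>] s, 0 < angle y u u' r - k * Real.pi := by
    rcases hs.eq_or_lt with he | hl
    · have hd := (h.angle_deriv_of_eq h0 he.symm)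
      have h1 := (hasDerivAt_iff_tendsto_slope.1 hd).eventually (lt_mem_nhds one_pos)
      filter_upwards [h1.filter_mono (nhdsWithin_mono s fun r (hr : s < r) => hr.ne'),
        self_mem_nhdsWithin] with r hr hr'
      rw [slope_def_field, ← he] at hr
      have : 0 < r - s := sub_pos.2 hr'
      exact (div_pos_iff_of_pos_right this).1 hr
    · filter_upwards [(hc.continuousAt.eventually (lt_mem_nhds hl)).filter_mono
        nhdsWithin_le_nhds] with r hr using sub_pos.2 hr
  obtain ⟨δ, hδ, hδ'⟩ := (mem_nhdsGT_iff_exists_Ioo_subset).1 hnear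
  obtain ⟨p, hp1, -, hp3, hp4⟩ := exists_first_zero (hc.sub continuous_const) hδ
    (fun r hr => hδ' hr) hst (sub_nonpos.2 ht)
  have h1 := nonpos_deriv_of_pos_left hp1
    ((h.angle_deriv_of_eq h0 (sub_eq_zero.1 hp3)).sub_const (k * Real.pi)) hp3 hp4
  linarith

lemma angle_pos (h : Profile y u u') (h0 : 0 < u' 0) {t : ℝ} (ht : 0 < t) :
    0 < angle y u u' t := by
  simpa using h.angle_barrier h0 ht (k := 0) (by simp)

lemma le_ncard_zeros (h : Profile y u u') (h0 : 0 < u' 0) (hfin : {t | 0 < t ∧ u t = 0}.Finite)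
    {T : ℝ} (hT : 0 ≤ T) {m : ℕ} (hm : m * Real.pi ≤ angle y u u' T) :
    m ≤ {t | 0 < t ∧ u t = 0}.ncard := by
  have hex : ∀ i ∈ Finset.Icc 1 m, ∃ t, 0 < t ∧ angle y u u' t = i * Real.pi := by
    intro i hi
    rw [Finset.mem_Icc] at hi
    have hi' : (i : ℝ) ≤ m := by exact_mod_cast hi.2
    have hi0 : (0 : ℝ) < i := by exact_mod_cast hi.1
    obtain ⟨t, ht, ht'⟩ := intermediate_value_Icc hT (h.continuous_angle h0.ne').continuousOn
      (show (i : ℝ) * Real.pi ∈ _ by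
        rw [angle_zero]
        exact ⟨by positivity, (by gcongr : (i : ℝ) * Real.pi ≤ m * Real.pi).trans hm⟩)
    refine ⟨t, ht.1.lt_of_ne ?_, ht'⟩
    rintro rfl
    rw [angle_zero] at ht'
    have := mul_pos hi0 Real.pi_pos
    linarith
  choose! τ hτ using hex
  have := Set.ncard_le_ncard_of_injOn (s := (Finset.Icc 1 m : Set ℕ))
    (t := {t | 0 < t ∧ u t = 0}) τ
    (fun i hi => ⟨(hτ i hi).1, (h.eq_zero_iff_angle h0 _).2 ⟨i, by simpa using (hτ i hi).2.symm⟩⟩)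
    (fun i hi j hj hij => by
      have h1 := (hτ i hi).2
      rw [hij, (hτ j hj).2] at h1
      exact_mod_cast (mul_right_cancel₀ Real.pi_ne_zero h1).symm) hfin
  rw [Set.ncard_coe_finset] at this
  simpa using this

lemma ncard_zeros_le (h : Profile y u u') (h0 : 0 < u' 0) {z : ℝ} (hz0 : 0 ≤ z) (hz : u z = 0)
    (hle : ∀ t, 0 < t → u t = 0 → t ≤ z) :
    {t | 0 < t ∧ u t = 0}.ncard * Real.pi ≤ angle y u u' z := by
  have hk : ∀ t, u t = 0 → ∃ k : ℤ, k * Real.pi = angle y u u' t :=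
    fun t => (h.eq_zero_iff_angle h0 t).1
  choose! κ hκ using hk
  have hpi := Real.pi_pos
  have hmono : ∀ s t, u s = 0 → u t = 0 → s < t → κ s < κ t := by
    intro s t hs ht hst
    have := h.angle_barrier h0 hst (hκ s hs).le
    rw [← hκ t ht] at this
    exact_mod_cast lt_of_mul_lt_mul_right this hpi.le
  have := Set.ncard_le_ncard_of_injOn (s := {t | 0 < t ∧ u t = 0})
    (t := (Finset.Icc 1 (κ z) : Set ℤ)) κ
    (fun t ht => by
      rw [Finset.coe_Icc]
      constructor
      · have h1 := h.angle_pos h0 ht.1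
        rw [← hκ t ht.2] at h1
        have : (0 : ℝ) < κ t := pos_of_mul_pos_left h1 hpi.le
        exact_mod_cast this
      · rcases (hle t ht.1 ht.2).eq_or_lt with rfl | hlt
        · exact le_rfl
        · exact (hmono t z ht.2 hz hlt).le)
    (fun s hs t ht hst => by
      rcases lt_trichotomy s t with h1 | h1 | h1
      · exact absurd (hmono s t hs.2 ht.2 h1) (by simp [hst])
      · exact h1
      · exact absurd (hmono t s ht.2 hs.2 h1) (by simp [hst])) (Finset.finite_toSet _)
  rw [Set.ncard_coe_finset, Int.card_Icc] at this
  have h1 : 0 ≤ angle y u u' z := by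
    rcases hz0.eq_or_lt with rfl | h2
    · rw [angle_zero]
    · exact (h.angle_pos h0 h2).le
  rw [← hκ z hz] at h1 ⊢
  have h2 : (0 : ℝ) ≤ κ z := nonneg_of_mul_nonneg_left h1 hpi
  have h3 : 0 ≤ κ z := by exact_mod_cast h2
  have h4 : (({t | 0 < t ∧ u t = 0}.ncard : ℤ)) ≤ κ z := by omega
  have h5 : (({t | 0 < t ∧ u t = 0}.ncard : ℝ)) ≤ κ z := by exact_mod_cast h4
  gcongr

end Profile

/-- The profiles of the solutions with initial value `b ≥ √2`. -/
structure ProfileFamily (y u u' : ℝ → ℝ → ℝ) : Prop where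
  prof : ∀ b, √2 ≤ b → Profile (y b) (u b) (u' b)
  init : ∀ b, √2 ≤ b → u' b 0 = b
  bound : ∀ b, √2 ≤ b → ∀ t, |y b t| ≤ b + 1

lemma exists_profileFamily : ∃ y u u', ProfileFamily y u u' := by
  have h : ∀ b, √2 ≤ b → ∃ y u u', Profile y u u' ∧ u' 0 = b ∧ ∀ t, |y t| ≤ b + 1 := by
    intro b hb
    have h2 : 0 < √2 := by positivity
    exact Profile.exists_of_initial_value (h2.trans_le hb)
      ((Real.sqrt_le_left (h2.le.trans hb)).1 hb)
  choose! y u u' h using h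
  exact ⟨y, u, u', fun b hb => (h b hb).1, fun b hb => (h b hb).2.1, fun b hb => (h b hb).2.2⟩

namespace ProfileFamily

open Profile

variable {y u u' : ℝ → ℝ → ℝ} {b b₁ b₂ T : ℝ}

lemma init_pos (h : ProfileFamily y u u') (hb : √2 ≤ b) : 0 < u' b 0 := by
  rw [h.init b hb]
  exact lt_of_lt_of_le (by positivity) hb

lemma eventually_bound (h : ProfileFamily y u u') (b : ℝ) :
    ∀ᶠ c in 𝓝[Ici √2] b, Profile (y c) (u c) (u' c) ∧ u' c 0 = c ∧ ∀ t, |y c t| ≤ b + 2 := by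
  filter_upwards [self_mem_nhdsWithin, mem_nhdsWithin_of_mem_nhds (Iio_mem_nhds (lt_add_one b))]
    with c hc hc'
  refine ⟨h.prof c hc, h.init c hc, fun t => (h.bound c hc t).trans ?_⟩
  have : c < b + 1 := hc'
  linarith

lemma continuousWithinAt (h : ProfileFamily y u u') (hb : √2 ≤ b) (hT : 0 ≤ T) :
    ContinuousWithinAt (fun c => u c T) (Ici √2) b ∧
    ContinuousWithinAt (fun c => u' c T) (Ici √2) b ∧
    ContinuousWithinAt (fun c => y c T) (Ici √2) b := by
  obtain ⟨L, hL, hL'⟩ := exists_lipschitz_bound T (b + 2)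
  have key : ∀ w : ℝ → ℝ, (∀ᶠ c in 𝓝[Ici √2] b, |w c - w b| ≤ L * |c - b|) →
      ContinuousWithinAt w (Ici √2) b := by
    intro w hw
    have h1 : Tendsto (fun c => L * |c - b|) (𝓝[Ici √2] b) (𝓝 0) := by
      have : ContinuousAt (fun c => L * |c - b|) b := by fun_prop
      simpa using this.tendsto.mono_left (nhdsWithin_le_nhds (s := Ici √2))
    rw [ContinuousWithinAt, tendsto_iff_dist_tendsto_zero]
    exact squeeze_zero' (Eventually.of_forall fun c => dist_nonneg) hw h1
  have hlip : ∀ᶠ c in 𝓝[Ici √2] b, |u c T - u b T| ≤ L * |c - b| ∧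
      |u' c T - u' b T| ≤ L * |c - b| ∧ |y c T - y b T| ≤ L * |c - b| := by
    filter_upwards [h.eventually_bound b] with c hc
    have h1 := hL' hc.1 (h.prof b hb) hc.2.2
      (fun t => (h.bound b hb t).trans (by linarith)) T ⟨hT, le_rfl⟩
    rwa [hc.2.1, h.init b hb] at h1
  exact ⟨key _ (hlip.mono fun c hc => hc.1), key _ (hlip.mono fun c hc => hc.2.1),
    key _ (hlip.mono fun c hc => hc.2.2)⟩

lemma continuousOn_angle (h : ProfileFamily y u u') (hT : 0 ≤ T) :
    ContinuousOn (fun c => angle (y c) (u c) (u' c) T) (Ici √2) := by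
  intro b hb
  refine intervalIntegral.continuousWithinAt_of_dominated_interval
    (bound := fun _ => 1 + (b + 2) ^ 2) ?_ ?_ (by simp) ?_
  · filter_upwards [self_mem_nhdsWithin] with c hc
    exact ((h.prof c hc).continuous_angularVelocity
      (h.init_pos hc).ne').aestronglyMeasurable
  · filter_upwards [h.eventually_bound b, self_mem_nhdsWithin] with c hc hc'
    refine Eventually.of_forall fun t _ => ?_
    have h1 := hc.1.sq_add_sq_pos (h.init_pos hc').ne' t
    have h2 : y c t ^ 2 ≤ (b + 2) ^ 2 := by
      rw [← sq_abs (y c t)]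
      have := hc.2.2 t
      gcongr
    rw [Real.norm_eq_abs, angularVelocity, abs_div, abs_of_pos h1, div_le_iff₀ h1, abs_le]
    constructor <;>
    nlinarith [mul_nonneg (sub_nonneg.2 h2) (sq_nonneg (u c t)), sq_nonneg (u c t),
      sq_nonneg (u' c t), mul_nonneg (sq_nonneg (b + 2)) (sq_nonneg (u' c t)),
      mul_nonneg (sq_nonneg (y c t)) (sq_nonneg (u c t))]
  · refine Eventually.of_forall fun t ht => ?_
    rw [uIoc_of_le hT] at ht
    obtain ⟨h1, h2, h3⟩ := h.continuousWithinAt hb ht.1.le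
    exact ((h2.pow 2).sub (h1.mul (h1.sub ((h3.pow 2).mul h1)))).div ((h1.pow 2).add (h2.pow 2))
      ((h.prof b hb).sq_add_sq_pos (h.init_pos hb).ne' t).ne.symm

/-- The sign of the variation of `u` to first order in the initial value. -/
lemma eventually_variation (h : ProfileFamily y u u') (hb : √2 ≤ b) {v v' : ℝ → ℝ}
    (hv : Lin (y b) 0 v v') (hv0 : v 0 = 0) (hv'0 : v' 0 = 1) (hT : 0 ≤ T) (σ : ℝ) :
    (0 < σ * v T → ∀ᶠ c in 𝓝[>] b, 0 < σ * (u c T - u b T)) ∧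
    (0 < σ * v' T → ∀ᶠ c in 𝓝[>] b, 0 < σ * (u' c T - u' b T)) := by
  obtain ⟨L, hL, hL'⟩ := exists_quadratic_bound (h.prof b hb) hv hv0 hv'0 (B := b + 2) hT
    (fun t => (h.bound b hb t).trans (by linarith))
  have hsub : 𝓝[>] b ≤ 𝓝[Ici √2] b := nhdsWithin_mono b fun c (hc : b < c) => hb.trans hc.le
  have key : ∀ p q : ℝ → ℝ, ∀ w : ℝ, (∀ᶠ c in 𝓝[>] b, |p c - q c - (c - b) * w| ≤ L * |c - b| ^ 2) →
      0 < σ * w → ∀ᶠ c in 𝓝[>] b, 0 < σ * (p c - q c) := by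
    intro p q w hpq hw
    have h1 : ∀ᶠ c in 𝓝[>] b, |σ| * L * (c - b) < σ * w := by
      have : ContinuousAt (fun c => |σ| * L * (c - b)) b := by fun_prop
      exact (this.eventually (gt_mem_nhds (by simpa using hw))).filter_mono nhdsWithin_le_nhds
    filter_upwards [hpq, h1, self_mem_nhdsWithin] with c hc1 hc2 hc3
    have h2 : 0 < c - b := sub_pos.2 hc3
    rw [abs_of_pos h2] at hc1
    have h3 : |σ * (p c - q c) - (c - b) * (σ * w)| ≤ |σ| * (L * (c - b) ^ 2) := by
      rw [show σ * (p c - q c) - (c - b) * (σ * w) = σ * (p c - q c - (c - b) * w) by ring, abs_mul]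
      gcongr
    have h4 := (abs_le.1 h3).1
    have h5 := mul_lt_mul_of_pos_right hc2 h2
    nlinarith
  have hq : ∀ᶠ c in 𝓝[>] b, |u c T - u b T - (c - b) * v T| ≤ L * |c - b| ^ 2 ∧
      |u' c T - u' b T - (c - b) * v' T| ≤ L * |c - b| ^ 2 := by
    filter_upwards [(h.eventually_bound b).filter_mono hsub] with c hc
    have h1 := hL' hc.1 hc.2.2 T ⟨hT, le_rfl⟩
    rwa [hc.2.1, h.init b hb] at h1
  exact ⟨key (fun c => u c T) (fun _ => u b T) _ (hq.mono fun c hc => hc.1),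
    key (fun c => u' c T) (fun _ => u' b T) _ (hq.mono fun c hc => hc.2)⟩

/-- At a zero of `u b`, the angle increases with the initial value. -/
lemma eventually_angle_gt (h : ProfileFamily y u u') (hb : √2 ≤ b) (hT : 0 < T) (huT : u b T = 0) :
    ∀ᶠ c in 𝓝[>] b, angle (y b) (u b) (u' b) T < angle (y c) (u c) (u' c) T := by
  have hp := h.prof b hb
  have h0 := h.init_pos hb
  have hy := hp.cont
  obtain ⟨v, v', hv0, hv'0, hv, hv'⟩ := exists_linear_solution (q := fun t => 1 - 3 * y b t ^ 2)
    (F := 0) (by fun_prop) continuous_zero 0 0 1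
  have hu'T : u' b T ≠ 0 := fun h1 => h0.ne' (hp.eq_zero_of_data huT h1)
  have hE : 0 < Profile.energy (y b) (u b) (u' b) T := by
    have := sq_pos_of_ne_zero hu'T
    simp only [Profile.energy, huT]
    linarith
  have hcone := hp.cone_at_zeros ⟨hv, hv'⟩ (fun t ht => hE.trans_le (hp.antitone_energy ht.1 ht.2))
    h0 hv0 hv'0 T ⟨hT.le, le_rfl⟩ huT
  have hpos : 0 < u' b T * v T := by
    rcases hcone with ⟨h1, -, h2⟩ | ⟨h1, -, h2⟩
    · exact mul_pos h1 (h2 hT)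
    · exact mul_pos_of_neg_of_neg h1 (h2 hT)
  have hsub : 𝓝[>] b ≤ 𝓝[Ici √2] b := nhdsWithin_mono b fun c (hc : b < c) => hb.trans hc.le
  have hnear := (((h.continuousOn_angle hT.le) b hb).mono_left hsub).eventually
    (lt_mem_nhds (sub_lt_self _ Real.pi_pos))
  obtain ⟨r, hr⟩ := hp.exists_amplitude h0
  filter_upwards [(h.eventually_variation hb ⟨hv, hv'⟩ hv0 hv'0 hT.le (u' b T)).1 hpos, hnear,
    self_mem_nhdsWithin] with c hc1 hc2 hc3
  have hbc : √2 ≤ c := hb.trans (le_of_lt hc3)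
  obtain ⟨ρ, hρ⟩ := (h.prof c hbc).exists_amplitude (h.init_pos hbc)
  obtain ⟨r1, r2, r3⟩ := hr T
  obtain ⟨ρ1, ρ2, -⟩ := hρ T
  set θ := angle (y b) (u b) (u' b) T
  set φ := angle (y c) (u c) (u' c) T
  have hs : Real.sin θ = 0 := by
    rw [huT] at r2
    exact (mul_eq_zero.1 r2.symm).resolve_left r1.ne'
  have h1 : 0 < r T * ρ T * Real.sin (φ - θ) := by
    rw [Real.sin_sub, hs]
    rw [huT, ρ2, r3] at hc1
    linarith
  by_contra! hle
  have h2 := Real.sin_nonpos_of_nonpos_of_neg_pi_le (sub_nonpos.2 hle) (by linarith)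
  have h3 := mul_nonneg (mul_pos r1 ρ1).le (neg_nonneg.2 h2)
  linarith

/-- As the initial value grows, the angle crosses multiples of `π` only upwards. -/
lemma angle_barrier (h : ProfileFamily y u u') (hb : √2 ≤ b₁) (hle : b₁ ≤ b₂) (hT : 0 < T) {k : ℤ}
    (hk : k * Real.pi ≤ angle (y b₁) (u b₁) (u' b₁) T) :
    k * Real.pi ≤ angle (y b₂) (u b₂) (u' b₂) T := by
  have hc := h.continuousOn_angle hT.le
  have hc' : ContinuousOn (fun c => angle (y c) (u c) (u' c) T) (Icc b₁ b₂) :=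
    hc.mono fun c hc => hb.trans hc.1
  have := IsClosed.Icc_subset_of_forall_mem_nhdsWithin
    (s := {c | k * Real.pi ≤ angle (y c) (u c) (u' c) T}) (a := b₁) (b := b₂)
    (by
      have := hc'.preimage_isClosed_of_isClosed isClosed_Icc (isClosed_Ici (a := k * Real.pi))
      rwa [inter_comm] at this) hk (fun c hc1 => by
      have hbc : √2 ≤ c := hb.trans hc1.2.1
      rcases (show k * Real.pi ≤ angle (y c) (u c) (u' c) T from hc1.1).eq_or_lt with he | hl
      · filter_upwards [h.eventually_angle_gt hbc hT
          (((h.prof c hbc).eq_zero_iff_angle (h.init_pos hbc) T).2 ⟨k, he⟩)] with d hd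
        exact he.trans_le hd.le
      · have hsub : 𝓝[>] c ≤ 𝓝[Ici √2] c :=
          nhdsWithin_mono c fun d (hd : c < d) => hbc.trans hd.le
        filter_upwards [((hc c hbc).mono_left hsub).eventually (lt_mem_nhds hl)] with d hd
        exact le_of_lt hd)
  exact this ⟨hle, le_rfl⟩

end ProfileFamily

namespace Profile

variable {y u u' y₁ u₁ u₁' v v' : ℝ → ℝ} {z σ : ℝ}

/-- After its last zero, a decaying profile has constant sign `σ`, and the variation eventually has
the opposite sign. -/
lemma exists_signed_exit (h : Profile y u u') (hv : Lin y 0 v v') (hlim : Tendsto y atTop (𝓝 0))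
    (hz : 0 ≤ z) (huz : u z = 0) (hu : ∀ t, z < t → u t ≠ 0)
    (hH : ∀ t, z < t → 0 < Profile.energy y u u' t) (hcone : SignedCone u' v v' z) (T : ℝ) :
    ∃ σ : ℝ, (σ = 1 ∨ σ = -1) ∧ (∀ t, z < t → 0 < σ * u t) ∧
      ∃ T₀, T < T₀ ∧ σ * v T₀ < 0 ∧ σ * v' T₀ < 0 := by
  rcases hcone with ⟨h1, h2, -⟩ | ⟨h1, h2, -⟩
  · have hpos : ∀ t, z < t → 0 < u t := fun t ht =>
      pos_of_ne_zero h.continuous (ht.trans (lt_add_one t)) (fun s hs => hu s hs.1) huz (h.hu z)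
        h1 t
        ⟨ht, lt_add_one t⟩
    obtain ⟨T₀, h3, h4, h5⟩ := h.exists_exit hv hlim hz huz hpos h1 hH h2 T
    exact ⟨1, Or.inl rfl, by simpa using hpos, T₀, h3, by simpa using h4, by simpa using h5⟩
  · have hpos : ∀ t, z < t → 0 < -u t := fun t ht =>
      pos_of_ne_zero h.continuous.neg (ht.trans (lt_add_one t))
        (fun s hs => neg_ne_zero.2 (hu s hs.1)) (by simp [huz]) (h.neg.hu z) (neg_pos.2 h1) t
        ⟨ht, lt_add_one t⟩
    have hv' : Lin (fun t => -y t) 0 (fun t => -v t) (fun t => -v' t) :=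
      ⟨fun t => (hv.hx t).neg, fun t => (hv.hx' t).neg.congr_deriv (by simp)⟩
    obtain ⟨T₀, h3, h4, h5⟩ := h.neg.exists_exit hv' (by simpa using hlim.neg) hz (by simp [huz])
      hpos (neg_pos.2 h1) (by rwa [energy_neg]) h2 T
    exact ⟨-1, Or.inr rfl, by simpa using hpos, T₀, h3, by simpa using h4, by simpa using h5⟩

lemma exists_zero_after_of_sign (h₁ : Profile y₁ u₁ u₁') (h : Profile y u u')
    (hσ : σ = 1 ∨ σ = -1) (hlim : Tendsto y₁ atTop (𝓝 0)) {T : ℝ} (hT : 0 < T)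
    (hy₁ : ∀ t, T ≤ t → y₁ t ^ 2 < 1 / 3) (huT : 0 < -σ * (u T - u₁ T))
    (hu'T : 0 < -σ * (u' T - u₁' T)) (hpos : 0 < σ * u T) : ∃ T', T < T' ∧ u T' = 0 := by
  rcases hσ with rfl | rfl
  · exact h₁.exists_zero_after h hlim hT hy₁ (by linarith) (by linarith) (by linarith)
  · obtain ⟨T', h1, h2⟩ := h₁.neg.exists_zero_after h.neg (by simpa using hlim.neg) hT
      (by simpa using hy₁) (by linarith) (by linarith) (by linarith)
    exact ⟨T', h1, neg_eq_zero.1 h2⟩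

end Profile

namespace ProfileFamily

open Profile

variable {y u u' : ℝ → ℝ → ℝ} {b b₁ b₂ : ℝ}

/-- A larger initial value than that of an excited state produces more zeros. -/
lemma ncard_zeros_lt (h : ProfileFamily y u u') (hb : √2 ≤ b₁) (hlt : b₁ < b₂)
    (hlim : Tendsto (y b₁) atTop (𝓝 0)) (hfin₁ : {t | 0 < t ∧ u b₁ t = 0}.Finite)
    (hne : {t | 0 < t ∧ u b₁ t = 0}.Nonempty) (hfin₂ : {t | 0 < t ∧ u b₂ t = 0}.Finite) :
    {t | 0 < t ∧ u b₁ t = 0}.ncard < {t | 0 < t ∧ u b₂ t = 0}.ncard := by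
  obtain ⟨z, ⟨hz, huz⟩, hmax⟩ := hfin₁.isCompact.exists_isGreatest hne
  have hmax' : ∀ t, 0 < t → u b₁ t = 0 → t ≤ z := fun t h1 h2 => hmax ⟨h1, h2⟩
  set n := {t | 0 < t ∧ u b₁ t = 0}.ncard
  have hp := h.prof b₁ hb
  have h0 := h.init_pos hb
  have hy := hp.cont
  have hE := hp.energy_pos h0.ne' hlim
  obtain ⟨v, v', hv0, hv'0, hv, hv'⟩ := exists_linear_solution (q := fun t => 1 - 3 * y b₁ t ^ 2)
    (F := 0) (by fun_prop) continuous_zero 0 0 1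
  obtain ⟨T₁, -, hT₁⟩ := sq_le_eventually hlim (show (0 : ℝ) < 1 / 3 by norm_num)
  obtain ⟨σ, hσ, hpos, T₀, hT₀, hvT, hv'T⟩ := hp.exists_signed_exit ⟨hv, hv'⟩ hlim hz.le huz
    (fun t ht hut => absurd (hmax' t (hz.trans ht) hut) (not_le.2 ht))
    (fun t ht => hE t (hz.trans ht))
    (hp.cone_at_zeros ⟨hv, hv'⟩ (fun t ht => hE t ht.1) h0 hv0 hv'0 z ⟨hz.le, le_rfl⟩ huz)
    (max z T₁)
  have hzT : z < T₀ := (le_max_left _ _).trans_lt hT₀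
  have hTT : T₁ < T₀ := (le_max_right _ _).trans_lt hT₀
  have hT : 0 < T₀ := hz.trans hzT
  have hangle : (n : ℤ) * Real.pi < angle (y b₁) (u b₁) (u' b₁) T₀ :=
    hp.angle_barrier h0 hzT (by simpa using hp.ncard_zeros_le h0 hz.le huz hmax')
  have hsub : 𝓝[>] b₁ ≤ 𝓝[Ici √2] b₁ := nhdsWithin_mono b₁ fun c (hc : b₁ < c) => hb.trans hc.le
  have e1 := ((h.continuousOn_angle hT.le b₁ hb).mono_left hsub).eventually (lt_mem_nhds hangle)
  have e2 := (((h.continuousWithinAt hb hT.le).1.const_mul σ).mono_left hsub).eventually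
    (lt_mem_nhds (hpos T₀ hzT))
  have e3 := h.eventually_variation hb ⟨hv, hv'⟩ hv0 hv'0 hT.le (-σ)
  obtain ⟨c, ⟨⟨⟨hc1, hc2⟩, hc3⟩, hc4⟩, hc5⟩ := (((e1.and e2).and (e3.1 (by linarith))).and
    (e3.2 (by linarith))).and (Ioc_mem_nhdsGT hlt) |>.exists
  have hbc : √2 ≤ c := hb.trans hc5.1.le
  obtain ⟨T', hT', huT'⟩ := hp.exists_zero_after_of_sign (h.prof c hbc) hσ hlim hT
    (fun t ht => hT₁ t (hTT.le.trans ht)) hc3 hc4 hc2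
  obtain ⟨k, hk⟩ := ((h.prof c hbc).eq_zero_iff_angle (h.init_pos hbc) T').1 huT'
  have hk' := (h.prof c hbc).angle_barrier (h.init_pos hbc) hT' hc1.le
  rw [← hk] at hk'
  have hnk : (n : ℤ) + 1 ≤ k := by
    have : ((n : ℤ) : ℝ) < k := lt_of_mul_lt_mul_right hk' Real.pi_pos.le
    exact_mod_cast this
  have hb₂ : √2 ≤ b₂ := hb.trans hlt.le
  have hfinal := h.angle_barrier hbc hc5.2 (hT.trans hT') hk.le
  have := (h.prof b₂ hb₂).le_ncard_zeros (h.init_pos hb₂) hfin₂ (hT.trans hT').le (m := n + 1) (by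
    refine le_trans ?_ hfinal
    have : ((n + 1 : ℕ) : ℝ) ≤ k := by exact_mod_cast hnk
    have := Real.pi_pos
    gcongr)
  exact this

lemma of_excitedState (h : ProfileFamily y u u') (hb : √2 ≤ b) {n : ℕ} {w : ℝ → ℝ}
    (hw : IsExcitedState n b w) : {t | 0 < t ∧ u b t = 0}.Finite ∧
      {t | 0 < t ∧ u b t = 0}.ncard = n ∧ Tendsto (y b) atTop (𝓝 0) := by
  obtain ⟨⟨hsol, -, hlim⟩, hfin, hcard⟩ := hw
  have hu := ((h.prof b hb).unique hsol.profile (by simp [h.init b hb, hsol.1])).1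
  have hset : {t | 0 < t ∧ u b t = 0} = {t | 0 < t ∧ w t = 0} := by
    ext t
    refine and_congr_right fun ht => ?_
    simp [hu, abs_of_pos ht, ht.ne']
  refine ⟨hset ▸ hfin, hset ▸ hcard, hlim.congr' ?_⟩
  filter_upwards [eventually_gt_atTop 0] with t ht
  have h1 := congrFun hu t
  rw [(h.prof b hb).eq, abs_of_pos ht] at h1
  exact (mul_left_cancel₀ ht.ne' h1).symm

lemma not_lt_of_excitedState (h : ProfileFamily y u u') {n : ℕ} (hn : 1 ≤ n) (hb : √2 ≤ b₁)
    {w₁ w₂ : ℝ → ℝ} (h₁ : IsExcitedState n b₁ w₁) (h₂ : IsExcitedState n b₂ w₂) : ¬ b₁ < b₂ := by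
  intro hlt
  obtain ⟨hfin₁, hcard₁, hlim⟩ := h.of_excitedState hb h₁
  obtain ⟨hfin₂, hcard₂, -⟩ := h.of_excitedState (hb.trans hlt.le) h₂
  have := h.ncard_zeros_lt hb hlt hlim hfin₁
    ((ncard_pos hfin₁).1 (hcard₁ ▸ hn)) hfin₂
  omega

end ProfileFamily

end

/-- Uniqueness of the first twenty excited states. -/
theorem excited_states_unique (n : ℕ) (hn1 : 1 ≤ n) (hn2 : n ≤ 20)
    (b₁ b₂ : ℝ) (y₁ y₂ : ℝ → ℝ)
    (hb₁ : Real.sqrt 2 < b₁) (hb₂ : Real.sqrt 2 < b₂)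
    (h₁ : IsExcitedState n b₁ y₁) (h₂ : IsExcitedState n b₂ y₂) :
    b₁ = b₂ := by
  obtain ⟨y, u, u', h⟩ := exists_profileFamily
  exact le_antisymm (not_lt.1 (h.not_lt_of_excitedState hn1 hb₂.le h₂ h₁))
    (not_lt.1 (h.not_lt_of_excitedState hn1 hb₁.le h₁ h₂))
end
end

section
/- For every b ∈ ℝ, exactly one of the following holds as t → ∞: y_b(t) → −1, or y_b(t) → 0, or y_b(t) → 1; and in all cases ẏ_b(t) → 0. -/
noncomputable section

open Filter Topology Set

lemma le_of_hasDerivAt_nonpos {F F' : ℝ → ℝ} {s t : ℝ} (hst : s ≤ t)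
    (hF : ∀ x ∈ Icc s t, HasDerivAt F (F' x) x) (hF' : ∀ x ∈ Icc s t, F' x ≤ 0) :
    F t ≤ F s := by
  have h : AntitoneOn F (Icc s t) := by
    apply antitoneOn_of_deriv_nonpos (convex_Icc s t)
    · exact fun x hx => (hF x hx).continuousAt.continuousWithinAt
    · exact fun x hx => (hF x (interior_subset hx)).differentiableAt.differentiableWithinAt
    · intro x hx
      rw [(hF x (interior_subset hx)).deriv]
      exact hF' x (interior_subset hx)
  exact h (left_mem_Icc.2 hst) (right_mem_Icc.2 hst) hst

lemma exists_tendsto_of_antitone_of_bddBelow {F : ℝ → ℝ} {a m : ℝ}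
    (hF : ∀ s t, a ≤ s → s ≤ t → F t ≤ F s) (hm : ∀ t, a ≤ t → m ≤ F t) :
    ∃ l, Tendsto F atTop (𝓝 l) ∧ ∀ t, a ≤ t → l ≤ F t := by
  have hanti : Antitone fun t => F (max t a) := fun s t hst =>
    hF _ _ (le_max_right _ _) (max_le_max_right a hst)
  have hbdd : BddBelow (range fun t => F (max t a)) :=
    ⟨m, by rintro _ ⟨t, rfl⟩; exact hm _ (le_max_right _ _)⟩
  refine ⟨⨅ t, F (max t a), ?_, fun t ht => ?_⟩
  · refine (tendsto_atTop_ciInf hanti hbdd).congr' ?_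
    filter_upwards [eventually_ge_atTop a] with t ht
    rw [max_eq_left ht]
  · have := ciInf_le hbdd t
    rwa [max_eq_left ht] at this

/-- If a function and the square of its derivative both converge, the derivative
converges to zero. -/
lemma eq_zero_of_tendsto_of_tendsto_deriv_sq {F F' : ℝ → ℝ} {l m : ℝ}
    (hF : ∀ x, 0 < x → HasDerivAt F (F' x) x)
    (hl : Tendsto F atTop (𝓝 l)) (hm : Tendsto (fun x => F' x ^ 2) atTop (𝓝 m)) : m = 0 := by
  have hmv : ∀ t : ℝ, ∃ c, t ≤ c ∧ (0 < t → F' c = F (t + 1) - F t) := by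
    intro t
    by_cases ht : 0 < t
    · obtain ⟨c, hc, h⟩ := exists_hasDerivAt_eq_slope F F' (lt_add_one t)
        (fun x hx => (hF x (ht.trans_le hx.1)).continuousAt.continuousWithinAt)
        (fun x hx => hF x (ht.trans hx.1))
      exact ⟨c, hc.1.le, fun _ => by rw [h]; ring⟩
    · exact ⟨t, le_rfl, fun h => absurd h ht⟩
  choose c hc hc' using hmv
  have h1 : Tendsto (fun t => F' (c t) ^ 2) atTop (𝓝 m) :=
    hm.comp (tendsto_atTop_mono hc tendsto_id)
  have h2 : Tendsto (fun t => (F (t + 1) - F t) ^ 2) atTop (𝓝 ((l - l) ^ 2)) :=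
    ((hl.comp (tendsto_atTop_add_const_right _ 1 tendsto_id)).sub hl).pow 2
  have h3 : Tendsto (fun t => F' (c t) ^ 2) atTop (𝓝 ((l - l) ^ 2)) := by
    refine h2.congr' ?_
    filter_upwards [eventually_gt_atTop 0] with t ht
    rw [hc' t ht]
  rw [tendsto_nhds_unique h1 h3, sub_self, zero_pow two_ne_zero]

lemma pos_or_neg_of_continuousOn_of_ne_zero {F : ℝ → ℝ} {a : ℝ}
    (hF : ContinuousOn F (Ici a)) (hne : ∀ t ∈ Ici a, F t ≠ 0) :
    (∀ t ∈ Ici a, 0 < F t) ∨ ∀ t ∈ Ici a, F t < 0 := by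
  by_contra! h
  obtain ⟨⟨s, hs, hs0⟩, t, ht, ht0⟩ := h
  obtain ⟨x, hx, hx0⟩ := isPreconnected_Ici.intermediate_value hs ht hF ⟨hs0, ht0⟩
  exact hne x hx hx0

/-- A function bounded below cannot have derivative at most `-k / t` with `k > 0`. -/
lemma false_of_deriv_le_neg_div {F F' : ℝ → ℝ} {a k m : ℝ} (ha : 0 < a) (hk : 0 < k)
    (hF : ∀ x, a ≤ x → HasDerivAt F (F' x) x) (hF' : ∀ x, a ≤ x → F' x ≤ -k / x)
    (hm : ∀ x, a ≤ x → m ≤ F x) : False := by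
  have h1 : ∀ t, a ≤ t → F t + k * Real.log t ≤ F a + k * Real.log a := by
    intro t ht
    apply le_of_hasDerivAt_nonpos (F := fun t => F t + k * Real.log t)
      (F' := fun t => F' t + k * t⁻¹) ht
    · intro x hx
      exact (hF x hx.1).add ((Real.hasDerivAt_log (ha.trans_le hx.1).ne').const_mul k)
    · intro x hx
      have := hF' x hx.1
      rw [neg_div, div_eq_mul_inv] at this
      linarith
  have h2 : Tendsto (fun t => k * Real.log t) atTop atTop :=
    Real.tendsto_log_atTop.const_mul_atTop hk
  obtain ⟨t, ht, ht'⟩ := ((eventually_ge_atTop a).and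
    (h2.eventually_gt_atTop (F a + k * Real.log a - m))).exists
  linarith [h1 t ht, hm t ht]

namespace IsSolution

variable {b : ℝ} {y : ℝ → ℝ}

lemma hasDerivAt (hy : IsSolution b y) {t : ℝ} (ht : 0 < t) : HasDerivAt y (deriv y t) t :=
  (hy.2.2.1 t ht.le).hasDerivAt

lemma hasDerivAt_deriv (hy : IsSolution b y) {t : ℝ} (ht : 0 < t) :
    HasDerivAt (deriv y) (-(2 / t) * deriv y t - (y t ^ 3 - y t)) t := by
  refine (hy.2.2.2.1 t ht).hasDerivAt.congr_deriv ?_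
  linarith [hy.2.2.2.2 t ht]

lemma hasDerivAt_energy (hy : IsSolution b y) {t : ℝ} (ht : 0 < t) :
    HasDerivAt (energy y) (-(2 / t) * deriv y t ^ 2) t := by
  have h1 := hy.hasDerivAt ht
  have h2 := hy.hasDerivAt_deriv ht
  refine ((((h2.pow 2).const_mul (1 / 2)).add ((h1.pow 4).const_mul (1 / 4))).sub
    ((h1.pow 2).const_mul (1 / 2))).congr_deriv ?_
  push_cast
  ring

lemma energy_le (hy : IsSolution b y) {s t : ℝ} (hs : 0 < s) (hst : s ≤ t) :
    energy y t ≤ energy y s := by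
  refine le_of_hasDerivAt_nonpos hst (fun x hx => hy.hasDerivAt_energy (hs.trans_le hx.1)) ?_
  intro x hx
  have : 0 < x := hs.trans_le hx.1
  have : 0 ≤ 2 / x * deriv y x ^ 2 := by positivity
  linarith

end IsSolution

lemma energy_add_quarter (y : ℝ → ℝ) (t : ℝ) :
    energy y t + 1 / 4 = deriv y t ^ 2 / 2 + (y t ^ 2 - 1) ^ 2 / 4 := by
  unfold energy; ring

namespace IsSolution

variable {b : ℝ} {y : ℝ → ℝ}

lemma exists_bound (hy : IsSolution b y) :
    ∃ M, 1 ≤ M ∧ ∀ t, 1 ≤ t → |y t| ≤ M ∧ |deriv y t| ≤ M := by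
  refine ⟨4 * (energy y 1 + 1 / 4) + 3, ?_, fun t ht => ?_⟩
  · have := energy_add_quarter y 1
    nlinarith [sq_nonneg (deriv y 1), sq_nonneg (y 1 ^ 2 - 1)]
  · have h1 := hy.energy_le one_pos ht
    have h2 := energy_add_quarter y t
    have hd := sq_nonneg (deriv y t)
    have hq := sq_nonneg (y t ^ 2 - 1)
    constructor
    · apply abs_le_of_sq_le_sq (by nlinarith [sq_nonneg (y t ^ 2 - 1 - 1)]) (by linarith)
    · apply abs_le_of_sq_le_sq (by nlinarith) (by linarith)

lemma exists_tendsto_energy (hy : IsSolution b y) :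
    ∃ l, Tendsto (energy y) atTop (𝓝 l) ∧ ∀ t, 1 ≤ t → l ≤ energy y t := by
  refine exists_tendsto_of_antitone_of_bddBelow (m := -1 / 4)
    (fun s t hs hst => hy.energy_le (one_pos.trans_le hs) hst) fun t _ => ?_
  have := energy_add_quarter y t
  linarith [sq_nonneg (deriv y t), sq_nonneg (y t ^ 2 - 1)]

lemma tendsto_energy_of_neg (hy : IsSolution b y) {T : ℝ} (hT : 1 ≤ T) (hE : energy y T < 0) :
    Tendsto (energy y) atTop (𝓝 (-1 / 4)) := by
  obtain ⟨l, hl, hle⟩ := hy.exists_tendsto_energy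
  obtain ⟨M, hM1, hM⟩ := hy.exists_bound
  have hquarter : -1 / 4 ≤ l := by
    refine ge_of_tendsto' hl fun t => ?_
    have := energy_add_quarter y t
    linarith [sq_nonneg (deriv y t), sq_nonneg (y t ^ 2 - 1)]
  rcases hquarter.eq_or_lt with h | hL
  · rwa [h]
  exfalso
  set η := -energy y T with hη
  have hη0 : 0 < η := by linarith
  have hη1 : η ≤ 1 / 4 := by
    have := energy_add_quarter y T
    linarith [sq_nonneg (deriv y T), sq_nonneg (y T ^ 2 - 1)]
  set L := l + 1 / 4 with hLdef
  have hL0 : 0 < L := by linarith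
  set C := (M ^ 3 + M) * M with hC
  have hC0 : 0 < C := by positivity
  have hk : 0 < η * L := by positivity
  refine false_of_deriv_le_neg_div (a := max T (3 * C / (η * L))) (k := η * L)
    (m := 3 * M ^ 2 * (-1 / 4) - C)
    (F := fun t => 3 * M ^ 2 * energy y t + (y t ^ 3 - y t) * deriv y t / t)
    (F' := fun t => 3 * M ^ 2 * (-(2 / t) * deriv y t ^ 2) +
      ((3 * y t ^ 2 * deriv y t - deriv y t) * deriv y t +
        (y t ^ 3 - y t) * (-(2 / t) * deriv y t - (y t ^ 3 - y t))) / t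
      - (y t ^ 3 - y t) * deriv y t / t ^ 2)
    (lt_of_lt_of_le (by linarith) (le_max_left _ _)) hk ?_ ?_ ?_
  · intro t ht
    have ht0 : 0 < t := by linarith [le_max_left T (3 * C / (η * L))]
    have h1 := hy.hasDerivAt ht0
    have h2 := hy.hasDerivAt_deriv ht0
    refine (((hy.hasDerivAt_energy ht0).const_mul (3 * M ^ 2)).add
      ((((h1.pow 3).sub h1).mul h2).div (hasDerivAt_id t) ht0.ne')).congr_deriv ?_
    simp only [Pi.mul_apply, Pi.sub_apply, Pi.pow_apply, id]
    push_cast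
    field_simp
    ring
  · intro t ht
    have htT : T ≤ t := (le_max_left _ _).trans ht
    have ht0 : 0 < t := by linarith
    have hC' : 3 * C / t ≤ η * L := by
      have h := (le_max_right _ _).trans ht
      rw [div_le_iff₀ hk] at h
      rw [div_le_iff₀ ht0]
      linarith
    obtain ⟨hb1, hb2⟩ := hM t (hT.trans htT)
    have hfd : |(y t ^ 3 - y t) * deriv y t| ≤ C := by
      rw [abs_mul, hC]
      gcongr
      calc |y t ^ 3 - y t| ≤ |y t ^ 3| + |y t| := abs_sub _ _
        _ ≤ M ^ 3 + M := by rw [abs_pow]; gcongr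
    have hy2 : y t ^ 2 ≤ M ^ 2 := sq_le_sq' (by linarith [abs_le.1 hb1]) (abs_le.1 hb1).2
    have hE1 := hy.energy_le (by linarith) htT
    have hE2 := hle t (by linarith)
    have hE3 := energy_add_quarter y t
    have hyη : 2 * η ≤ y t ^ 2 := by
      have : energy y t = deriv y t ^ 2 / 2 + y t ^ 4 / 4 - y t ^ 2 / 2 := by
        unfold energy; ring
      nlinarith [sq_nonneg (deriv y t), sq_nonneg (y t ^ 2)]
    have key : 2 * (η * L) ≤
        (6 * M ^ 2 - 3 * y t ^ 2 + 1) * deriv y t ^ 2 + (y t ^ 3 - y t) ^ 2 := by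
      have e1 : (y t ^ 3 - y t) ^ 2 = y t ^ 2 * (y t ^ 2 - 1) ^ 2 := by ring
      have e2 : 2 * η * (y t ^ 2 - 1) ^ 2 ≤ y t ^ 2 * (y t ^ 2 - 1) ^ 2 := by gcongr
      have e3 : deriv y t ^ 2 ≤ (6 * M ^ 2 - 3 * y t ^ 2 + 1) * deriv y t ^ 2 := by
        apply le_mul_of_one_le_left (sq_nonneg _); nlinarith
      have e4 : η * L ≤ η * (deriv y t ^ 2 / 2 + (y t ^ 2 - 1) ^ 2 / 4) := by
        gcongr; linarith
      have e5 : η * deriv y t ^ 2 ≤ 1 / 4 * deriv y t ^ 2 := by gcongr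
      have e6 : 0 ≤ η * (y t ^ 2 - 1) ^ 2 := by positivity
      rw [e1]
      nlinarith [sq_nonneg (deriv y t)]
    have e7 : -(3 * ((y t ^ 3 - y t) * deriv y t) / t) ≤ 3 * C / t := by
      rw [← neg_div]
      gcongr
      linarith [neg_abs_le ((y t ^ 3 - y t) * deriv y t)]
    have e8 : 3 * M ^ 2 * (-(2 / t) * deriv y t ^ 2) +
      ((3 * y t ^ 2 * deriv y t - deriv y t) * deriv y t +
        (y t ^ 3 - y t) * (-(2 / t) * deriv y t - (y t ^ 3 - y t))) / t
      - (y t ^ 3 - y t) * deriv y t / t ^ 2 =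
      (-((6 * M ^ 2 - 3 * y t ^ 2 + 1) * deriv y t ^ 2 + (y t ^ 3 - y t) ^ 2) +
        -(3 * ((y t ^ 3 - y t) * deriv y t) / t)) / t := by
      field_simp
      ring
    simp only [e8]
    gcongr
    linarith
  · intro t ht
    have htT : T ≤ t := (le_max_left _ _).trans ht
    have ht0 : 0 < t := by linarith
    obtain ⟨hb1, hb2⟩ := hM t (hT.trans htT)
    have hfd : |(y t ^ 3 - y t) * deriv y t| ≤ C := by
      rw [abs_mul, hC]
      gcongr
      calc |y t ^ 3 - y t| ≤ |y t ^ 3| + |y t| := abs_sub _ _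
        _ ≤ M ^ 3 + M := by rw [abs_pow]; gcongr
    have h1 : |(y t ^ 3 - y t) * deriv y t / t| ≤ C := by
      rw [abs_div, abs_of_pos ht0]
      exact (div_le_self (abs_nonneg _) (hT.trans htT)).trans hfd
    have h2 : -1 / 4 ≤ energy y t := hquarter.trans (hle t (by linarith))
    have h3 : 3 * M ^ 2 * (-1 / 4) ≤ 3 * M ^ 2 * energy y t := by gcongr
    linarith [neg_abs_le ((y t ^ 3 - y t) * deriv y t / t)]

lemma tendsto_of_energy_neg (hy : IsSolution b y) {T : ℝ} (hT : 1 ≤ T) (hE : energy y T < 0) :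
    (Tendsto y atTop (𝓝 (-1)) ∨ Tendsto y atTop (𝓝 1)) ∧ Tendsto (deriv y) atTop (𝓝 0) := by
  have hlim : Tendsto (fun t => energy y t + 1 / 4) atTop (𝓝 0) := by
    have h := (hy.tendsto_energy_of_neg hT hE).add_const (1 / 4)
    rwa [show (-1 / 4 : ℝ) + 1 / 4 = 0 by norm_num] at h
  have hd : Tendsto (deriv y) atTop (𝓝 0) := by
    have : Tendsto (fun t => deriv y t ^ 2) atTop (𝓝 0) := by
      refine squeeze_zero (fun t => sq_nonneg _) (fun t => ?_)
        (by simpa using hlim.const_mul 2)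
      have := energy_add_quarter y t
      linarith [sq_nonneg (y t ^ 2 - 1)]
    have h := this.sqrt
    simp only [Real.sqrt_sq_eq_abs, Real.sqrt_zero] at h
    exact (tendsto_zero_iff_abs_tendsto_zero _).2 h
  have habs : Tendsto (fun t => |y t|) atTop (𝓝 1) := by
    have h0 : Tendsto (fun t => (y t ^ 2 - 1) ^ 2) atTop (𝓝 0) := by
      refine squeeze_zero (fun t => sq_nonneg _) (fun t => ?_)
        (by simpa using hlim.const_mul 4)
      have := energy_add_quarter y t
      linarith [sq_nonneg (deriv y t)]
    have h1 := h0.sqrt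
    simp only [Real.sqrt_sq_eq_abs, Real.sqrt_zero] at h1
    have h2 := (((tendsto_zero_iff_abs_tendsto_zero _).2 h1).add_const 1).sqrt
    simpa [Real.sqrt_sq_eq_abs] using h2
  have hne : ∀ t ∈ Ici T, y t ≠ 0 := by
    intro t ht h0
    have h1 := hy.energy_le (by linarith) ht
    have h2 : energy y t = deriv y t ^ 2 / 2 := by unfold energy; rw [h0]; ring
    linarith [sq_nonneg (deriv y t)]
  have hcont : ContinuousOn y (Ici T) := fun t ht =>
    (hy.hasDerivAt (by linarith [mem_Ici.1 ht])).continuousAt.continuousWithinAt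
  refine ⟨?_, hd⟩
  rcases pos_or_neg_of_continuousOn_of_ne_zero hcont hne with h | h
  · right
    refine habs.congr' ?_
    filter_upwards [eventually_ge_atTop T] with t ht
    exact abs_of_pos (h t ht)
  · left
    refine habs.neg.congr' ?_
    filter_upwards [eventually_ge_atTop T] with t ht
    rw [abs_of_neg (h t ht), neg_neg]

lemma tendsto_zero_of_frequently (hy : IsSolution b y) (hE : ∀ t, 1 ≤ t → 0 ≤ energy y t)
    (hcrit : ∃ᶠ t in atTop, deriv y t = 0) :
    Tendsto y atTop (𝓝 0) ∧ Tendsto (deriv y) atTop (𝓝 0) := by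
  obtain ⟨M, hM1, hM⟩ := hy.exists_bound
  -- The energy of `t * y t`, which solves an equation without damping term.
  let G : ℝ → ℝ := fun t => t ^ 2 * energy y t + t * (y t * deriv y t) + y t ^ 2 / 2
  have hG : ∀ t, 0 < t → HasDerivAt G (-(t * y t ^ 4 / 2)) t := by
    intro t ht
    have h1 := hy.hasDerivAt ht
    have h2 := hy.hasDerivAt_deriv ht
    have hid := hasDerivAt_id t
    refine ((((hid.pow 2).mul (hy.hasDerivAt_energy ht)).add
      (hid.mul (h1.mul h2))).add ((h1.pow 2).div_const 2)).congr_deriv ?_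
    simp only [Pi.mul_apply, Pi.pow_apply, id, energy]
    push_cast
    field_simp
    ring
  have hGle : ∀ s t, 1 ≤ s → s ≤ t → G t ≤ G s := by
    intro s t hs hst
    refine le_of_hasDerivAt_nonpos hst (fun x hx => hG x (by linarith [hx.1])) fun x hx => ?_
    have : 0 < x := by linarith [hx.1]
    have : 0 ≤ x * y x ^ 4 / 2 := by positivity
    linarith
  have hGnn : ∀ t, 1 ≤ t → 0 ≤ G t := by
    intro t ht
    obtain ⟨s, hs, hts⟩ := (hcrit.and_eventually (eventually_ge_atTop t)).exists
    refine le_trans ?_ (hGle t s ht hts)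
    have := hE s (ht.trans hts)
    simp only [G, hs, mul_zero, add_zero]
    positivity
  obtain ⟨g, hg, hgle⟩ := exists_tendsto_of_antitone_of_bddBelow hGle hGnn
  have hy0 : Tendsto y atTop (𝓝 0) := by
    rw [Metric.tendsto_nhds]
    intro ε hε
    have hh : 0 < ε / (2 * M) := by positivity
    have hc : 0 < (ε / 2) ^ 4 / 2 := by positivity
    have hev := hg.eventually_lt_const
      (show g < g + (ε / 2) ^ 4 / 2 * (ε / (2 * M)) from lt_add_of_pos_right _ (by positivity))
    filter_upwards [hev, eventually_ge_atTop 1] with s hs hs1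
    rw [dist_zero_right, Real.norm_eq_abs]
    by_contra! hys
    have hlow : ∀ x ∈ Icc s (s + ε / (2 * M)), ε / 2 ≤ |y x| := by
      intro x hx
      have h1 := (convex_Icc s (s + ε / (2 * M))).norm_image_sub_le_of_norm_deriv_le
        (f := y) (C := M) (fun z hz => (hy.hasDerivAt (by linarith [hz.1])).differentiableAt)
        (fun z hz => (hM z (by linarith [hz.1])).2) (left_mem_Icc.2 (by linarith)) hx
      rw [Real.norm_eq_abs, Real.norm_eq_abs, abs_of_nonneg (sub_nonneg.2 hx.1)] at h1
      have h2 : M * (x - s) ≤ M * (ε / (2 * M)) := by gcongr; linarith [hx.2]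
      have h3 : M * (ε / (2 * M)) = ε / 2 := by field_simp
      have h4 := abs_sub_abs_le_abs_sub (y s) (y x)
      rw [abs_sub_comm] at h4
      linarith
    have hdrop := le_of_hasDerivAt_nonpos (s := s) (t := s + ε / (2 * M)) (by linarith)
      (F := fun x => G x + (ε / 2) ^ 4 / 2 * x)
      (F' := fun x => -(x * y x ^ 4 / 2) + (ε / 2) ^ 4 / 2 * 1)
      (fun x hx => (hG x (by linarith [hx.1])).add ((hasDerivAt_id x).const_mul _))
      (fun x hx => by
        have h1 : (ε / 2) ^ 4 ≤ |y x| ^ 4 := by gcongr; exact hlow x hx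
        rw [Even.pow_abs (by decide)] at h1
        have h2 : 1 * y x ^ 4 ≤ x * y x ^ 4 := by gcongr; linarith [hx.1]
        linarith)
    have := hgle (s + ε / (2 * M)) (by linarith)
    simp only [mul_add] at hdrop
    linarith
  refine ⟨hy0, ?_⟩
  obtain ⟨l, hl, -⟩ := hy.exists_tendsto_energy
  have hsq : Tendsto (fun t => deriv y t ^ 2) atTop (𝓝 (2 * l)) := by
    have := ((hl.const_mul 2).sub ((hy0.pow 4).const_mul (1 / 2))).add (hy0.pow 2)
    simp only [ne_eq, OfNat.ofNat_ne_zero, not_false_eq_true, zero_pow, mul_zero, sub_zero,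
      add_zero] at this
    refine this.congr fun t => ?_
    unfold energy; ring
  have hl0 : 2 * l = 0 := by
    by_contra hne
    exact hcrit ((hsq.eventually_ne hne).mono fun t ht h => ht (by simp [h]))
  rw [hl0] at hsq
  have h := hsq.sqrt
  simp only [Real.sqrt_sq_eq_abs, Real.sqrt_zero] at h
  exact (tendsto_zero_iff_abs_tendsto_zero _).2 h

lemma exists_tendsto_of_deriv_ne_zero (hy : IsSolution b y) {T : ℝ} (hT : 1 ≤ T)
    (hne : ∀ t ∈ Ici T, deriv y t ≠ 0) : ∃ l, Tendsto y atTop (𝓝 l) := by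
  obtain ⟨M, -, hM⟩ := hy.exists_bound
  have hcont : ContinuousOn (deriv y) (Ici T) := fun t ht =>
    (hy.hasDerivAt_deriv (by linarith [mem_Ici.1 ht])).continuousAt.continuousWithinAt
  rcases pos_or_neg_of_continuousOn_of_ne_zero hcont hne with h | h
  · obtain ⟨l, hl, -⟩ := exists_tendsto_of_antitone_of_bddBelow (F := fun t => -y t) (a := T)
      (m := -M)
      (fun s t hs hst => le_of_hasDerivAt_nonpos (F := fun t => -y t)
        (F' := fun t => -deriv y t) hst
        (fun x hx => (hy.hasDerivAt (by linarith [hx.1])).neg)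
        (fun x hx => by linarith [h x (hs.trans hx.1)]))
      (fun t ht => by linarith [(abs_le.1 (hM t (by linarith)).1).2])
    exact ⟨-l, by simpa using hl.neg⟩
  · obtain ⟨l, hl, -⟩ := exists_tendsto_of_antitone_of_bddBelow (F := y) (a := T)
      (m := -M)
      (fun s t hs hst => le_of_hasDerivAt_nonpos hst
        (fun x hx => hy.hasDerivAt (by linarith [hx.1]))
        (fun x hx => (h x (hs.trans hx.1)).le))
      (fun t ht => (abs_le.1 (hM t (by linarith)).1).1)
    exact ⟨l, hl⟩

lemma limit_is_equilibrium (hy : IsSolution b y) {l : ℝ} (hl : Tendsto y atTop (𝓝 l)) :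
    l ^ 3 - l = 0 ∧ Tendsto (deriv y) atTop (𝓝 0) := by
  have hd : Tendsto (deriv y) atTop (𝓝 0) := by
    obtain ⟨e, he, -⟩ := hy.exists_tendsto_energy
    have hsq : Tendsto (fun t => deriv y t ^ 2) atTop
        (𝓝 (2 * e - 1 / 2 * l ^ 4 + l ^ 2)) := by
      refine (((he.const_mul 2).sub ((hl.pow 4).const_mul (1 / 2))).add (hl.pow 2)).congr
        fun t => ?_
      unfold energy; ring
    rw [eq_zero_of_tendsto_of_tendsto_deriv_sq (fun x hx => hy.hasDerivAt hx) hl hsq] at hsq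
    have h := hsq.sqrt
    simp only [Real.sqrt_sq_eq_abs, Real.sqrt_zero] at h
    exact (tendsto_zero_iff_abs_tendsto_zero _).2 h
  refine ⟨?_, hd⟩
  have h2 : Tendsto (fun t : ℝ => 2 / t) atTop (𝓝 0) := tendsto_const_nhds.div_atTop tendsto_id
  have h3 := eq_zero_of_tendsto_of_tendsto_deriv_sq (fun x hx => hy.hasDerivAt_deriv hx) hd
    (((h2.neg.mul hd).sub ((hl.pow 3).sub hl)).pow 2)
  have h4 := pow_eq_zero_iff two_ne_zero |>.1 h3
  linarith

end IsSolution

theorem limit_trichotomy (b : ℝ) (y : ℝ → ℝ) (hy : IsSolution b y) :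
    (Filter.Tendsto y Filter.atTop (nhds (-1)) ∨
     Filter.Tendsto y Filter.atTop (nhds 0) ∨
     Filter.Tendsto y Filter.atTop (nhds 1)) ∧
    Filter.Tendsto (deriv y) Filter.atTop (nhds 0) := by
  by_cases hE : ∃ T, 1 ≤ T ∧ energy y T < 0
  · obtain ⟨T, hT, hE⟩ := hE
    obtain ⟨h, hd⟩ := hy.tendsto_of_energy_neg hT hE
    exact ⟨h.imp_right Or.inr, hd⟩
  push Not at hE
  by_cases hcrit : ∃ᶠ t in atTop, deriv y t = 0
  · obtain ⟨h, hd⟩ := hy.tendsto_zero_of_frequently hE hcrit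
    exact ⟨Or.inr (Or.inl h), hd⟩
  · obtain ⟨T, hT⟩ := eventually_atTop.1 (not_frequently.1 hcrit)
    obtain ⟨l, hl⟩ := hy.exists_tendsto_of_deriv_ne_zero (le_max_right T 1)
      fun t ht => hT t ((le_max_left T 1).trans ht)
    obtain ⟨hl0, hd⟩ := hy.limit_is_equilibrium hl
    refine ⟨?_, hd⟩
    have hfac : (l + 1) * (l * (l - 1)) = 0 := by linear_combination hl0
    rcases mul_eq_zero.1 hfac with h | h
    · exact Or.inl (by rwa [eq_neg_of_add_eq_zero_left h] at hl)
    rcases mul_eq_zero.1 h with h | h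
    · exact Or.inr (Or.inl (by rwa [h] at hl))
    · exact Or.inr (Or.inr (by rwa [sub_eq_zero.1 h] at hl))
end
end
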